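/- Let X be a minimal Banach space with a Schauder basis and not containing an isomorphic copy of ℓ₁. Then for every λ > 1 there exists a family {Y_ξ : ξ < ω₁} of separable Banach spaces with the following properties: (i) for every ξ < ω₁ the space Y_ξ is an 𝓛_{∞,λ+}-space and does not contain an isomorphic copy of X; (ii) if ξ < ζ < ω₁, then Y_ξ embeds isomorphically into Y_ζ; (iii) every separable Banach space Z with φ_{NC_X}(Z) ≤ ξ embeds isomorphically into Y_ξ. -/

import Mathlib

open Filter Topology MeasureTheory

noncomputable section

/-! ### The Cantor set and the space `C(2^ℕ)` -/

/-- The Cantor set `2^ℕ`. -/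
abbrev CantorSet : Type := ℕ → Bool

/-- The Banach space `C(2^ℕ)` of continuous real-valued functions on the Cantor set. -/
abbrev CantorC : Type := C(CantorSet, ℝ)

/-! ### The standard Borel space `SB` of separable Banach spaces -/

/-- `SB`: the set of closed linear subspaces of `C(2^ℕ)`. -/
def SB : Type := {Y : Submodule ℝ CantorC // IsClosed (Y : Set CantorC)}

/-- The Effros-Borel σ-algebra on `SB`, generated by the sets
`{Y : Y ∩ U ≠ ∅}` for `U` open in `C(2^ℕ)`. -/
instance : MeasurableSpace SB :=
  MeasurableSpace.generateFrom
    {A : Set SB | ∃ U : Set CantorC, IsOpen U ∧ A = {Y : SB | ((Y.1 : Set CantorC) ∩ U).Nonempty}}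

/-- A subset of a standard Borel space is analytic if it is the image of a Borel map
from the Baire space `ℕ^ℕ`. -/
def IsAnalyticIn {α : Type*} [MeasurableSpace α] (A : Set α) : Prop :=
  ∃ f : (ℕ → ℕ) → α, Measurable f ∧ A = Set.range f

/-! ### Embeddings, isomorphisms, universality -/

/-- `X` embeds isomorphically into `Y`: there is a bounded linear map which is
bounded below, i.e. an isomorphism onto its range. -/
def Embeds (X Y : Type*) [SeminormedAddCommGroup X] [NormedSpace ℝ X]
    [SeminormedAddCommGroup Y] [NormedSpace ℝ Y] : Prop :=
  ∃ (T : X →L[ℝ] Y) (c : ℝ), 0 < c ∧ ∀ x : X, c * ‖x‖ ≤ ‖T x‖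

/-- `X` embeds isometrically into `Y` (i.e. `Y` contains an isometric copy of `X`). -/
def EmbedsIsometrically (X Y : Type*) [SeminormedAddCommGroup X] [NormedSpace ℝ X]
    [SeminormedAddCommGroup Y] [NormedSpace ℝ Y] : Prop :=
  Nonempty (X →ₗᵢ[ℝ] Y)

/-- `X` and `Y` are isomorphic Banach spaces (linearly homeomorphic). -/
def IsomorphicTo (X Y : Type*) [SeminormedAddCommGroup X] [NormedSpace ℝ X]
    [SeminormedAddCommGroup Y] [NormedSpace ℝ Y] : Prop :=
  Nonempty (X ≃L[ℝ] Y)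

/-- The class `NU ⊆ SB` of non-universal spaces: those `X ∈ SB` which do not contain
an isomorphic copy of `C(2^ℕ)` (equivalently, are not universal for all separable
Banach spaces). -/
def NU : Set SB := {Y : SB | ¬ Embeds CantorC Y.1}

/-- The class `NC_X ⊆ SB` of all `Y ∈ SB` containing no isomorphic copy of `X`. -/
def NCin (X : Type*) [SeminormedAddCommGroup X] [NormedSpace ℝ X] : Set SB :=
  {Y : SB | ¬ Embeds X Y.1}

/-! ### Schauder bases -/

/-- `x` is a Schauder basis of `E`: every vector has a unique representation as a
norm convergent series `Σ aₙ • xₙ`. -/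
def IsSchauderBasis {E : Type*} [SeminormedAddCommGroup E] [NormedSpace ℝ E]
    (x : ℕ → E) : Prop :=
  ∀ y : E, ∃! a : ℕ → ℝ,
    Tendsto (fun m => ∑ n ∈ Finset.range m, a n • x n) atTop (𝓝 y)

/-- `E` has a Schauder basis. -/
def HasSchauderBasis (E : Type*) [SeminormedAddCommGroup E] [NormedSpace ℝ E] : Prop :=
  ∃ x : ℕ → E, IsSchauderBasis x

/-- `x` is a monotone basis sequence: initial-segment projections have norm at most 1. -/
def IsMonotoneSeq {E : Type*} [SeminormedAddCommGroup E] [NormedSpace ℝ E]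
    (x : ℕ → E) : Prop :=
  ∀ (a : ℕ → ℝ) (k m : ℕ), k ≤ m →
    ‖∑ n ∈ Finset.range k, a n • x n‖ ≤ ‖∑ n ∈ Finset.range m, a n • x n‖

/-- `x` is a bi-monotone sequence: interval projections have norm at most 1. -/
def IsBimonotoneSeq {E : Type*} [SeminormedAddCommGroup E] [NormedSpace ℝ E]
    (x : ℕ → E) : Prop :=
  ∀ (a : ℕ → ℝ) (j k m : ℕ), j ≤ k → k ≤ m →
    ‖∑ n ∈ Finset.Ico j k, a n • x n‖ ≤ ‖∑ n ∈ Finset.range m, a n • x n‖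

/-- `x` is a Schauder basic sequence: it is a Schauder basis of its closed linear span. -/
def IsSchauderBasicSeq {E : Type*} [NormedAddCommGroup E] [NormedSpace ℝ E]
    (x : ℕ → E) : Prop :=
  ∀ y ∈ (Submodule.span ℝ (Set.range x)).topologicalClosure,
    ∃! a : ℕ → ℝ,
      Tendsto (fun m => ∑ n ∈ Finset.range m, a n • x n) atTop (𝓝 y)

/-! ### Trees, ordinal ranks and Bourgain's index -/

/-- A tree on `Λ`: a set of finite sequences closed under initial segments. -/
def IsTree {Λ : Type*} (T : Set (List Λ)) : Prop :=
  ∀ s t : List Λ, s <+: t → t ∈ T → s ∈ T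

/-- A pruned tree: every node has a proper extension in the tree. -/
def IsPruned {Λ : Type*} (T : Set (List Λ)) : Prop :=
  ∀ t ∈ T, ∃ a : Λ, t ++ [a] ∈ T

/-- `σ` is an infinite branch of `T`. -/
def IsBranch {Λ : Type*} (T : Set (List Λ)) (σ : ℕ → Λ) : Prop :=
  ∀ n : ℕ, (List.ofFn fun i : Fin n => σ i) ∈ T

/-- `T` is ill-founded: it has an infinite branch. -/
def TreeIllFounded {Λ : Type*} (T : Set (List Λ)) : Prop :=
  ∃ σ : ℕ → Λ, IsBranch T σ

/-- The derivative of a tree: its non-maximal nodes, i.e. nodes having a proper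
extension in the tree. -/
def treeDeriv {Λ : Type*} (T : Set (List Λ)) : Set (List Λ) :=
  {l | l ∈ T ∧ ∃ a : Λ, l ++ [a] ∈ T}

/-- The iterated derivatives `T^(ξ)` of a tree, defined by transfinite recursion. -/
def treeDerivIter {Λ : Type*} (T : Set (List Λ)) (ξ : Ordinal.{0}) : Set (List Λ) :=
  Ordinal.limitRecOn ξ T (fun _ S => treeDeriv S)
    (fun o _ ih => ⋂ (o' : Ordinal.{0}) (h : o' < o), ih o' h)

/-- The ordinal rank `o(T)` of a (well-founded) tree: the least `ξ` with `T^(ξ) = ∅`. -/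
def treeRank {Λ : Type*} (T : Set (List Λ)) : Ordinal.{0} :=
  sInf {ξ : Ordinal.{0} | treeDerivIter T ξ = ∅}

/-- The first uncountable ordinal `ω₁`. -/
def omega1 : Ordinal.{0} := (Cardinal.aleph 1).ord

/-- Bourgain's tree `T(Y, (e_n), δ)`: all finite sequences `(y_0, …, y_k)` in `Y`
which are `δ`-equivalent to `(e_0, …, e_k)`. -/
def bourgainTree {W : Type*} [SeminormedAddCommGroup W] [NormedSpace ℝ W] (e : ℕ → W)
    (δ : ℝ) (Y : Type*) [SeminormedAddCommGroup Y] [NormedSpace ℝ Y] : Set (List Y) :=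
  {l : List Y | ∀ a : ℕ → ℝ,
    δ * ‖∑ i ∈ Finset.range l.length, a i • e i‖ ≤
        ‖∑ i ∈ Finset.range l.length, a i • l.getD i 0‖ ∧
    ‖∑ i ∈ Finset.range l.length, a i • l.getD i 0‖ ≤
        δ⁻¹ * ‖∑ i ∈ Finset.range l.length, a i • e i‖}

open Classical in
/-- Bourgain's ordinal index of `Y` relative to a (normalized Schauder) basis `(e_n)`
of a space `W`: it equals `ω₁` if some tree `T(Y, (e_n), δ)` is ill-founded, and
otherwise `sup_{0 < δ ≤ 1} o(T(Y, (e_n), δ))`.  With `W = C(2^ℕ)` this is `φ_NU`,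
and with `W = Z` it is `φ_{NC_Z}`. -/
def bourgainIndex {W : Type*} [SeminormedAddCommGroup W] [NormedSpace ℝ W] (e : ℕ → W)
    (Y : Type*) [SeminormedAddCommGroup Y] [NormedSpace ℝ Y] : Ordinal.{0} :=
  if ∃ δ ∈ Set.Ioc (0:ℝ) 1, TreeIllFounded (bourgainTree e δ Y) then omega1
  else ⨆ δ : Set.Ioc (0:ℝ) 1, treeRank (bourgainTree e δ.1 Y)

/-! ### The Schur property and the Radon-Nikodym property -/

/-- `X` has the Schur property: weakly convergent sequences are norm convergent. -/
def HasSchurProperty (X : Type*) [SeminormedAddCommGroup X] [NormedSpace ℝ X] : Prop :=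
  ∀ (f : ℕ → X) (x : X),
    (∀ φ : X →L[ℝ] ℝ, Tendsto (fun n => φ (f n)) atTop (𝓝 (φ x))) →
    Tendsto f atTop (𝓝 x)

/-- `X` has the Radon-Nikodym property: on every finite measure space, every
`X`-valued vector measure of bounded variation which is absolutely continuous
with respect to the measure has a Bochner-integrable density. -/
def HasRNP (X : Type*) [NormedAddCommGroup X] [NormedSpace ℝ X] : Prop :=
  ∀ (Ω : Type) [MeasurableSpace Ω] (μ : Measure Ω), IsFiniteMeasure μ →
    ∀ τ : VectorMeasure Ω X,
      (∀ s : Set Ω, MeasurableSet s → μ s = 0 → τ s = 0) →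
      (∃ C : ℝ, ∀ P : Finset (Set Ω), (∀ s ∈ P, MeasurableSet s) →
        ((P : Set (Set Ω)).Pairwise fun s t => Disjoint s t) →
        ∑ s ∈ P, ‖τ s‖ ≤ C) →
      ∃ g : Ω → X, Integrable g μ ∧
        ∀ s : Set Ω, MeasurableSet s → τ s = ∫ x in s, g x ∂μ

/-! ### `𝓛_{∞,λ}`-spaces -/

/-- The Banach-Mazur distance from `G` to `ℓ∞^n` is at most `θ`, witnessed by an
isomorphism `e` with `‖e‖ ⬝ ‖e⁻¹‖ ≤ θ'` for every `θ' > θ`. -/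
def BMdistToLinftyLE (G : Type*) [SeminormedAddCommGroup G] [NormedSpace ℝ G]
    (n : ℕ) (θ : ℝ) : Prop :=
  ∀ θ' : ℝ, θ < θ' → ∃ e : G ≃L[ℝ] (Fin n → ℝ),
    ‖(e : G →L[ℝ] (Fin n → ℝ))‖ * ‖(e.symm : (Fin n → ℝ) →L[ℝ] G)‖ ≤ θ'

/-- `X` is an (infinite-dimensional) `𝓛_{∞,λ}`-space: every finite-dimensional subspace
`F` of `X` is contained in a finite-dimensional subspace `G` with `d(G, ℓ∞^(dim G)) ≤ λ`. -/
def IsLinftyLam (lam : ℝ) (X : Type*) [NormedAddCommGroup X] [NormedSpace ℝ X] : Prop :=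
  (¬ FiniteDimensional ℝ X) ∧
  ∀ F : Submodule ℝ X, FiniteDimensional ℝ F →
    ∃ G : Submodule ℝ X, F ≤ G ∧ FiniteDimensional ℝ G ∧
      BMdistToLinftyLE G (Module.finrank ℝ G) lam

/-- `X` is an `𝓛_{∞,λ+}`-space: it is an `𝓛_{∞,θ}`-space for every `θ > λ`. -/
def IsLinftyPlus (lam : ℝ) (X : Type*) [NormedAddCommGroup X] [NormedSpace ℝ X] : Prop :=
  ∀ θ : ℝ, lam < θ → IsLinftyLam θ X

/-! ### Minimal spaces and `ℓ₁` -/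

/-- The space `ℓ₁`. -/
abbrev EllOne : Type := lp (fun _ : ℕ => ℝ) 1

/-- `X` is a minimal Banach space: it is infinite-dimensional and embeds isomorphically
into every infinite-dimensional (closed) subspace of itself. -/
def IsMinimal (X : Type*) [NormedAddCommGroup X] [NormedSpace ℝ X] : Prop :=
  (¬ FiniteDimensional ℝ X) ∧
  ∀ Z : Submodule ℝ X, IsClosed (Z : Set X) → ¬ FiniteDimensional ℝ Z → Embeds X Z

end

open Filter Topology MeasureTheory

/-! ### Part 1: Banach–Mazur, general facts on embeddings -/

theorem embedsIso_cantorC (W : Type*) [NormedAddCommGroup W] [NormedSpace ℝ W]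
    [TopologicalSpace.SeparableSpace W] : Nonempty (W →ₗᵢ[ℝ] CantorC) := by
  classical
  let K : Set (WeakDual ℝ W) := WeakDual.toStrongDual ⁻¹' Metric.closedBall 0 1
  have hK : IsCompact K := WeakDual.isCompact_closedBall 0 1
  haveI : TopologicalSpace.MetrizableSpace K := WeakDual.metrizable_of_isCompact ℝ W K hK
  haveI : CompactSpace K := isCompact_iff_compactSpace.mp hK
  letI : MetricSpace K := TopologicalSpace.metrizableSpaceMetric K
  haveI : Nonempty K := ⟨⟨0, by simp [K]⟩⟩
  obtain ⟨f, hf, hs⟩ := exists_nat_bool_continuous_surjective_of_compact K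
  have hev : ∀ w : W, Continuous fun s : ℕ → Bool => ((f s : WeakDual ℝ W)) w := fun w =>
    (WeakDual.eval_continuous w).comp (continuous_subtype_val.comp hf)
  let L : W →ₗ[ℝ] CantorC :=
    { toFun := fun w => ⟨fun s => ((f s : WeakDual ℝ W)) w, hev w⟩
      map_add' := by intro a b; ext s; simp
      map_smul' := by intro a b; ext s; simp }
  refine ⟨⟨L, fun w => le_antisymm ?_ ?_⟩⟩
  · refine (ContinuousMap.norm_le _ (norm_nonneg _)).2 fun s => ?_
    have h1 : ‖WeakDual.toStrongDual (f s : WeakDual ℝ W)‖ ≤ 1 := by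
      exact mem_closedBall_zero_iff.1 (f s).2
    calc ‖L w s‖ = ‖WeakDual.toStrongDual (f s : WeakDual ℝ W) w‖ := rfl
      _ ≤ 1 * ‖w‖ := ContinuousLinearMap.le_of_opNorm_le _ h1 w
      _ = ‖w‖ := one_mul _
  · obtain ⟨g, hg, hgw⟩ := exists_dual_vector'' ℝ w
    obtain ⟨s, hs⟩ := hs ⟨StrongDual.toWeakDual g, by simpa [K] using hg⟩
    have : L w s = ‖w‖ := by
      change ((f s : WeakDual ℝ W)) w = _
      rw [hs]; exact hgw
    calc ‖w‖ = ‖L w s‖ := by rw [this]; simp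
      _ ≤ ‖L w‖ := ContinuousMap.norm_coe_le_norm _ s

theorem Embeds.trans' {X Y Z : Type*} [SeminormedAddCommGroup X] [NormedSpace ℝ X]
    [SeminormedAddCommGroup Y] [NormedSpace ℝ Y] [SeminormedAddCommGroup Z] [NormedSpace ℝ Z]
    (h : Embeds X Y) (h' : Embeds Y Z) : Embeds X Z := by
  obtain ⟨T, c, hc, hT⟩ := h
  obtain ⟨S, d, hd, hS⟩ := h'
  refine ⟨S.comp T, d * c, by positivity, fun x => ?_⟩
  calc d * c * ‖x‖ = d * (c * ‖x‖) := by ring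
    _ ≤ d * ‖T x‖ := by gcongr; exact hT x
    _ ≤ _ := hS _

theorem embeds_of_linearIsometry {X Y : Type*} [SeminormedAddCommGroup X] [NormedSpace ℝ X]
    [SeminormedAddCommGroup Y] [NormedSpace ℝ Y] (T : X →ₗᵢ[ℝ] Y) : Embeds X Y :=
  ⟨T.toContinuousLinearMap, 1, one_pos, fun x => by simp⟩

/-- the `SB`-copy of a separable Banach space -/
theorem exists_SB (W : Type*) [NormedAddCommGroup W] [NormedSpace ℝ W] [CompleteSpace W]
    [TopologicalSpace.SeparableSpace W] : ∃ Y : SB, Nonempty (W ≃ₗᵢ[ℝ] Y.1) := by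
  obtain ⟨T⟩ := embedsIso_cantorC W
  refine ⟨⟨LinearMap.range T.toLinearMap, ?_⟩, ⟨T.equivRange⟩⟩
  exact T.isometry.isClosedEmbedding.isClosed_range

theorem embeds_of_isometryEquiv {X Y : Type*} [SeminormedAddCommGroup X] [NormedSpace ℝ X]
    [SeminormedAddCommGroup Y] [NormedSpace ℝ Y] (T : X ≃ₗᵢ[ℝ] Y) : Embeds X Y :=
  embeds_of_linearIsometry T.toLinearIsometry

theorem isLinftyPlus_of_isometryEquiv {lam : ℝ} {X Y : Type*} [NormedAddCommGroup X]
    [NormedSpace ℝ X] [NormedAddCommGroup Y] [NormedSpace ℝ Y] (T : X ≃ₗᵢ[ℝ] Y)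
    (h : IsLinftyPlus lam X) : IsLinftyPlus lam Y := by
  intro θ hθ
  obtain ⟨h1, h2⟩ := h θ hθ
  refine ⟨fun hf => h1 (LinearEquiv.finiteDimensional T.symm.toLinearEquiv), fun F hF => ?_⟩
  obtain ⟨G, hFG, hG, hd⟩ := h2 (F.map T.symm.toLinearEquiv.toLinearMap) inferInstance
  refine ⟨G.map T.toLinearEquiv.toLinearMap, ?_, inferInstance, ?_⟩
  · intro y hy
    refine ⟨T.symm y, hFG ⟨y, hy, rfl⟩, by simp⟩
  · intro θ' hθ'
    obtain ⟨e, he⟩ := hd θ' hθ'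
    have hfr : Module.finrank ℝ (G.map T.toLinearEquiv.toLinearMap) = Module.finrank ℝ G :=
      LinearEquiv.finrank_map_eq T.toLinearEquiv G
    rw [hfr]
    let S : G ≃ₗᵢ[ℝ] (G.map T.toLinearEquiv.toLinearMap) :=
      ⟨T.toLinearEquiv.submoduleMap G, fun x => T.norm_map x⟩
    refine ⟨S.symm.toContinuousLinearEquiv.trans e, ?_⟩
    refine le_trans ?_ he
    gcongr
    · refine ContinuousLinearMap.opNorm_le_bound _ (norm_nonneg _) fun x => ?_
      have := ContinuousLinearMap.le_opNorm
        (e : G →L[ℝ] (Fin (Module.finrank ℝ G) → ℝ)) (S.symm x)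
      rwa [S.symm.norm_map] at this
    · refine ContinuousLinearMap.opNorm_le_bound _ (norm_nonneg _) fun x => ?_
      have := ContinuousLinearMap.le_opNorm
        (e.symm : (Fin (Module.finrank ℝ G) → ℝ) →L[ℝ] G) x
      rw [← S.norm_map] at this
      exact this

open Filter Topology MeasureTheory

/-! ### Part 2: tools -/

noncomputable section

theorem exists_seq_strong {α : Type*} [Nonempty α] (P : ℕ → (ℕ → α) → α → Prop)
    (h : ∀ n f, ∃ a, P n f a) :
    ∃ f : ℕ → α, ∀ n, ∃ f' : ℕ → α, (∀ k < n, f' k = f k) ∧ P n f' (f n) := by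
  classical
  choose F hF using h
  let a0 : α := Classical.arbitrary α
  let G : (n : ℕ) → ((m : ℕ) → m < n → α) → α := fun n prev =>
    F n (fun k => if hk : k < n then prev k hk else a0)
  let f : ℕ → α := fun n => Nat.strongRec (motive := fun _ => α) G n
  refine ⟨f, fun n => ⟨fun k => if k < n then f k else a0, fun k hk => by simp [hk], ?_⟩⟩
  have : f n = F n (fun k => if k < n then f k else a0) := by
    change Nat.strongRec (motive := fun _ => α) G n = _
    rw [Nat.strongRec_eq]; rfl
  rw [this]
  exact hF n _

theorem exists_unit_ker {X : Type*} [NormedAddCommGroup X] [NormedSpace ℝ X]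
    (hX : ¬ FiniteDimensional ℝ X) (Φ : Set (X →L[ℝ] ℝ)) (hΦ : Φ.Finite) :
    ∃ x : X, ‖x‖ = 1 ∧ ∀ f ∈ Φ, f x = 0 := by
  have := hΦ.to_subtype
  let L : X →ₗ[ℝ] (Φ → ℝ) := LinearMap.pi fun f => (f.1 : X →ₗ[ℝ] ℝ)
  have hL : ¬ Function.Injective L := fun hi => hX (FiniteDimensional.of_injective L hi)
  rw [← LinearMap.ker_eq_bot] at hL
  obtain ⟨y, hy, hy0⟩ := (Submodule.ne_bot_iff _).1 hL
  refine ⟨‖y‖⁻¹ • y, ?_, fun f hf => ?_⟩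
  · rw [norm_smul, norm_inv, norm_norm, inv_mul_cancel₀ (norm_ne_zero_iff.2 hy0)]
  · have : L y ⟨f, hf⟩ = 0 := by rw [LinearMap.mem_ker.1 hy]; rfl
    have h2 : f y = 0 := this
    simp [h2]

abbrev lc {V : Type*} [AddCommGroup V] [Module ℝ V] (x : ℕ → V) : (ℕ →₀ ℝ) →ₗ[ℝ] V :=
  Finsupp.linearCombination ℝ x

theorem lc_eq_sum_range {V : Type*} [AddCommGroup V] [Module ℝ V] (x : ℕ → V) (a : ℕ →₀ ℝ)
    {N : ℕ} (hN : ∀ k ∈ a.support, k < N) : lc x a = ∑ k ∈ Finset.range N, a k • x k := by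
  rw [Finsupp.linearCombination_apply]
  exact Finsupp.sum_of_support_subset _ (fun k hk => Finset.mem_range.2 (hN k hk)) _ (by simp)

theorem exists_bound_support (a : ℕ →₀ ℝ) : ∃ N, ∀ k ∈ a.support, k < N :=
  ⟨a.support.sup id + 1, fun _ hk => Nat.lt_succ_of_le (Finset.le_sup (f := id) hk)⟩

theorem sel {X : Type*} [NormedAddCommGroup X] [NormedSpace ℝ X] (Q : ℕ → X → Prop)
    (h : ∀ k, ∀ Φ : Set (X →L[ℝ] ℝ), Φ.Finite → ∃ x : X, ‖x‖ = 1 ∧ Q k x ∧ ∀ f ∈ Φ, f x = 0) :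
    ∃ x : ℕ → X, (∀ k, ‖x k‖ = 1 ∧ Q k (x k)) ∧
      ∀ (a : ℕ →₀ ℝ) (k : ℕ), |a k| ≤ 2 ^ k * ‖lc x a‖ := by
  obtain ⟨F, hF⟩ := exists_seq_strong (α := X × (X →L[ℝ] ℝ))
    (fun n f p => ‖p.1‖ = 1 ∧ Q n p.1 ∧ ‖p.2‖ ≤ 1 ∧ p.2 p.1 = 1 ∧ ∀ k < n, (f k).2 p.1 = 0)
    (by
      intro n f
      obtain ⟨x, hx1, hQ, hx⟩ := h n ((fun k => (f k).2) '' Set.Iio n)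
        ((Set.finite_Iio n).image _)
      obtain ⟨g, hg, hgx⟩ := exists_dual_vector'' ℝ x
      refine ⟨(x, g), hx1, hQ, hg, by simpa [hx1] using hgx, fun k hk => ?_⟩
      exact hx _ ⟨k, hk, rfl⟩)
  have hx1 : ∀ n, ‖(F n).1‖ = 1 := fun n => by obtain ⟨f', _, h⟩ := hF n; exact h.1
  have hQ : ∀ n, Q n (F n).1 := fun n => by obtain ⟨f', _, h⟩ := hF n; exact h.2.1
  have hg : ∀ n, ‖(F n).2‖ ≤ 1 := fun n => by obtain ⟨f', _, h⟩ := hF n; exact h.2.2.1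
  have hgx : ∀ n, (F n).2 (F n).1 = 1 := fun n => by obtain ⟨f', _, h⟩ := hF n; exact h.2.2.2.1
  have hz : ∀ n, ∀ k < n, (F k).2 (F n).1 = 0 := fun n k hk => by
    obtain ⟨f', hf', h⟩ := hF n
    rw [← hf' k hk]; exact h.2.2.2.2 k hk
  refine ⟨fun n => (F n).1, fun n => ⟨hx1 n, hQ n⟩, fun a => ?_⟩
  intro k
  induction k using Nat.strong_induction_on with
  | _ k ih =>
    obtain ⟨N, hN⟩ := exists_bound_support a
    set y := lc (fun n => (F n).1) a with hy
    have hy2 : y = ∑ j ∈ Finset.range (N + (k + 1)), a j • (F j).1 :=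
      lc_eq_sum_range _ a fun j hj => lt_of_lt_of_le (hN j hj) (by omega)
    have h1 : (F k).2 y = ∑ j ∈ Finset.range k, a j * (F k).2 (F j).1 + a k := by
      rw [hy2, map_sum]
      rw [add_comm N, Finset.sum_range_add]
      rw [Finset.sum_range_succ]
      rw [Finset.sum_eq_zero (s := Finset.range N)]
      · simp [hgx]
      · intro j _
        rw [map_smul, hz (k + 1 + j) k (by omega), smul_zero]
    have h2 : |(F k).2 y| ≤ ‖y‖ := by
      have := ContinuousLinearMap.le_of_opNorm_le _ (hg k) y
      simpa using this
    have h3 : |∑ j ∈ Finset.range k, a j * (F k).2 (F j).1| ≤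
        ∑ j ∈ Finset.range k, 2 ^ j * ‖y‖ := by
      refine (Finset.abs_sum_le_sum_abs _ _).trans (Finset.sum_le_sum fun j hj => ?_)
      have h4 : |(F k).2 (F j).1| ≤ 1 := by
        have := ContinuousLinearMap.le_of_opNorm_le _ (hg k) (F j).1
        simpa [hx1] using this
      rw [abs_mul]
      calc |a j| * |(F k).2 (F j).1| ≤ |a j| * 1 := by gcongr
        _ ≤ _ := by rw [mul_one]; exact ih j (Finset.mem_range.1 hj)
    have h5 : ∑ j ∈ Finset.range k, (2:ℝ) ^ j * ‖y‖ = (2 ^ k - 1) * ‖y‖ := by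
      rw [← Finset.sum_mul, geom_sum_eq (by norm_num)]; norm_num
    have h6 : a k = (F k).2 y - ∑ j ∈ Finset.range k, a j * (F k).2 (F j).1 := by rw [h1]; ring
    calc |a k| ≤ |(F k).2 y| + |∑ j ∈ Finset.range k, a j * (F k).2 (F j).1| := by
          rw [h6]; exact abs_sub _ _
      _ ≤ ‖y‖ + (2 ^ k - 1) * ‖y‖ := by rw [← h5]; gcongr
      _ = _ := by ring

/-! #### completions of seminormed spaces -/

/-- type synonym carrying a seminorm -/
def SN {V : Type*} [AddCommGroup V] [Module ℝ V] (_p : Seminorm ℝ V) : Type _ := V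

section SN
variable {V : Type*} [AddCommGroup V] [Module ℝ V] (p : Seminorm ℝ V)

instance : SeminormedAddCommGroup (SN p) :=
  p.toAddGroupSeminorm.toSeminormedAddCommGroup

instance : Module ℝ (SN p) := inferInstanceAs (Module ℝ V)

instance : NormedSpace ℝ (SN p) where
  norm_smul_le a b := le_of_eq (map_smul_eq_mul p a b)

/-- completion of a seminormed space -/
abbrev Cmp : Type _ := UniformSpace.Completion (SN p)

/-- canonical map -/
def toCmp : V →ₗ[ℝ] Cmp p :=
  (UniformSpace.Completion.toComplL (𝕜 := ℝ) (E := SN p)).toLinearMap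

theorem norm_toCmp (v : V) : ‖toCmp p v‖ = p v :=
  UniformSpace.Completion.norm_coe (E := SN p) v

theorem denseRange_toCmp : DenseRange (toCmp p) :=
  UniformSpace.Completion.denseRange_coe (α := SN p)

theorem approx_toCmp (y : Cmp p) {η : ℝ} (hη : 0 < η) : ∃ v, ‖y - toCmp p v‖ < η := by
  obtain ⟨v, hv⟩ := (denseRange_toCmp p).exists_dist_lt y hη
  exact ⟨v, by rwa [dist_eq_norm] at hv⟩

theorem exists_liftCmp {W : Type*} [NormedAddCommGroup W] [NormedSpace ℝ W] [CompleteSpace W]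
    (f : V →ₗ[ℝ] W) (C : ℝ) (hf : ∀ v, ‖f v‖ ≤ C * p v) :
    ∃ F : Cmp p →L[ℝ] W, (∀ v, F (toCmp p v) = f v) ∧ (∀ y, ‖F y‖ ≤ C * ‖y‖) ∧
      ∀ c : ℝ, (∀ v, c * p v ≤ ‖f v‖) → ∀ y, c * ‖y‖ ≤ ‖F y‖ := by
  let f0 : SN p →ₗ[ℝ] W := f
  let f' : SN p →L[ℝ] W := f0.mkContinuous C hf
  let F := f'.extend (UniformSpace.Completion.toComplL (𝕜 := ℝ) (E := SN p))
  have hF : ∀ v, F (toCmp p v) = f v := fun v =>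
    ContinuousLinearMap.extend_eq (E := SN p) (Eₗ := Cmp p) f'
      (UniformSpace.Completion.denseRange_coe (α := SN p))
      (UniformSpace.Completion.isUniformInducing_coe (SN p)) v
  refine ⟨F, hF, fun y => ?_, fun c hc y => ?_⟩
  · refine (denseRange_toCmp p).induction_on (p := fun y => ‖F y‖ ≤ C * ‖y‖) y
      (isClosed_le (by fun_prop) (by fun_prop)) fun v => ?_
    rw [hF, norm_toCmp]; exact hf v
  · refine (denseRange_toCmp p).induction_on (p := fun y => c * ‖y‖ ≤ ‖F y‖) y
      (isClosed_le (by fun_prop) (by fun_prop)) fun v => ?_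
    rw [hF, norm_toCmp]; exact hc v

/-- finite norming families -/
theorem finite_norming (G : Submodule ℝ V) [FiniteDimensional ℝ G] {θ : ℝ} (hθ : θ < 1) :
    ∃ Φ : Set (V →ₗ[ℝ] ℝ), Φ.Finite ∧ Φ.Nonempty ∧ (∀ g ∈ Φ, ∀ v, |g v| ≤ p v) ∧
      ∀ v ∈ G, ∃ g ∈ Φ, θ * p v ≤ g v := by
  let G' : Submodule ℝ (Cmp p) := G.map (toCmp p)
  have : FiniteDimensional ℝ G' := inferInstance
  have hc : IsCompact (Metric.sphere (0 : G') 1) := isCompact_sphere _ _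
  choose g hg1 hg2 using fun y : Cmp p => exists_dual_vector'' ℝ y
  obtain ⟨t, ht⟩ := hc.elim_finite_subcover (ι := G')
    (fun y => Metric.ball y ((1 - θ) / 2)) (fun _ => Metric.isOpen_ball)
    (fun y _ => Set.mem_iUnion.2 ⟨y, Metric.mem_ball_self (by linarith)⟩)
  refine ⟨insert 0 ((fun y : G' => ((g y.1 : Cmp p →ₗ[ℝ] ℝ).comp (toCmp p))) '' (t : Set G')),
    (t.finite_toSet.image _).insert _, ⟨0, Set.mem_insert _ _⟩, ?_, ?_⟩
  · rintro _ (rfl | ⟨y, _, rfl⟩) v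
    · simp
    · have := ContinuousLinearMap.le_of_opNorm_le _ (hg1 y.1) (toCmp p v)
      rw [norm_toCmp] at this
      simpa using this
  · intro v hv
    by_cases h0 : p v = 0
    · exact ⟨0, Set.mem_insert _ _, by simp [h0]⟩
    have hpos : 0 < p v := lt_of_le_of_ne (apply_nonneg p v) (Ne.symm h0)
    let u : G' := ⟨toCmp p ((p v)⁻¹ • v), ⟨_, G.smul_mem _ hv, rfl⟩⟩
    have hu : ‖u‖ = 1 := by
      change ‖toCmp p ((p v)⁻¹ • v)‖ = 1
      rw [norm_toCmp, map_smul_eq_mul, norm_inv, Real.norm_of_nonneg hpos.le,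
        inv_mul_cancel₀ h0]
    have hmem := ht (show u ∈ Metric.sphere (0 : G') 1 by simpa using hu)
    simp only [Set.mem_iUnion, Metric.mem_ball] at hmem
    obtain ⟨y, hy, hd⟩ := hmem
    have hn1 : ‖(y : Cmp p) - u‖ < (1 - θ) / 2 := by
      rw [dist_comm, dist_eq_norm] at hd; exact hd
    refine ⟨_, Set.mem_insert_of_mem _ ⟨y, hy, rfl⟩, ?_⟩
    have hy1 : 1 - (1 - θ) / 2 ≤ ‖(y : Cmp p)‖ := by
      have h1 : ‖(u : Cmp p)‖ ≤ ‖(y : Cmp p)‖ + ‖(y : Cmp p) - u‖ := by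
        have := norm_sub_norm_le (u : Cmp p) y
        rw [norm_sub_rev] at this; linarith
      have h2 : ‖(u : Cmp p)‖ = 1 := hu
      linarith
    have h3 : |g y ((y : Cmp p) - u)| ≤ ‖(y : Cmp p) - u‖ := by
      have := ContinuousLinearMap.le_of_opNorm_le _ (hg1 y.1) ((y : Cmp p) - u)
      simpa using this
    have h4 : g y.1 (u : Cmp p) = (p v)⁻¹ * g y.1 (toCmp p v) := by
      change g y.1 (toCmp p ((p v)⁻¹ • v)) = _
      rw [map_smul, map_smul, smul_eq_mul]
    have h5 : θ ≤ g y.1 (u : Cmp p) := by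
      have h6 := hg2 y.1
      rw [map_sub, h6] at h3
      have h7 := (abs_le.1 h3).2
      simp only [Real.coe_toNNReal', RCLike.ofReal_real_eq_id, id] at h7
      linarith
    change θ * p v ≤ g y.1 (toCmp p v)
    rw [h4] at h5
    calc θ * p v ≤ ((p v)⁻¹ * g y.1 (toCmp p v)) * p v := by gcongr
      _ = _ := by field_simp
end SN

/-! #### extension and `ℓ₁` lemmas -/

theorem embeds_of_seq {X W : Type*} [NormedAddCommGroup X] [NormedSpace ℝ X] [CompleteSpace X]
    [NormedAddCommGroup W] [NormedSpace ℝ W] [CompleteSpace W] (hmin : IsMinimal X)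
    (x : ℕ → X) (w : ℕ → W) (hx : LinearIndependent ℝ x) (c C : ℝ) (hc : 0 < c)
    (h1 : ∀ a : ℕ →₀ ℝ, c * ‖lc x a‖ ≤ ‖lc w a‖) (h2 : ∀ a : ℕ →₀ ℝ, ‖lc w a‖ ≤ C * ‖lc x a‖) :
    Embeds X W := by
  let p : Seminorm ℝ (ℕ →₀ ℝ) := (normSeminorm ℝ X).comp (lc x)
  have hp : ∀ a, p a = ‖lc x a‖ := fun a => rfl
  obtain ⟨F, hF, hF2, hF3⟩ := exists_liftCmp p (lc x) 1 (fun a => by rw [hp, one_mul])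
  have hFn : ∀ y, ‖F y‖ = ‖y‖ := fun y => le_antisymm (by simpa using hF2 y)
    (by simpa using hF3 1 (fun a => by rw [hp, one_mul]) y)
  let Fi : Cmp p →ₗᵢ[ℝ] X := ⟨F.toLinearMap, hFn⟩
  have hcl : IsClosed ((LinearMap.range Fi.toLinearMap : Submodule ℝ X) : Set X) :=
    Fi.isometry.isClosedEmbedding.isClosed_range
  obtain ⟨S, hS, _, hS3⟩ := exists_liftCmp p (lc w) C h2
  have hmem : ∀ k, x k ∈ (LinearMap.range Fi.toLinearMap : Submodule ℝ X) := fun k =>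
    ⟨toCmp p (Finsupp.single k 1), by
      change F _ = _
      rw [hF]; simp [lc]⟩
  have hinf : ¬ FiniteDimensional ℝ (LinearMap.range Fi.toLinearMap : Submodule ℝ X) := by
    intro hfd
    have hli : LinearIndependent ℝ
        (fun k => (⟨x k, hmem k⟩ : (LinearMap.range Fi.toLinearMap : Submodule ℝ X))) :=
      LinearIndependent.of_comp (Submodule.subtype _) hx
    have := hli.finite
    exact not_finite ℕ
  have hE := hmin.2 _ hcl hinf
  refine hE.trans' ((embeds_of_isometryEquiv Fi.equivRange.symm).trans' ⟨S, c, hc, ?_⟩)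
  exact hS3 c h1

theorem linearIndependent_of_bound {X : Type*} [NormedAddCommGroup X] [NormedSpace ℝ X]
    (x : ℕ → X) (K : ℕ → ℝ) (h : ∀ (a : ℕ →₀ ℝ) (k : ℕ), |a k| ≤ K k * ‖lc x a‖) :
    LinearIndependent ℝ x := by
  rw [linearIndependent_iff]
  intro a ha
  ext k
  have := h a k
  rw [show lc x a = 0 from ha] at this
  simpa using this

theorem embeds_ellOne {X : Type*} [NormedAddCommGroup X] [NormedSpace ℝ X] [CompleteSpace X]
    (x : ℕ → X) (C c : ℝ) (hc : 0 < c) (hx : ∀ k, ‖x k‖ ≤ C)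
    (h : ∀ (n : ℕ) (a : ℕ → ℝ), c * ∑ k ∈ Finset.range n, |a k| ≤
      ‖∑ k ∈ Finset.range n, a k • x k‖) : Embeds EllOne X := by
  have hsum : ∀ a : EllOne, Summable fun k => ‖a k‖ := fun a => by
    have := lp.memℓp a
    rw [memℓp_gen_iff (by norm_num)] at this
    simpa using this
  have hnorm : ∀ a : EllOne, ‖a‖ = ∑' k, ‖a k‖ := fun a => by
    rw [lp.norm_eq_tsum_rpow (by norm_num)]; simp
  have hC : 0 ≤ C := (norm_nonneg _).trans (hx 0)
  have hb : ∀ (a : EllOne) k, ‖a k • x k‖ ≤ ‖a k‖ * C := fun a k => by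
    rw [norm_smul]; gcongr; exact hx k
  have hsx : ∀ a : EllOne, Summable fun k => a k • x k := fun a =>
    Summable.of_norm_bounded ((hsum a).mul_right C) (hb a)
  let L : EllOne →ₗ[ℝ] X :=
    { toFun := fun a => ∑' k, a k • x k
      map_add' := fun a b => by
        rw [← (hsx a).tsum_add (hsx b)]; congr 1; funext k; simp [add_smul]
      map_smul' := fun r a => by
        simp only [RingHom.id_apply]
        rw [← (hsx a).tsum_const_smul]; congr 1; funext k; simp [mul_smul] }
  refine ⟨L.mkContinuous C fun a => ?_, c, hc, fun a => ?_⟩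
  · rw [hnorm, mul_comm, ← tsum_mul_right]
    exact tsum_of_norm_bounded ((hsum a).mul_right C).hasSum (hb a)
  · change c * ‖a‖ ≤ ‖∑' k, a k • x k‖
    rw [hnorm]
    exact le_of_tendsto_of_tendsto' ((hsum a).hasSum.tendsto_sum_nat.const_mul c)
      (hsx a).hasSum.tendsto_sum_nat.norm fun n => h n _

/-- stepwise construction of `ℓ₁`. -/
theorem step_l1 {X V : Type*} [NormedAddCommGroup X] [NormedSpace ℝ X] [CompleteSpace X]
    [AddCommGroup V] [Module ℝ V] (p D : Seminorm ℝ V) (C : ℝ) (hD : ∀ v, D v ≤ C * p v)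
    (S : X →L[ℝ] Cmp p) (c : ℝ) (hc : 0 < c)
    (h : ∀ (n : ℕ) (e : ℕ → V),
      (∀ a : ℕ → ℝ, c / 2 * ∑ j ∈ Finset.range n, |a j| ≤ D (∑ j ∈ Finset.range n, a j • e j)) →
      ∀ θ < 1, ∀ η > 0, ∃ (x : X) (e' : V), ‖x‖ = 1 ∧ ‖S x - toCmp p e'‖ ≤ η ∧
        ∀ (a : ℕ → ℝ) (t : ℝ), θ * D (∑ j ∈ Finset.range n, a j • e j) + c * |t| ≤
          D (∑ j ∈ Finset.range n, a j • e j + t • e')) : Embeds EllOne X := by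
  let b : ℕ → ℝ := fun k => c / 2 * (1 + (1 / 2) ^ k)
  have hb0 : ∀ k, 0 < b k := fun k => by positivity
  have hbc : ∀ k, b k ≤ c := fun k => by
    have : (1 / 2 : ℝ) ^ k ≤ 1 := pow_le_one₀ (by norm_num) (by norm_num)
    simp only [b]; nlinarith
  have hbc2 : ∀ k, c / 2 ≤ b k := fun k => by
    have : 0 ≤ (1 / 2 : ℝ) ^ k := by positivity
    simp only [b]; nlinarith
  have hbs : ∀ k, b (k + 1) / b k < 1 := fun k => by
    rw [div_lt_one (hb0 k)]
    have : 0 < (1 / 2 : ℝ) ^ k := by positivity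
    simp only [b, pow_succ]; nlinarith
  let C' := |C| + 1
  have hC' : 0 < C' := by positivity
  let η := c / (4 * C')
  have hη : 0 < η := by positivity
  obtain ⟨F, hF⟩ := exists_seq_strong (α := X × V)
    (fun n f q => (∀ a : ℕ → ℝ, c / 2 * ∑ j ∈ Finset.range n, |a j| ≤
        D (∑ j ∈ Finset.range n, a j • (f j).2)) →
      ‖q.1‖ = 1 ∧ ‖S q.1 - toCmp p q.2‖ ≤ η ∧
        ∀ (a : ℕ → ℝ) (t : ℝ), b (n + 1) / b n * D (∑ j ∈ Finset.range n, a j • (f j).2) + c * |t| ≤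
          D (∑ j ∈ Finset.range n, a j • (f j).2 + t • q.2))
    (by
      intro n f
      by_cases hh : (∀ a : ℕ → ℝ, c / 2 * ∑ j ∈ Finset.range n, |a j| ≤
        D (∑ j ∈ Finset.range n, a j • (f j).2))
      · obtain ⟨x, e', h1, h2, h3⟩ := h n (fun j => (f j).2) hh _ (hbs n) η hη
        exact ⟨(x, e'), fun _ => ⟨h1, h2, h3⟩⟩
      · exact ⟨(0, 0), fun h' => absurd h' hh⟩)
  have hF' : ∀ n, (∀ a : ℕ → ℝ, c / 2 * ∑ j ∈ Finset.range n, |a j| ≤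
        D (∑ j ∈ Finset.range n, a j • (F j).2)) →
      ‖(F n).1‖ = 1 ∧ ‖S (F n).1 - toCmp p (F n).2‖ ≤ η ∧
        ∀ (a : ℕ → ℝ) (t : ℝ), b (n + 1) / b n * D (∑ j ∈ Finset.range n, a j • (F j).2) + c * |t| ≤
          D (∑ j ∈ Finset.range n, a j • (F j).2 + t • (F n).2) := by
    intro n
    obtain ⟨f', hf', h1⟩ := hF n
    have : ∀ a : ℕ → ℝ, ∑ j ∈ Finset.range n, a j • (f' j).2 =
        ∑ j ∈ Finset.range n, a j • (F j).2 := fun a =>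
      Finset.sum_congr rfl fun j hj => by rw [hf' j (Finset.mem_range.1 hj)]
    simpa only [this] using h1
  have key : ∀ n, ∀ a : ℕ → ℝ, b n * ∑ j ∈ Finset.range n, |a j| ≤
        D (∑ j ∈ Finset.range n, a j • (F j).2) := by
    intro n
    induction n with
    | zero => intro a; simp
    | succ n ih =>
      intro a
      have h0 := hF' n fun a => le_trans (by gcongr; exact hbc2 n) (ih a)
      rw [Finset.sum_range_succ, Finset.sum_range_succ]
      refine le_trans ?_ (h0.2.2 a (a n))
      rw [mul_add]
      have h1 : b (n + 1) * ∑ j ∈ Finset.range n, |a j| =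
        b (n + 1) / b n * (b n * ∑ j ∈ Finset.range n, |a j|) := by
          rw [← mul_assoc, div_mul_cancel₀ _ (hb0 n).ne']
      rw [h1]
      have := hb0 n
      have := hb0 (n + 1)
      gcongr
      · exact ih a
      · exact hbc (n + 1)
  have key2 : ∀ n, ∀ a : ℕ → ℝ, c / 2 * ∑ j ∈ Finset.range n, |a j| ≤
        D (∑ j ∈ Finset.range n, a j • (F j).2) := fun n a =>
    le_trans (by gcongr; exact hbc2 n) (key n a)
  refine embeds_ellOne (fun k => (F k).1) 1 (c / (4 * (C' * (‖S‖ + 1)))) (by positivity)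
    (fun k => (hF' k (key2 k)).1.le) fun n a => ?_
  set x := ∑ k ∈ Finset.range n, a k • (F k).1
  set e := ∑ k ∈ Finset.range n, a k • (F k).2
  set s := ∑ k ∈ Finset.range n, |a k|
  have hs : 0 ≤ s := Finset.sum_nonneg fun _ _ => abs_nonneg _
  have h1 : ‖S x - toCmp p e‖ ≤ s * η := by
    have : S x - toCmp p e = ∑ k ∈ Finset.range n, a k • (S (F k).1 - toCmp p (F k).2) := by
      simp only [x, e, map_sum, map_smul, smul_sub, Finset.sum_sub_distrib]
    rw [this, Finset.sum_mul]
    refine (norm_sum_le _ _).trans (Finset.sum_le_sum fun k _ => ?_)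
    rw [norm_smul, Real.norm_eq_abs]
    gcongr
    exact (hF' k (key2 k)).2.1
  have h2 : p e ≤ ‖S‖ * ‖x‖ + s * η := by
    rw [← norm_toCmp]
    have := norm_sub_norm_le (toCmp p e) (S x)
    rw [norm_sub_rev] at this
    have h3 := S.le_opNorm x
    linarith
  have h3 : D e ≤ C' * p e := (hD e).trans (by
    gcongr; exact (le_abs_self C).trans (by simp [C']))
  have h4 := key2 n a
  have h5 : c / 2 * s ≤ C' * (‖S‖ * ‖x‖ + s * η) := h4.trans (h3.trans (by gcongr))
  have h6 : C' * (s * η) = c / 4 * s := by simp only [η]; field_simp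
  have h7 : c / 4 * s ≤ C' * ((‖S‖ + 1) * ‖x‖) := by
    have : C' * (‖S‖ * ‖x‖) ≤ C' * ((‖S‖ + 1) * ‖x‖) := by gcongr; linarith
    nlinarith
  rw [div_mul_eq_mul_div, div_le_iff₀ (by positivity)]
  nlinarith

end

open Filter Topology MeasureTheory

noncomputable section

theorem pert_bound {X W : Type*} [NormedAddCommGroup X] [NormedSpace ℝ X]
    [SeminormedAddCommGroup W] [NormedSpace ℝ W] (x : ℕ → X) (w : ℕ → W) (ε : ℝ) (hε : 0 ≤ ε)
    (h : ∀ (a : ℕ →₀ ℝ) (k : ℕ), |a k| ≤ 2 ^ k * ‖lc x a‖)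
    (hw : ∀ k, ‖w k‖ ≤ ε * (1 / 4) ^ k) (a : ℕ →₀ ℝ) : ‖lc w a‖ ≤ 2 * ε * ‖lc x a‖ := by
  obtain ⟨N, hN⟩ := exists_bound_support a
  have h1 : ‖lc w a‖ ≤ ∑ k ∈ Finset.range N, ε * ‖lc x a‖ * (1 / 2) ^ k := by
    rw [lc_eq_sum_range w a hN]
    refine (norm_sum_le _ _).trans (Finset.sum_le_sum fun k _ => ?_)
    rw [norm_smul, Real.norm_eq_abs]
    calc |a k| * ‖w k‖ ≤ (2 ^ k * ‖lc x a‖) * (ε * (1 / 4) ^ k) := by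
          gcongr
          · exact h a k
          · exact hw k
      _ = ε * ‖lc x a‖ * (2 ^ k * (1 / 4) ^ k) := by ring
      _ = _ := by rw [← mul_pow]; norm_num
  have h2 : ∑ k ∈ Finset.range N, (1 / 2 : ℝ) ^ k ≤ 2 := by
    have := sum_geometric_two_le N
    simpa using this
  rw [← Finset.mul_sum] at h1
  have h3 : 0 ≤ ε * ‖lc x a‖ := by positivity
  nlinarith

theorem ker_closed_infinite {X : Type*} [NormedAddCommGroup X] [NormedSpace ℝ X]
    (hX : ¬ FiniteDimensional ℝ X) (Φ : Set (X →L[ℝ] ℝ)) (hΦ : Φ.Finite) :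
    ∃ K : Submodule ℝ X, IsClosed (K : Set X) ∧ ¬ FiniteDimensional ℝ K ∧
      ∀ x, x ∈ K ↔ ∀ f ∈ Φ, f x = 0 := by
  have := hΦ.to_subtype
  let L : X →L[ℝ] (Φ → ℝ) := ContinuousLinearMap.pi fun f => f.1
  refine ⟨LinearMap.ker L.toLinearMap, L.isClosed_ker, fun hf => hX ?_, fun x => ?_⟩
  · have h2 : FiniteDimensional ℝ (X ⧸ LinearMap.ker L.toLinearMap) :=
      LinearEquiv.finiteDimensional (LinearMap.quotKerEquivRange L.toLinearMap).symm
    exact Module.Finite.of_submodule_quotient (LinearMap.ker L.toLinearMap)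
  · rw [LinearMap.mem_ker]
    constructor
    · intro h f hf
      exact congrFun h ⟨f, hf⟩
    · intro h
      funext f
      exact h f.1 f.2

theorem dichotomy {X : Type*} [NormedAddCommGroup X] [NormedSpace ℝ X] (ρ : Seminorm ℝ X) :
    (∃ Φ : Set (X →L[ℝ] ℝ), Φ.Finite ∧ ∃ c > 0, ∀ x, (∀ f ∈ Φ, f x = 0) → c * ‖x‖ ≤ ρ x) ∨
    ∀ ε > 0, ∃ x : ℕ → X, (∀ k, ‖x k‖ = 1 ∧ ρ (x k) < ε * (1 / 4) ^ k) ∧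
      ∀ (a : ℕ →₀ ℝ) (k : ℕ), |a k| ≤ 2 ^ k * ‖lc x a‖ := by
  by_cases h : ∃ Φ : Set (X →L[ℝ] ℝ), Φ.Finite ∧ ∃ c > 0, ∀ x, (∀ f ∈ Φ, f x = 0) → c * ‖x‖ ≤ ρ x
  · exact Or.inl h
  · right
    intro ε hε
    push Not at h
    refine sel (fun k x => ρ x < ε * (1 / 4) ^ k) fun k Φ hΦ => ?_
    obtain ⟨x, hx, hlt⟩ := h Φ hΦ (ε * (1 / 4) ^ k) (by positivity)
    have hpos : 0 < ‖x‖ := by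
      rcases (norm_nonneg x).eq_or_lt' with h0 | h0
      · rw [h0, mul_zero] at hlt
        exact absurd hlt (not_lt.2 (apply_nonneg ρ x))
      · exact h0
    refine ⟨‖x‖⁻¹ • x, ?_, ?_, fun f hf => by simp [hx f hf]⟩
    · rw [norm_smul, norm_inv, norm_norm, inv_mul_cancel₀ hpos.ne']
    · rw [map_smul_eq_mul, norm_inv, norm_norm, inv_mul_lt_iff₀ hpos, mul_comm]
      exact hlt

theorem closure_span_infinite {X : Type*} [NormedAddCommGroup X] [NormedSpace ℝ X]
    (x : ℕ → X) (hx : LinearIndependent ℝ x) :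
    ¬ FiniteDimensional ℝ (Submodule.span ℝ (Set.range x)).topologicalClosure := by
  intro hfd
  have hmem : ∀ k, x k ∈ (Submodule.span ℝ (Set.range x)).topologicalClosure := fun k =>
    Submodule.le_topologicalClosure _ (Submodule.subset_span ⟨k, rfl⟩)
  have hli : LinearIndependent ℝ
      (fun k => (⟨x k, hmem k⟩ : (Submodule.span ℝ (Set.range x)).topologicalClosure)) :=
    LinearIndependent.of_comp (Submodule.subtype _) hx
  have := hli.finite
  exact not_finite ℕ

/-- an inequality between continuous functions passes to the closed span -/
theorem closure_span_induction {X : Type*} [NormedAddCommGroup X] [NormedSpace ℝ X]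
    (x : ℕ → X) (f g : X → ℝ) (hf : Continuous f) (hg : Continuous g)
    (h : ∀ a : ℕ →₀ ℝ, f (lc x a) ≤ g (lc x a)) :
    ∀ y ∈ (Submodule.span ℝ (Set.range x)).topologicalClosure, f y ≤ g y := by
  intro y hy
  have hcl : IsClosed {y | f y ≤ g y} := isClosed_le hf hg
  have hsub : (Submodule.span ℝ (Set.range x) : Set X) ⊆ {y | f y ≤ g y} := by
    intro y hy
    obtain ⟨a, rfl⟩ := (Finsupp.mem_span_range_iff_exists_finsupp).1 hy
    exact h a
  exact (closure_minimal hsub hcl) hy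

theorem ss {X ι : Type*} [NormedAddCommGroup X] [NormedSpace ℝ X] [CompleteSpace X]
    (hmin : IsMinimal X) (W : ι → Type*) [∀ i, NormedAddCommGroup (W i)]
    [∀ i, NormedSpace ℝ (W i)] (s : Finset ι) :
    ∀ (S : ∀ i, X →L[ℝ] W i) (c : ℝ), 0 < c → (∀ x, c * ‖x‖ ≤ ∑ i ∈ s, ‖S i x‖) →
      ∃ i ∈ s, Embeds X (W i) := by
  classical
  induction s using Finset.induction_on with
  | empty =>
    intro S c hc h
    exfalso
    obtain ⟨x, hx, _⟩ := exists_unit_ker hmin.1 ∅ Set.finite_empty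
    have := h x
    simp [hx] at this
    linarith
  | insert i s hi ih =>
    intro S c hc h
    rcases dichotomy ((normSeminorm ℝ (W i)).comp (S i).toLinearMap) with
      ⟨Φ, hΦ, d, hd, hb⟩ | hsmall
    · obtain ⟨K, hK1, hK2, hK3⟩ := ker_closed_infinite hmin.1 Φ hΦ
      refine ⟨i, Finset.mem_insert_self _ _, (hmin.2 K hK1 hK2).trans'
        ⟨(S i).comp K.subtypeL, d, hd, fun x => ?_⟩⟩
      exact hb x.1 ((hK3 x.1).1 x.2)
    · obtain ⟨x, hx, hxb⟩ := hsmall (c / 4) (by positivity)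
      have hli := linearIndependent_of_bound x _ hxb
      obtain ⟨T, d, hd, hT⟩ := hmin.2 _ (Submodule.isClosed_topologicalClosure _)
        (closure_span_infinite x hli)
      have hSi : ∀ y ∈ (Submodule.span ℝ (Set.range x)).topologicalClosure,
          ‖S i y‖ ≤ c / 2 * ‖y‖ := by
        refine closure_span_induction x _ _ (by fun_prop) (by fun_prop) fun a => ?_
        have := pert_bound x (fun k => S i (x k)) (c / 4) (by positivity) hxb
          (fun k => (hx k).2.le) a
        have h2 : S i (lc x a) = lc (fun k => S i (x k)) a := by
          simp [lc, Finsupp.linearCombination_apply, Finsupp.sum, map_sum]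
        rw [h2]
        linarith
      obtain ⟨j, hj, hE⟩ := ih (fun j => (S j).comp ((Submodule.subtypeL _).comp T))
        (c / 2 * d) (by positivity) (fun u => by
          have h1 := h (T u : X)
          have h2 := hSi (T u : X) (T u).2
          rw [Finset.sum_insert hi] at h1
          have h3 : d * ‖u‖ ≤ ‖(T u : X)‖ := hT u
          have h4 : c / 2 * ‖(T u : X)‖ ≤ ∑ j ∈ s, ‖S j (T u : X)‖ := by linarith
          calc c / 2 * d * ‖u‖ = c / 2 * (d * ‖u‖) := by ring
            _ ≤ c / 2 * ‖(T u : X)‖ := by gcongr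
            _ ≤ _ := h4)
      exact ⟨j, Finset.mem_insert_of_mem hj, hE⟩

theorem lc_map {V W : Type*} [AddCommGroup V] [Module ℝ V] [AddCommGroup W] [Module ℝ W]
    (L : V →ₗ[ℝ] W) (x : ℕ → V) (a : ℕ →₀ ℝ) : L (lc x a) = lc (fun k => L (x k)) a := by
  simp [lc, Finsupp.linearCombination_apply, Finsupp.sum, map_sum]

/-- If `S : X → Y` is an embedding and vectors almost in `Z` can be found in all finite
codimensional subspaces then `X` embeds in `Z`; otherwise we get a lower bound. -/
theorem dist_dichotomy {X Y : Type*} [NormedAddCommGroup X] [NormedSpace ℝ X] [CompleteSpace X]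
    (hmin : IsMinimal X) [NormedAddCommGroup Y] [NormedSpace ℝ Y] [CompleteSpace Y]
    (S : X →L[ℝ] Y) (c : ℝ) (hc : 0 < c) (hS : ∀ x, c * ‖x‖ ≤ ‖S x‖)
    (Z : Submodule ℝ Y) (hZ : IsClosed (Z : Set Y)) (ρ : Seminorm ℝ X)
    (hρ : ∀ x, ∀ t > ρ x, ∃ z ∈ Z, ‖S x - z‖ ≤ t) :
    (∃ Φ : Set (X →L[ℝ] ℝ), Φ.Finite ∧ ∃ c > 0, ∀ x, (∀ f ∈ Φ, f x = 0) → c * ‖x‖ ≤ ρ x) ∨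
      Embeds X Z := by
  rcases dichotomy ρ with h | h
  · exact Or.inl h
  right
  obtain ⟨x, hx, hxb⟩ := h (c / 4) (by positivity)
  choose z hzZ hz using fun k => hρ (x k) (c / 4 * (1 / 4) ^ k) (hx k).2
  have : CompleteSpace Z := hZ.completeSpace_coe
  have hp : ∀ a, ‖lc (fun k => S (x k) - z k) a‖ ≤ c / 2 * ‖lc x a‖ := fun a => by
    have := pert_bound x _ (c / 4) (by positivity) hxb hz a
    linarith
  have heq : ∀ a, ((lc (fun k => (⟨z k, hzZ k⟩ : Z)) a : Z) : Y) =
      S (lc x a) - lc (fun k => S (x k) - z k) a := fun a => by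
    have h1 := lc_map Z.subtype (fun k => (⟨z k, hzZ k⟩ : Z)) a
    have h2 := lc_map (S : X →ₗ[ℝ] Y) x a
    simp only [Submodule.subtype_apply] at h1
    rw [h1]
    simp only [ContinuousLinearMap.coe_coe] at h2
    rw [h2]
    simp [lc, Finsupp.linearCombination_apply, Finsupp.sum, smul_sub]
  refine embeds_of_seq hmin x (fun k => (⟨z k, hzZ k⟩ : Z)) (linearIndependent_of_bound x _ hxb)
    (c / 2) (‖S‖ + c / 2) (by positivity) (fun a => ?_) (fun a => ?_)
  · rw [Submodule.coe_norm, heq]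
    have h1 := norm_sub_norm_le (S (lc x a)) (lc (fun k => S (x k) - z k) a)
    have h2 := hS (lc x a)
    have h3 := hp a
    linarith
  · rw [Submodule.coe_norm, heq]
    have h1 := norm_sub_le (S (lc x a)) (lc (fun k => S (x k) - z k) a)
    have h2 := S.le_opNorm (lc x a)
    have h3 := hp a
    linarith

end

open Filter Topology MeasureTheory

/-! ### Part 3a: the Schur-type lemma behind the Bourgain–Pisier construction -/

noncomputable section

theorem glue_linear {V : Type*} [AddCommGroup V] [Module ℝ V] (E : ℕ → Submodule ℝ V)
    (hmono : Monotone E) (hE : ∀ v, ∃ N, v ∈ E N) (F : ℕ → V →ₗ[ℝ] ℝ)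
    (h : ∀ k, ∀ v ∈ E k, F (k + 1) v = F k v) :
    ∃ f : V →ₗ[ℝ] ℝ, ∀ k, ∀ v ∈ E k, f v = F k v := by
  choose N hN using hE
  have h1 : ∀ k j v, v ∈ E k → F (k + j) v = F k v := by
    intro k j v hv
    induction j with
    | zero => rfl
    | succ j ih => rw [← add_assoc, h (k + j) v (hmono (by omega) hv), ih]
  have h2 : ∀ k K v, v ∈ E k → k ≤ K → F K v = F k v := by
    intro k K v hv hk
    obtain ⟨j, rfl⟩ := Nat.exists_eq_add_of_le hk
    exact h1 k j v hv
  have h3 : ∀ k v, v ∈ E k → F (N v) v = F k v := fun k v hv => by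
    rw [← h2 k (max k (N v)) v hv (le_max_left _ _),
      ← h2 (N v) (max k (N v)) v (hN v) (le_max_right _ _)]
  refine ⟨{ toFun := fun v => F (N v) v, map_add' := fun v w => ?_, map_smul' := fun r v => ?_ },
    fun k v hv => h3 k v hv⟩
  · let K := max (N v) (N w)
    have hv : v ∈ E K := hmono (le_max_left _ _) (hN v)
    have hw : w ∈ E K := hmono (le_max_right _ _) (hN w)
    rw [h3 K v hv, h3 K w hw, h3 K (v + w) ((E K).add_mem hv hw), map_add]
  · rw [h3 (N v) (r • v) ((E _).smul_mem r (hN v)), map_smul, RingHom.id_apply]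

structure SchurData {V : Type*} [AddCommGroup V] [Module ℝ V] (E : ℕ → Submodule ℝ V)
    (D : Seminorm ℝ V) (m : ℕ → Seminorm ℝ V) (κ : ℝ) : Prop where
  mono : Monotone E
  exh : ∀ v, ∃ N, v ∈ E N
  H1 : ∀ N, ∀ x ∈ E (N + 1), ∀ ε > 0, ∃ x' ∈ E N, m (N + 1) (x - x') + D x' ≤ D x + ε
  H2 : ∀ N, ∀ x ∈ E (N + 1), D x ≤ m (N + 1) x
  H3 : ∀ N, ∀ x ∈ E N, κ * D x ≤ m (N + 1) x
  fd : ∀ N, ∃ G : Submodule ℝ V, FiniteDimensional ℝ G ∧ ∀ x ∈ E N, ∃ g ∈ G, D (x - g) = 0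

variable {V : Type*} [AddCommGroup V] [Module ℝ V] {E : ℕ → Submodule ℝ V}
    {D : Seminorm ℝ V} {m : ℕ → Seminorm ℝ V} {κ : ℝ}

theorem SchurData.extend (H : SchurData E D m κ) (hκ : 1 < κ) (n : ℕ) (g : V →ₗ[ℝ] ℝ)
    (hg : ∀ x ∈ E n, g x ≤ D x) :
    ∃ f : V →ₗ[ℝ] ℝ, (∀ x ∈ E n, f x = g x) ∧ (∀ x, |f x| ≤ D x) ∧
      ∀ x, ∀ ε > 0, ∃ y ∈ E n, f x + (1 - κ⁻¹) * D (x - y) ≤ D x + ε := by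
  have hκ0 : 0 < κ := by linarith
  have hδ : 0 ≤ 1 - κ⁻¹ := by
    have : κ⁻¹ ≤ 1 := inv_le_one_of_one_le₀ hκ.le
    linarith
  let P : ℕ → (V →ₗ[ℝ] ℝ) → Prop := fun k f =>
    ∀ x ∈ E (n + k), ∀ ε > 0, ∃ y ∈ E n, f x + (1 - κ⁻¹) * D (x - y) ≤ D x + ε
  have hle : ∀ k f, P k f → ∀ x ∈ E (n + k), f x ≤ D x := fun k f hP x hx => by
    refine le_of_forall_pos_le_add fun ε hε => ?_
    obtain ⟨y, _, h⟩ := hP x hx ε hε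
    have := mul_nonneg hδ (apply_nonneg D (x - y))
    linarith
  have step : ∀ k (f : {f : V →ₗ[ℝ] ℝ // P k f}), ∃ f' : {f : V →ₗ[ℝ] ℝ // P (k + 1) f},
      ∀ x ∈ E (n + k), f'.1 x = f.1 x := by
    rintro k ⟨f, hf⟩
    obtain ⟨f', hf1, hf2⟩ := exists_extension_of_le_sublinear
      (⟨E (n + k), f.comp (E (n + k)).subtype⟩ : V →ₗ.[ℝ] ℝ)
      (fun x => κ⁻¹ * m (n + k + 1) x)
      (fun c hc x => by
        simp only [map_smul_eq_mul, Real.norm_of_nonneg hc.le]; ring)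
      (fun x y => by
        have := map_add_le_add (m (n + k + 1)) x y
        rw [← mul_add]; gcongr)
      (fun x => by
        have h1 : f x.1 ≤ D x.1 := hle k f hf x.1 x.2
        have h2 := H.H3 (n + k) x.1 x.2
        change f x.1 ≤ κ⁻¹ * _
        rw [inv_mul_eq_div, le_div_iff₀ hκ0]
        nlinarith)
    have hf1' : ∀ x ∈ E (n + k), f' x = f x := fun x hx => hf1 ⟨x, hx⟩
    refine ⟨⟨f', ?_⟩, hf1'⟩
    intro x hx ε hε
    obtain ⟨x', hx', h1⟩ := H.H1 (n + k) x hx (ε / 2) (by positivity)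
    obtain ⟨y, hy, h2⟩ := hf x' hx' (ε / 2) (by positivity)
    refine ⟨y, hy, ?_⟩
    have h3 : f' x = f' (x - x') + f x' := by rw [← hf1' x' hx', ← map_add]; simp
    have h4 := hf2 (x - x')
    have h5 : D (x - y) ≤ D (x - x') + D (x' - y) := by
      have := map_add_le_add D (x - x') (x' - y)
      simpa using this
    have h6 := H.H2 (n + k) (x - x') ((E _).sub_mem hx (H.mono (by omega) hx'))
    have h7 := mul_le_mul_of_nonneg_left h5 hδ
    have h8 := mul_le_mul_of_nonneg_left h6 hδ
    rw [h3]
    have h9 : κ⁻¹ * m (n + k + 1) (x - x') + (1 - κ⁻¹) * m (n + k + 1) (x - x') =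
      m (n + k + 1) (x - x') := by ring
    linarith
  choose next hnext using step
  have h0 : P 0 g := fun x hx ε hε => ⟨x, hx, by
    have := hg x hx
    simp; linarith⟩
  let F : (k : ℕ) → {f : V →ₗ[ℝ] ℝ // P k f} := fun k =>
    Nat.rec (motive := fun k => {f : V →ₗ[ℝ] ℝ // P k f}) ⟨g, h0⟩ (fun k f => next k f) k
  obtain ⟨f, hf⟩ := glue_linear (fun k => E (n + k)) (fun a b hab => H.mono (by omega))
    (fun v => by
      obtain ⟨N, hN⟩ := H.exh v
      exact ⟨N, H.mono (by omega) hN⟩) (fun k => (F k).1)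
    (fun k v hv => hnext k (F k) v hv)
  have hex : ∀ x, ∃ k, x ∈ E (n + k) := fun v => by
    obtain ⟨N, hN⟩ := H.exh v
    exact ⟨N, H.mono (by omega) hN⟩
  have hfle : ∀ x, f x ≤ D x := fun x => by
    obtain ⟨k, hk⟩ := hex x
    rw [hf k x hk]
    exact hle k _ (F k).2 x hk
  refine ⟨f, fun x hx => hf 0 x hx, fun x => abs_le.2 ⟨?_, hfle x⟩, fun x ε hε => ?_⟩
  · have := hfle (-x)
    rw [map_neg, map_neg_eq_map] at this
    linarith
  · obtain ⟨k, hk⟩ := hex x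
    rw [hf k x hk]
    exact (F k).2 x hk ε hε

theorem SchurData.l1 (H : SchurData E D m κ) (hκ : 1 < κ) {X : Type*} [NormedAddCommGroup X]
    [NormedSpace ℝ X] [CompleteSpace X] (hX : ¬ FiniteDimensional ℝ X)
    (p : Seminorm ℝ V) (C : ℝ) (hC : 0 < C) (hD : ∀ v, D v ≤ C * p v)
    (S : X →L[ℝ] Cmp p) (Φ : Set (X →L[ℝ] ℝ)) (hΦ : Φ.Finite) (c : ℝ) (hc : 0 < c)
    (hlow : ∀ x, (∀ f ∈ Φ, f x = 0) → ∀ v, c * ‖x‖ - C * ‖S x - toCmp p v‖ ≤ D v) :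
    Embeds EllOne X := by
  have hκ0 : 0 < κ := by linarith
  set δ := 1 - κ⁻¹ with hδdef
  have hδ : 0 < δ := by
    have : κ⁻¹ < 1 := inv_lt_one_of_one_lt₀ hκ
    linarith
  have hδ1 : δ ≤ 1 := by
    have : 0 < κ⁻¹ := inv_pos.2 hκ0
    linarith
  have hlift : ∀ g : V →ₗ[ℝ] ℝ, ∃ G : Cmp p →L[ℝ] ℝ, (∀ v, |g v| ≤ D v) →
      ∀ v, G (toCmp p v) = g v ∧ ∀ y, |G y| ≤ C * ‖y‖ := by
    intro g
    by_cases hg : ∀ v, |g v| ≤ D v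
    · obtain ⟨G, h1, h2, _⟩ := exists_liftCmp p g C (fun v => (hg v).trans (hD v))
      exact ⟨G, fun _ v => ⟨h1 v, h2⟩⟩
    · exact ⟨0, fun h => absurd h hg⟩
  choose Lf hLf using hlift
  refine step_l1 p D C hD S (δ * c / 8) (by positivity) fun n e _ θ hθ η hη => ?_
  obtain ⟨N, hN⟩ : ∃ N, ∀ j < n, e j ∈ E N := by
    choose k hk using fun j => H.exh (e j)
    exact ⟨(Finset.range n).sup k, fun j hj =>
      H.mono (Finset.le_sup (f := k) (Finset.mem_range.2 hj)) (hk j)⟩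
  obtain ⟨G, hG, hG2⟩ := H.fd N
  have hnull : ∀ x g : V, D (x - g) = 0 → D x = D g ∧ ∀ f : V →ₗ[ℝ] ℝ,
      (∀ v, |f v| ≤ D v) → f x = f g := by
    intro x g h
    constructor
    · have := abs_sub_map_le_sub D x g
      rw [h] at this
      have := abs_nonpos_iff.1 this
      linarith
    · intro f hf
      have := hf (x - g)
      rw [h, map_sub] at this
      have := abs_nonpos_iff.1 this
      linarith
  obtain ⟨Φ1, hΦ1, _, hΦ1b, hΦ1n⟩ := finite_norming D G hθ
  obtain ⟨Φ2, hΦ2, _, hΦ2b, hΦ2n⟩ := finite_norming D G (θ := 1 / 2) (by norm_num)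
  have hext : ∀ g : V →ₗ[ℝ] ℝ, ∃ f : V →ₗ[ℝ] ℝ, (∀ v, |g v| ≤ D v) → ((∀ x ∈ E N, f x = g x) ∧
      (∀ x, |f x| ≤ D x) ∧ ∀ x, ∀ ε > 0, ∃ y ∈ E N, f x + δ * D (x - y) ≤ D x + ε) := by
    intro g
    by_cases hg : ∀ v, |g v| ≤ D v
    · obtain ⟨f, hf⟩ := H.extend hκ N g fun x _ => (le_abs_self _).trans (hg x)
      exact ⟨f, fun _ => hf⟩
    · exact ⟨0, fun h => absurd h hg⟩
  choose Ex hEx using hext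
  obtain ⟨x, hx1, hx⟩ := exists_unit_ker hX
    (Φ ∪ ((fun g => (Lf (Ex g)).comp S) '' Φ1 ∪ (fun g => (Lf g).comp S) '' Φ2))
    (hΦ.union ((hΦ1.image _).union (hΦ2.image _)))
  let η' := min η (δ * c / (12 * C))
  have hη' : 0 < η' := by positivity
  have hη2 : C * η' ≤ δ * c / 12 := by
    have : η' ≤ δ * c / (12 * C) := min_le_right _ _
    calc C * η' ≤ C * (δ * c / (12 * C)) := by gcongr
      _ = _ := by field_simp
  have hη3 : C * η' ≤ c / 12 := hη2.trans (by nlinarith)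
  obtain ⟨e', he'⟩ := approx_toCmp p (S x) hη'
  refine ⟨x, e', hx1, he'.le.trans (min_le_left _ _), ?_⟩
  have hsm : ∀ g : V →ₗ[ℝ] ℝ, (∀ v, |g v| ≤ D v) → Lf g (S x) = 0 → |g e'| ≤ C * η' := by
    intro g hg h0
    have h1 := (hLf g hg e').2 (S x - toCmp p e')
    rw [map_sub, h0, (hLf g hg e').1, zero_sub, abs_neg] at h1
    exact h1.trans (by gcongr)
  have hDe : c - C * η' ≤ D e' := by
    have h1 := hlow x (fun f hf => hx f (Or.inl hf)) e'
    rw [hx1, mul_one] at h1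
    have : C * ‖S x - toCmp p e'‖ ≤ C * η' := by gcongr
    linarith
  have hd : ∀ y ∈ E N, c / 4 ≤ D (e' - y) := by
    intro y hy
    obtain ⟨g, hgG, hg0⟩ := hG2 y hy
    obtain ⟨f, hf, hfn⟩ := hΦ2n g hgG
    have h1 := hnull y g hg0
    rw [← h1.1, ← h1.2 f (hΦ2b f hf)] at hfn
    have h2 := hsm f (hΦ2b f hf) (hx _ (Or.inr (Or.inr ⟨f, hf, rfl⟩)))
    have h3 := hΦ2b f hf (e' - y)
    rw [map_sub] at h3
    have h4 := (abs_le.1 h3).1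
    have h5 := (abs_le.1 h2).2
    have h6 : D e' ≤ D (e' - y) + D y := by
      have := map_add_le_add D (e' - y) y
      simpa using this
    linarith
  intro a t
  set y := ∑ j ∈ Finset.range n, a j • e j with hy
  have hyN : y ∈ E N := Submodule.sum_mem _ fun j hj =>
    (E N).smul_mem _ (hN j (Finset.mem_range.1 hj))
  obtain ⟨g, hgG, hg0⟩ := hG2 y hyN
  obtain ⟨f, hf, hfn⟩ := hΦ1n g hgG
  have h1 := hnull y g hg0
  rw [← h1.1, ← h1.2 f (hΦ1b f hf)] at hfn
  obtain ⟨hE1, hE2, hE3⟩ := hEx f (hΦ1b f hf)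
  have h2 := hsm (Ex f) hE2 (hx _ (Or.inr (Or.inl ⟨f, hf, rfl⟩)))
  rw [← hE1 y hyN] at hfn
  refine le_of_forall_pos_le_add fun ε hε => ?_
  obtain ⟨u, hu, h3⟩ := hE3 (y + t • e') ε hε
  have h4 : |t| * (c / 4) ≤ D (y + t • e' - u) := by
    by_cases ht : t = 0
    · subst ht; simp
    · have h5 : y + t • e' - u = t • (e' - t⁻¹ • (u - y)) := by
        rw [smul_sub, smul_smul, mul_inv_cancel₀ ht, one_smul]; abel
      rw [h5, map_smul_eq_mul, Real.norm_eq_abs]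
      gcongr
      exact hd _ ((E N).smul_mem _ ((E N).sub_mem hu hyN))
  have h6 : |t * Ex f e'| ≤ |t| * (C * η') := by rw [abs_mul]; gcongr
  have h7 := (abs_le.1 h6).1
  rw [map_add, map_smul, smul_eq_mul] at h3
  have h8 := mul_le_mul_of_nonneg_left h4 hδ.le
  have h9 : |t| * (C * η') ≤ |t| * (δ * c / 12) := by gcongr
  have h10 : 0 ≤ |t| * (δ * c) := by positivity
  nlinarith

end

open Filter Topology MeasureTheory

/-! ### Part 3b: one step of the Bourgain–Pisier construction -/

noncomputable section

/-- Seminorms, with fixed instance path. -/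
abbrev SemiN (V : Type*) [AddCommGroup V] [Module ℝ V] := Seminorm ℝ V

/-- Linear maps, with fixed instance path. -/
abbrev LinM (V W : Type*) [AddCommGroup V] [Module ℝ V] [AddCommGroup W] [Module ℝ W] :=
  V →ₗ[ℝ] W

/-- Pull back of a seminorm. -/
def pullSN {V W : Type*} [AddCommGroup V] [Module ℝ V] [AddCommGroup W] [Module ℝ W]
    (p : SemiN W) (f : LinM V W) : SemiN V := p.comp f

section minSN
variable {V W : Type*} [AddCommGroup V] [Module ℝ V] [AddCommGroup W] [Module ℝ W]

theorem bddBelow_range_sn (r : Seminorm ℝ (V × W)) (v : V) :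
    BddBelow (Set.range fun w : W => r (v, w)) :=
  ⟨0, by rintro _ ⟨w, rfl⟩; exact apply_nonneg r _⟩

theorem exists_lt_iInf_sn (r : Seminorm ℝ (V × W)) (v : V) {ε : ℝ} (hε : 0 < ε) :
    ∃ w, r (v, w) < (⨅ w, r (v, w)) + ε :=
  exists_lt_of_ciInf_lt (lt_add_of_pos_right _ hε)

/-- Partial infimum of a seminorm on a product. -/
def minSN (r : Seminorm ℝ (V × W)) : Seminorm ℝ V :=
  Seminorm.ofSMulLE (fun v => ⨅ w, r (v, w))
    (le_antisymm ((ciInf_le (bddBelow_range_sn r 0) 0).trans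
      (by rw [show ((0 : V), (0 : W)) = 0 from rfl, map_zero]))
      (le_ciInf fun w => apply_nonneg r _))
    (fun x y => by
      refine le_of_forall_pos_le_add fun ε hε => ?_
      obtain ⟨u, hu⟩ := exists_lt_iInf_sn r x (half_pos hε)
      obtain ⟨w, hw⟩ := exists_lt_iInf_sn r y (half_pos hε)
      have h1 := ciInf_le (bddBelow_range_sn r (x + y)) (u + w)
      have h2 := map_add_le_add r (x, u) (y, w)
      rw [Prod.mk_add_mk] at h2
      linarith)
    (fun t x => by
      rw [Real.mul_iInf_of_nonneg (norm_nonneg _)]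
      refine le_ciInf fun w => ?_
      have h1 := ciInf_le (bddBelow_range_sn r (t • x)) (t • w)
      refine h1.trans (le_of_eq ?_)
      rw [← map_smul_eq_mul r, Prod.smul_mk])

theorem minSN_le (r : Seminorm ℝ (V × W)) (v : V) (w : W) : minSN r v ≤ r (v, w) :=
  ciInf_le (bddBelow_range_sn r v) w

theorem exists_minSN_lt (r : Seminorm ℝ (V × W)) (v : V) {ε : ℝ} (hε : 0 < ε) :
    ∃ w, r (v, w) < minSN r v + ε := exists_lt_iInf_sn r v hε

theorem le_minSN (r : Seminorm ℝ (V × W)) (v : V) (c : ℝ) (h : ∀ w, c ≤ r (v, w)) :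
    c ≤ minSN r v := le_ciInf h

/-- The limit of a pointwise eventually constant sequence of seminorms. -/
theorem exists_evSN (p : ℕ → Seminorm ℝ V) (h : ∀ v, ∃ N, ∀ n ≥ N, p n v = p N v) :
    ∃ P : Seminorm ℝ V, ∀ v, ∃ N, ∀ n ≥ N, P v = p n v := by
  choose N hN using h
  have key : ∀ v, ∀ n ≥ N v, p (N v) v = p n v := fun v n hn => (hN v n hn).symm
  refine ⟨Seminorm.of (fun v => p (N v) v) (fun x y => ?_) (fun t x => ?_), fun v => ⟨N v, key v⟩⟩
  · let n := max (N (x + y)) (max (N x) (N y))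
    show p (N (x + y)) (x + y) ≤ _
    rw [key _ n (le_max_left _ _), key x n (by simp [n]), key y n (by simp [n])]
    exact map_add_le_add _ _ _
  · let n := max (N (t • x)) (N x)
    show p (N (t • x)) (t • x) = _
    rw [key _ n (le_max_left _ _), key x n (by simp [n])]
    exact map_smul_eq_mul _ _ _

theorem sn_eq_of_sub_zero (p : Seminorm ℝ V) {x y : V} (h : p (x - y) = 0) : p x = p y := by
  have h1 := abs_sub_map_le_sub p x y
  rw [h] at h1
  have := abs_nonpos_iff.1 h1
  linarith

end minSN

section BP
variable {ι B : Type*} [NormedAddCommGroup B] [NormedSpace ℝ B]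

/-- State in the Bourgain–Pisier construction. -/
structure BPS (ι B : Type*) [NormedAddCommGroup B] [NormedSpace ℝ B] where
  F : Finset ι
  M : SemiN ((ι →₀ ℝ) × B)
  Q : SemiN ((ι →₀ ℝ) × B)

structure BPS.Good (S : BPS ι B) (lam : ℝ) (L : ℕ) : Prop where
  null : ∀ x : ι →₀ ℝ, (∀ c ∈ S.F, x c = 0) → S.M (x, 0) = 0 ∧ S.Q (x, 0) = 0
  le : ∀ v, S.M v ≤ lam * S.Q v
  le' : ∀ x, S.Q (x, 0) ≤ S.M (x, 0)
  Q0 : ∀ b, S.Q (0, b) = ‖b‖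
  kill : ∀ b, ∃ x : ι →₀ ℝ, (∀ c ∉ S.F, x c = 0) ∧ S.M (x, -b) = 0
  iso : ∃ (k : Type) (_ : Fintype k) (θ : (ι →₀ ℝ) →ₗ[ℝ] (k → ℝ)), L ≤ Fintype.card k ∧
    (∀ x, S.M (x, 0) = ‖θ x‖) ∧ ∀ y, ∃ x : ι →₀ ℝ, (∀ c ∉ S.F, x c = 0) ∧ θ x = y

structure BPRel (κ : ℝ) (z : B) (S S' : BPS ι B) : Prop where
  sub : S.F ⊆ S'.F
  mono : ∀ v, S.M v ≤ S'.M v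
  stab : ∀ x : ι →₀ ℝ, (∀ c ∉ S.F, x c = 0) → ∀ b, S'.Q (x, b) = S.Q (x, b)
  le' : ∀ x (t : ℝ), S'.Q (x, t • z) ≤ S'.M (x, t • z)
  exp : ∀ x : ι →₀ ℝ, (∀ c ∉ S.F, x c = 0) → ∀ t : ℝ, κ * S.Q (x, t • z) ≤ S'.M (x, t • z)
  dec : ∀ x b, ∀ ε > 0, ∃ (x' : ι →₀ ℝ) (t : ℝ), (∀ c ∉ S.F, x' c = 0) ∧
    S'.M (x - x', (-t) • z) + S.Q (x', b + t • z) ≤ S'.Q (x, b) + ε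

/-- The initial state. -/
def BPS.initial (ι B : Type*) [NormedAddCommGroup B] [NormedSpace ℝ B] : BPS ι B where
  F := ∅
  M := 0
  Q := (normSeminorm ℝ B).comp (LinearMap.snd ℝ (ι →₀ ℝ) B)

theorem BPS.initial_good {lam : ℝ} (hlam : 0 ≤ lam) : (BPS.initial ι B).Good lam 0 where
  null x _ := by
    constructor
    · rfl
    · show ‖(0 : B)‖ = 0
      simp
  le v := by
    have : 0 ≤ lam * (BPS.initial ι B).Q v := mul_nonneg hlam (apply_nonneg _ _)
    exact this
  le' x := by
    show ‖(0 : B)‖ ≤ 0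
    simp
  Q0 b := rfl
  kill b := ⟨0, fun _ _ => rfl, rfl⟩
  iso := ⟨Empty, inferInstance, 0, by simp, fun x => by
    show (0 : ℝ) = _
    simp, fun y => ⟨0, fun _ _ => rfl, Subsingleton.elim _ _⟩⟩

theorem exists_g (Q : SemiN ((ι →₀ ℝ) × B)) (F : Finset ι)
    (hF : ∀ x : ι →₀ ℝ, (∀ c ∈ F, x c = 0) → Q (x, 0) = 0) (z : B) {κ lam : ℝ} (hκ : 0 ≤ κ)
    (hl : κ < lam) :
    ∃ (r : ℕ) (g : ℕ → ((ι →₀ ℝ) × B) →ₗ[ℝ] ℝ), 0 < r ∧ (∀ i v, |g i v| ≤ lam * Q v) ∧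
      ∀ x (t : ℝ), ∃ i < r, κ * Q (x, t • z) ≤ |g i (x, t • z)| := by
  classical
  have hlam : 0 < lam := hκ.trans_lt hl
  let G : Submodule ℝ ((ι →₀ ℝ) × B) :=
    (Finsupp.supported ℝ ℝ (F : Set ι)).prod (Submodule.span ℝ {z})
  have e1 : FiniteDimensional ℝ (Finsupp.supported ℝ ℝ (F : Set ι)) :=
    Module.Finite.equiv (Finsupp.supportedEquivFinsupp (F : Set ι)).symm
  have : FiniteDimensional ℝ G :=
    Module.Finite.iff_fg.2 ((Module.Finite.iff_fg.1 e1).prod (Submodule.fg_span_singleton z))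
  obtain ⟨Φ, hfin, hne, h1, h2⟩ := finite_norming Q G (θ := κ / lam) ((div_lt_one hlam).2 hl)
  have : Fintype Φ := hfin.fintype
  have : Nonempty Φ := hne.to_subtype
  let e := Fintype.equivFin Φ
  let g : ℕ → ((ι →₀ ℝ) × B) →ₗ[ℝ] ℝ := fun i =>
    if h : i < Fintype.card Φ then lam • (e.symm ⟨i, h⟩).1 else 0
  have hg : ∀ i v, |g i v| ≤ lam * Q v := by
    intro i v
    by_cases h : i < Fintype.card Φ
    · simp only [g, h, dif_pos, LinearMap.smul_apply, smul_eq_mul, abs_mul, abs_of_pos hlam]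
      exact mul_le_mul_of_nonneg_left (h1 _ (e.symm ⟨i, h⟩).2 v) hlam.le
    · simp only [g, h, dif_neg, not_false_iff, LinearMap.zero_apply, abs_zero]
      exact mul_nonneg hlam.le (apply_nonneg _ _)
  refine ⟨Fintype.card Φ, g, Fintype.card_pos, hg, fun x t => ?_⟩
  let x' := x.filter (· ∈ F)
  have hx' : Q ((x, t • z) - (x', t • z)) = 0 := by
    have : ((x, t • z) - (x', t • z) : (ι →₀ ℝ) × B) = (x - x', 0) := by simp
    rw [this]
    refine hF _ fun c hc => ?_
    simp [x', hc]
  have hQ := sn_eq_of_sub_zero Q hx'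
  obtain ⟨f, hf, hf2⟩ := h2 (x', t • z) ⟨by
    show x' ∈ Finsupp.supported ℝ ℝ (F : Set ι)
    rw [Finsupp.mem_supported']
    intro c hc
    exact Finsupp.filter_apply_neg _ _ (by simpa using hc), Submodule.smul_mem _ _
      (Submodule.mem_span_singleton_self z)⟩
  refine ⟨e ⟨f, hf⟩, (e ⟨f, hf⟩).2, ?_⟩
  have hge : g (e ⟨f, hf⟩) = lam • f := by
    simp only [g]
    rw [dif_pos (e ⟨f, hf⟩).2]
    simp
  have h0 : g (e ⟨f, hf⟩) (x, t • z) = g (e ⟨f, hf⟩) (x', t • z) := by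
    have := hg (e ⟨f, hf⟩) ((x, t • z) - (x', t • z))
    rw [hx', mul_zero, map_sub] at this
    exact sub_eq_zero.1 (abs_nonpos_iff.1 this)
  rw [h0, hQ, hge]
  refine le_trans ?_ (le_abs_self _)
  simp only [LinearMap.smul_apply, smul_eq_mul]
  calc κ * Q (x', t • z) = lam * (κ / lam * Q (x', t • z)) := by field_simp
    _ ≤ _ := mul_le_mul_of_nonneg_left hf2 hlam.le

theorem BPS.step (S : BPS ι B) {lam κ : ℝ} {L : ℕ} (hS : S.Good lam L) (hκ : 1 ≤ κ)
    (hl : κ < lam) (e : ℕ → ι) (he : Function.Injective e) (heF : ∀ i, e i ∉ S.F) (z : B) :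
    ∃ (S' : BPS ι B) (r : ℕ), S'.Good lam (L + 1) ∧ BPRel κ z S S' ∧ 0 < r ∧
      ∀ c, c ∈ S'.F ↔ c ∈ S.F ∨ ∃ i < r, c = e i := by
  classical
  have hlam1 : 1 ≤ lam := hκ.trans hl.le
  have hlam0 : 0 ≤ lam := zero_le_one.trans hlam1
  obtain ⟨r, g, hr, hg, hgz⟩ := exists_g S.Q S.F (fun x hx => (hS.null x hx).2) z
    (zero_le_one.trans hκ) hl
  let φ : ℕ → ((ι →₀ ℝ) × B) →ₗ[ℝ] ℝ := fun i =>
    (Finsupp.lapply (e i)) ∘ₗ LinearMap.fst ℝ (ι →₀ ℝ) B + g i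
  have hφ : ∀ i x b, φ i (x, b) = x (e i) + g i (x, b) := fun i x b => rfl
  let M' : SemiN ((ι →₀ ℝ) × B) :=
    S.M ⊔ (Finset.range r).sup fun i => (normSeminorm ℝ ℝ).comp (φ i)
  have hM1 : ∀ v, S.M v ≤ M' v := fun v => le_max_left _ _
  have hM2 : ∀ v, ∀ i < r, |φ i v| ≤ M' v := fun v i hi => by
    have h1 : ((normSeminorm ℝ ℝ).comp (φ i)) ≤
      (Finset.range r).sup fun i => (normSeminorm ℝ ℝ).comp (φ i) :=
        Finset.le_sup (f := fun i => (normSeminorm ℝ ℝ).comp (φ i)) (Finset.mem_range.2 hi)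
    exact (h1 v).trans (le_max_right _ _)
  have hM3 : ∀ v c, 0 ≤ c → S.M v ≤ c → (∀ i < r, |φ i v| ≤ c) → M' v ≤ c :=
    fun v c hc h1 h2 => sup_le h1 (Seminorm.finset_sup_apply_le hc
      fun i hi => h2 i (Finset.mem_range.1 hi))
  let Es := Finsupp.supported ℝ ℝ (S.F : Set ι)
  have hEs : ∀ x, x ∈ Es ↔ ∀ c ∉ S.F, x c = 0 := fun x => by
    rw [Finsupp.mem_supported']; rfl
  let π1 : LinM (((ι →₀ ℝ) × B) × (Es × ℝ)) ((ι →₀ ℝ) × B) :=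
    { toFun := fun w => (w.1.1 - w.2.1.1, (-w.2.2) • z)
      map_add' := fun a b => by
        ext1
        · simp; abel
        · simp [add_smul]; abel
      map_smul' := fun a b => by
        ext1
        · simp [smul_sub]
        · simp [mul_smul] }
  let π2 : LinM (((ι →₀ ℝ) × B) × (Es × ℝ)) ((ι →₀ ℝ) × B) :=
    { toFun := fun w => (w.2.1.1, w.1.2 + w.2.2 • z)
      map_add' := fun a b => by
        ext1
        · simp
        · simp [add_smul]; abel
      map_smul' := fun a b => by
        ext1
        · simp
        · simp [mul_smul] }
  let Q' : SemiN ((ι →₀ ℝ) × B) := minSN (pullSN M' π1 + pullSN S.Q π2)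
  have hQle : ∀ x b x' (t : ℝ), (∀ c ∉ S.F, x' c = 0) →
      Q' (x, b) ≤ M' (x - x', (-t) • z) + S.Q (x', b + t • z) := fun x b x' t hx' =>
    minSN_le (pullSN M' π1 + pullSN S.Q π2) (x, b) (⟨x', (hEs x').2 hx'⟩, t)
  have hQlt : ∀ x b, ∀ ε > 0, ∃ x' : (ι →₀ ℝ), ∃ t : ℝ, (∀ c ∉ S.F, x' c = 0) ∧
      M' (x - x', (-t) • z) + S.Q (x', b + t • z) < Q' (x, b) + ε := fun x b ε hε => by
    obtain ⟨⟨x', t⟩, h⟩ := exists_minSN_lt (pullSN M' π1 + pullSN S.Q π2) (x, b) hε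
    exact ⟨x'.1, t, (hEs x'.1).1 x'.2, h⟩
  have hgnull : ∀ x : (ι →₀ ℝ), (∀ c ∈ S.F, x c = 0) → ∀ i b, g i (x, b) = g i (0, b) := fun x hx i b => by
    have h1 := hg i (x, 0)
    rw [(hS.null x hx).2, mul_zero] at h1
    have h2 := abs_nonpos_iff.1 h1
    have : ((x, b) : (ι →₀ ℝ) × B) = (x, 0) + (0, b) := by simp
    rw [this, map_add, h2, zero_add]
  have hsplit : ∀ x x' : (ι →₀ ℝ), ∀ b b' : B, ((x, b) : (ι →₀ ℝ) × B) = (x - x', b - b') + (x', b') := by simp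
  have hexp : ∀ x : (ι →₀ ℝ), (∀ c ∉ S.F, x c = 0) → ∀ t : ℝ, κ * S.Q (x, t • z) ≤ M' (x, t • z) := by
    intro x hx t
    obtain ⟨i, hi, h⟩ := hgz x t
    refine h.trans ?_
    have := hM2 (x, t • z) i hi
    rwa [hφ, hx _ (heF i), zero_add] at this
  have hle'2 : ∀ x (t : ℝ), Q' (x, t • z) ≤ M' (x, t • z) := fun x t => by
    have := hQle x (t • z) 0 (-t) (fun _ _ => rfl)
    simpa [show ((0 : (ι →₀ ℝ)), (0 : B)) = 0 from rfl] using this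
  have hstab : ∀ x : (ι →₀ ℝ), (∀ c ∉ S.F, x c = 0) → ∀ b, Q' (x, b) = S.Q (x, b) := by
    intro x hx b
    apply le_antisymm
    · have := hQle x b x 0 hx
      simpa [show ((0 : (ι →₀ ℝ)), (0 : B)) = 0 from rfl] using this
    · refine le_of_forall_pos_le_add fun ε hε => ?_
      obtain ⟨x', t, hx', h⟩ := hQlt x b ε hε
      have h1 := hexp (x - x') (fun c hc => by simp [hx c hc, hx' c hc]) (-t)
      have h2 : S.Q (x - x', (-t) • z) ≤ κ * S.Q (x - x', (-t) • z) :=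
        le_mul_of_one_le_left (apply_nonneg _ _) hκ
      have h3 := map_add_le_add S.Q (x - x', (-t) • z) (x', b + t • z)
      have h4 : ((x - x', (-t) • z) + (x', b + t • z) : (ι →₀ ℝ) × B) = (x, b) := by simp
      rw [h4] at h3
      linarith
  have hnewnull : ∀ y : ℕ → ℝ, ∃ u : (ι →₀ ℝ), (∀ c ∈ S.F, u c = 0) ∧ (∀ i < r, u (e i) = y i) ∧
      ∀ c, (∀ i < r, c ≠ e i) → u c = 0 := by
    intro y
    refine ⟨∑ i ∈ Finset.range r, Finsupp.single (e i) (y i), ?_, ?_, ?_⟩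
    · intro c hc
      rw [Finsupp.finsetSum_apply]
      refine Finset.sum_eq_zero fun i _ => ?_
      rw [Finsupp.single_apply, if_neg]
      rintro rfl
      exact heF i hc
    · intro i hi
      rw [Finsupp.finsetSum_apply, Finset.sum_eq_single i]
      · simp
      · intro j _ hj
        rw [Finsupp.single_apply, if_neg]
        exact fun h => hj (he h)
      · intro h
        exact absurd (Finset.mem_range.2 hi) h
    · intro c hc
      rw [Finsupp.finsetSum_apply]
      refine Finset.sum_eq_zero fun i hi => ?_
      rw [Finsupp.single_apply, if_neg]
      exact fun h => hc i (Finset.mem_range.1 hi) h.symm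
  let S' : BPS ι B := ⟨S.F ∪ (Finset.range r).image e, M', Q'⟩
  have hF' : ∀ c, c ∈ S'.F ↔ c ∈ S.F ∨ ∃ i < r, c = e i := fun c => by
    simp [S', eq_comm]
  have hF'n : ∀ c ∉ S'.F, c ∉ S.F ∧ ∀ i < r, c ≠ e i := fun c hc => by
    rw [hF'] at hc
    push Not at hc
    exact hc
  have hnullM : ∀ x : (ι →₀ ℝ), (∀ c ∈ S'.F, x c = 0) → M' (x, 0) = 0 := fun x hx => by
    have hx0 : ∀ c ∈ S.F, x c = 0 := fun c hc => hx c ((hF' c).2 (Or.inl hc))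
    refine le_antisymm (hM3 _ _ le_rfl (hS.null x hx0).1.le fun i hi => ?_) (apply_nonneg _ _)
    rw [hφ, hx _ ((hF' _).2 (Or.inr ⟨i, hi, rfl⟩)), hgnull x hx0 i]
    simp [show ((0 : (ι →₀ ℝ)), (0 : B)) = 0 from rfl]
  refine ⟨S', r, ⟨?_, ?_, ?_, ?_, ?_, ?_⟩, ⟨Finset.subset_union_left, hM1, hstab, hle'2, hexp, ?_⟩,
    hr, hF'⟩
  · intro x hx
    have h1 := hnullM x hx
    refine ⟨h1, le_antisymm ?_ (apply_nonneg _ _)⟩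
    have := hle'2 x 0
    rw [zero_smul] at this
    exact this.trans h1.le
  · rintro ⟨x, b⟩
    show M' (x, b) ≤ lam * Q' (x, b)
    refine le_of_forall_pos_le_add fun ε hε => ?_
    have hlp : 0 < lam := by linarith
    obtain ⟨x', t, hx', h⟩ := hQlt x b (ε / lam) (by positivity)
    have h1 := map_add_le_add M' (x - x', (-t) • z) (x', b + t • z)
    have h4 : ((x - x', (-t) • z) + (x', b + t • z) : (ι →₀ ℝ) × B) = (x, b) := by simp
    rw [h4] at h1
    have h2 : M' (x', b + t • z) ≤ lam * S.Q (x', b + t • z) := by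
      refine hM3 _ _ (mul_nonneg hlam0 (apply_nonneg _ _)) (hS.le _) fun i hi => ?_
      rw [hφ, hx' _ (heF i), zero_add]
      exact hg i _
    have h3 : M' (x - x', (-t) • z) ≤ lam * M' (x - x', (-t) • z) :=
      le_mul_of_one_le_left (apply_nonneg _ _) hlam1
    have h5 := mul_le_mul_of_nonneg_left h.le hlam0
    rw [mul_add, mul_add, mul_div_cancel₀ _ hlp.ne'] at h5
    linarith
  · intro x
    have := hle'2 x 0
    rwa [zero_smul] at this
  · intro b
    rw [show S'.Q = Q' from rfl, hstab 0 (fun _ _ => rfl), hS.Q0]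
  · intro b
    obtain ⟨x, hx, hxb⟩ := hS.kill b
    obtain ⟨u, hu1, hu2, hu3⟩ := hnewnull (fun i => - g i (x, -b))
    refine ⟨x + u, fun c hc => ?_, ?_⟩
    · obtain ⟨h1, h2⟩ := hF'n c hc
      simp [hx c h1, hu3 c h2]
    · have hs : ((x + u, -b) : (ι →₀ ℝ) × B) = (x, -b) + (u, 0) := by simp
      refine le_antisymm (hM3 _ _ le_rfl ?_ fun i hi => ?_) (apply_nonneg _ _)
      · rw [hs]
        refine (map_add_le_add _ _ _).trans ?_
        rw [hxb, (hS.null u hu1).1, add_zero]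
      · rw [hs, map_add, hφ, hφ, hx _ (heF i), hu2 i hi, hgnull u hu1]
        simp [show ((0 : (ι →₀ ℝ)), (0 : B)) = 0 from rfl]
  · obtain ⟨k, hk, θ, hc, hθ, hsurj⟩ := hS.iso
    let θ' : (ι →₀ ℝ) →ₗ[ℝ] (k ⊕ Fin r → ℝ) := LinearMap.pi fun j =>
      Sum.elim (fun a => LinearMap.proj a ∘ₗ θ)
        (fun i : Fin r => φ i ∘ₗ LinearMap.inl ℝ (ι →₀ ℝ) B) j
    have hl : ∀ x a, θ' x (Sum.inl a) = θ x a := fun x a => rfl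
    have hr' : ∀ x i, θ' x (Sum.inr i) = φ i (x, 0) := fun x a => rfl
    refine ⟨k ⊕ Fin r, inferInstance, θ', ?_, fun x => ?_, fun y => ?_⟩
    · simp only [Fintype.card_sum, Fintype.card_fin]
      omega
    · apply le_antisymm
      · refine hM3 _ _ (norm_nonneg _) ?_ fun i hi => ?_
        · rw [hθ]
          refine (pi_norm_le_iff_of_nonneg (norm_nonneg _)).2 fun a => ?_
          rw [← hl]
          exact norm_le_pi_norm _ _
        · exact norm_le_pi_norm (θ' x) (Sum.inr ⟨i, hi⟩)
      · refine (pi_norm_le_iff_of_nonneg (apply_nonneg _ _)).2 ?_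
        rintro (a | i)
        · rw [hl]
          refine le_trans (norm_le_pi_norm (θ x) a) ?_
          rw [← hθ]
          exact hM1 _
        · rw [hr']
          exact hM2 _ _ i.2
    · obtain ⟨x, hx, hxy⟩ := hsurj fun a => y (Sum.inl a)
      obtain ⟨u, hu1, hu2, hu3⟩ := hnewnull
        (fun i => if h : i < r then y (Sum.inr ⟨i, h⟩) - g i (x, 0) else 0)
      have hu0 : θ u = 0 := by
        rw [← norm_eq_zero, ← hθ]
        exact (hS.null u hu1).1
      refine ⟨x + u, fun c hc => ?_, ?_⟩
      · obtain ⟨h1, h2⟩ := hF'n c hc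
        simp [hx c h1, hu3 c h2]
      · ext (a | i)
        · rw [hl, map_add, hu0, add_zero, hxy]
        · have hs : ((x + u, 0) : (ι →₀ ℝ) × B) = (x, 0) + (u, 0) := by simp
          rw [hr', hs, map_add, hφ, hφ, hx _ (heF i), hu2 i i.2, hgnull u hu1]
          simp [show ((0 : (ι →₀ ℝ)), (0 : B)) = 0 from rfl]
  · intro x b ε hε
    obtain ⟨x', t, hx', h⟩ := hQlt x b ε hε
    exact ⟨x', t, hx', h.le⟩

end BP
end

open Filter Topology MeasureTheory

/-! ### Part 3c: chains of `ℓ∞ⁿ` spaces -/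

noncomputable section

theorem linfty_of_chain {Y : Type*} [NormedAddCommGroup Y] [NormedSpace ℝ Y] [CompleteSpace Y]
    (lam : ℝ) (hlam : 1 ≤ lam) (m : ℕ → ℕ) (hm : ∀ n, n ≤ m n)
    (ψ : ∀ n, (Fin (m n) → ℝ) →ₗ[ℝ] Y)
    (h1 : ∀ n y, ‖ψ n y‖ ≤ ‖y‖) (h2 : ∀ n y, ‖y‖ ≤ lam * ‖ψ n y‖)
    (hmono : ∀ n n', n ≤ n' → LinearMap.range (ψ n) ≤ LinearMap.range (ψ n'))
    (happ : ∀ y, ∀ δ > 0, ∃ n v, ‖y - ψ n v‖ < δ) : IsLinftyPlus lam Y := by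
  have hinj : ∀ n, Function.Injective (ψ n) := fun n => by
    rw [injective_iff_map_eq_zero]
    intro y hy
    have := h2 n y
    rw [hy, norm_zero, mul_zero] at this
    exact norm_le_zero_iff.1 this
  have hinf : ¬ FiniteDimensional ℝ Y := by
    intro hfd
    have h3 := LinearMap.finrank_le_finrank_of_injective (hinj (Module.finrank ℝ Y + 1))
    rw [Module.finrank_fin_fun] at h3
    have := hm (Module.finrank ℝ Y + 1)
    omega
  intro θ hθ
  refine ⟨hinf, fun F hF => ?_⟩
  obtain ⟨ε, hε, hε1, hεθ⟩ : ∃ ε : ℝ, 0 < ε ∧ ε < 1 ∧ lam * (1 + ε) * (1 - ε)⁻¹ ≤ θ := by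
    have hc : ContinuousAt (fun ε : ℝ => lam * (1 + ε) * (1 - ε)⁻¹) 0 := by
      refine ContinuousAt.mul (by fun_prop) (ContinuousAt.inv₀ (by fun_prop) (by norm_num))
    have h3 : ∀ᶠ ε : ℝ in 𝓝 0, lam * (1 + ε) * (1 - ε)⁻¹ < θ :=
      hc.eventually_lt continuousAt_const (by simpa using hθ)
    have h4 : ∀ᶠ ε : ℝ in 𝓝[>] 0, lam * (1 + ε) * (1 - ε)⁻¹ < θ ∧ 0 < ε ∧ ε < 1 := by
      refine (h3.filter_mono nhdsWithin_le_nhds).and ?_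
      exact Ioo_mem_nhdsGT one_pos
    obtain ⟨ε, h5, h6, h7⟩ := h4.exists
    exact ⟨ε, h6, h7, h5.le⟩
  let b := Module.finBasis ℝ F
  set d := Module.finrank ℝ F
  choose f hf _ using fun i : Fin d => exists_extension_norm_eq F (b.coord i).toContinuousLinearMap
  let C : ℝ := ∑ i, ‖f i‖ + 1
  have hC : 0 < C := by
    have : 0 ≤ ∑ i, ‖f i‖ := Finset.sum_nonneg fun i _ => norm_nonneg _
    positivity
  choose n0 v0 hv0 using fun i : Fin d => happ (b i : Y) (ε / C) (by positivity)
  let n := Finset.univ.sup n0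
  have hw : ∀ i, ∃ w, ψ n w = ψ (n0 i) (v0 i) := fun i =>
    hmono (n0 i) n (Finset.le_sup (Finset.mem_univ i)) ⟨v0 i, rfl⟩
  choose w hw using hw
  let t : Y →L[ℝ] Y := ∑ i, (f i).smulRight ((b i : Y) - ψ n (w i))
  have ht : ∀ y, t y = ∑ i, f i y • ((b i : Y) - ψ n (w i)) := fun y => by simp [t]
  have htn : ‖t‖ ≤ ε := by
    refine ContinuousLinearMap.opNorm_le_bound _ hε.le fun y => ?_
    rw [ht]
    calc ‖∑ i, f i y • ((b i : Y) - ψ n (w i))‖ ≤ ∑ i, ‖f i‖ * ‖y‖ * (ε / C) := by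
          refine norm_sum_le_of_le _ fun i _ => ?_
          rw [norm_smul, hw]
          exact mul_le_mul ((f i).le_opNorm y) (hv0 i).le (norm_nonneg _) (by positivity)
      _ = (∑ i, ‖f i‖) * (‖y‖ * (ε / C)) := by rw [Finset.sum_mul]; simp [mul_assoc]
      _ ≤ C * (‖y‖ * (ε / C)) := by
          refine mul_le_mul_of_nonneg_right ?_ (by positivity)
          simp [C]
      _ = ε * ‖y‖ := by field_simp
  let R : Y ≃L[ℝ] Y := ContinuousLinearEquiv.ofUnit (Units.oneSub t (htn.trans_lt hε1))
  have hR : ∀ y, R y = y - t y := fun y => rfl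
  have hR1 : ∀ y, ‖R y‖ ≤ (1 + ε) * ‖y‖ := fun y => by
    rw [hR]
    have h3 := norm_sub_le y (t y)
    have h4 := t.le_of_opNorm_le htn y
    linarith
  have hR2 : ∀ y, (1 - ε) * ‖y‖ ≤ ‖R y‖ := fun y => by
    rw [hR]
    have h3 := norm_sub_norm_le y (t y)
    have h4 := t.le_of_opNorm_le htn y
    linarith
  let χ : (Fin (m n) → ℝ) →ₗ[ℝ] Y := R.symm.toLinearEquiv.toLinearMap ∘ₗ ψ n
  have hχ : ∀ y, R (χ y) = ψ n y := fun y => R.apply_symm_apply _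
  have hχi : Function.Injective χ := R.symm.injective.comp (hinj n)
  let e0 : (Fin (m n) → ℝ) ≃ₗ[ℝ] LinearMap.range χ := LinearEquiv.ofInjective χ hχi
  have he0 : ∀ y, ((e0 y : LinearMap.range χ) : Y) = χ y := fun y => rfl
  refine ⟨LinearMap.range χ, ?_, inferInstance, ?_⟩
  · have hbm : ∀ i, (b i : Y) ∈ LinearMap.range χ := fun i => by
      refine ⟨w i, R.injective ?_⟩
      rw [hχ, hR, ht, Finset.sum_eq_single i]
      · rw [hf]
        simp
      · intro j _ hj
        rw [hf]
        simp [Finsupp.single_apply, hj.symm]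
      · simp
    intro y hy
    have := b.sum_repr ⟨y, hy⟩
    have h3 : y = ∑ i, b.repr ⟨y, hy⟩ i • (b i : Y) := by
      have := congrArg (Submodule.subtype F) this
      rw [map_sum] at this
      exact this.symm
    rw [h3]
    exact Submodule.sum_mem _ fun i _ => Submodule.smul_mem _ _ (hbm i)
  · have hfr : Module.finrank ℝ (LinearMap.range χ) = m n := by
      rw [← e0.finrank_eq, Module.finrank_fin_fun]
    rw [hfr]
    intro θ' hθ'
    let e : LinearMap.range χ ≃L[ℝ] (Fin (m n) → ℝ) := e0.symm.toContinuousLinearEquiv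
    refine ⟨e, ?_⟩
    have hε' : 0 < 1 - ε := by linarith
    have n1 : ‖(e : LinearMap.range χ →L[ℝ] (Fin (m n) → ℝ))‖ ≤ lam * (1 + ε) := by
      refine ContinuousLinearMap.opNorm_le_bound _ (by positivity) fun y => ?_
      obtain ⟨u, rfl⟩ := e0.surjective y
      have : e (e0 u) = u := e0.symm_apply_apply u
      rw [ContinuousLinearEquiv.coe_coe, this]
      refine (h2 n u).trans ?_
      rw [← hχ, mul_assoc]
      exact mul_le_mul_of_nonneg_left (hR1 _) (by linarith)
    have n2 : ‖(e.symm : (Fin (m n) → ℝ) →L[ℝ] LinearMap.range χ)‖ ≤ (1 - ε)⁻¹ := by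
      refine ContinuousLinearMap.opNorm_le_bound _ (by positivity) fun u => ?_
      have h3 : (e.symm u) = e0 u := rfl
      rw [ContinuousLinearEquiv.coe_coe, h3]
      have h4 := (hR2 (χ u)).trans ((hχ u ▸ h1 n u))
      show ‖χ u‖ ≤ _
      rw [inv_mul_eq_div, le_div_iff₀ hε', mul_comm]
      exact h4
    calc _ ≤ lam * (1 + ε) * (1 - ε)⁻¹ := mul_le_mul n1 n2 (ContinuousLinearMap.opNorm_nonneg _) (by positivity)
      _ ≤ θ' := hεθ.trans hθ'.le

/-- Sequences which are isometrically equivalent have isometric closed spans. -/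
theorem embeds_closedSpan {Y B : Type*} [NormedAddCommGroup Y] [NormedSpace ℝ Y] [CompleteSpace Y]
    [NormedAddCommGroup B] [NormedSpace ℝ B] [CompleteSpace B] (u : ℕ → Y) (w : ℕ → B)
    (h : ∀ a : ℕ →₀ ℝ, ‖lc u a‖ = ‖lc w a‖) :
    Embeds (Submodule.span ℝ (Set.range u)).topologicalClosure
      (Submodule.span ℝ (Set.range w)).topologicalClosure := by
  let p : Seminorm ℝ (ℕ →₀ ℝ) := (normSeminorm ℝ Y).comp (lc u)
  have hp : ∀ a, p a = ‖lc u a‖ := fun a => rfl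
  obtain ⟨F, hF, hF2, hF3⟩ := exists_liftCmp p (lc u) 1 (fun a => by rw [hp, one_mul])
  have hFn : ∀ y, ‖F y‖ = ‖y‖ := fun y => le_antisymm (by simpa using hF2 y)
    (by simpa using hF3 1 (fun a => by rw [hp, one_mul]) y)
  let Fi : Cmp p →ₗᵢ[ℝ] Y := ⟨F.toLinearMap, hFn⟩
  have hcl : IsClosed ((LinearMap.range Fi.toLinearMap : Submodule ℝ Y) : Set Y) :=
    Fi.isometry.isClosedEmbedding.isClosed_range
  obtain ⟨S, hS, hS2, hS3⟩ := exists_liftCmp p (lc w) 1 (fun a => by rw [hp, one_mul, h])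
  have hSn : ∀ y, ‖S y‖ = ‖y‖ := fun y => le_antisymm (by simpa using hS2 y)
    (by simpa using hS3 1 (fun a => by rw [hp, one_mul, h]) y)
  have hle : (Submodule.span ℝ (Set.range u)).topologicalClosure ≤
      LinearMap.range Fi.toLinearMap := by
    refine Submodule.topologicalClosure_minimal _ ?_ hcl
    rw [Submodule.span_le]
    rintro _ ⟨k, rfl⟩
    refine ⟨toCmp p (Finsupp.single k 1), ?_⟩
    show F _ = _
    rw [hF]
    simp
  have hmem : ∀ y, S y ∈ (Submodule.span ℝ (Set.range w)).topologicalClosure := by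
    intro y
    have hc : IsClosed {y | S y ∈ (Submodule.span ℝ (Set.range w)).topologicalClosure} :=
      (Submodule.isClosed_topologicalClosure _).preimage S.continuous
    refine (denseRange_toCmp p).induction_on y hc fun a => ?_
    rw [hS]
    exact Submodule.le_topologicalClosure _
      ((Finsupp.mem_span_range_iff_exists_finsupp).2 ⟨a, rfl⟩)
  let e : Cmp p ≃ₗᵢ[ℝ] LinearMap.range Fi.toLinearMap := Fi.equivRange
  let S' : Cmp p →L[ℝ] (Submodule.span ℝ (Set.range w)).topologicalClosure := S.codRestrict _ hmem
  let T : (Submodule.span ℝ (Set.range u)).topologicalClosure →ₗ[ℝ]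
      (Submodule.span ℝ (Set.range w)).topologicalClosure :=
    S'.toLinearMap ∘ₗ e.symm.toLinearEquiv.toLinearMap ∘ₗ (Submodule.inclusion hle)
  have hT : ∀ y, ‖T y‖ = ‖y‖ := fun y => by
    show ‖S (e.symm _)‖ = _
    rw [hSn, LinearIsometryEquiv.norm_map]
    rfl
  exact ⟨T.mkContinuous 1 fun y => by rw [hT, one_mul], 1, one_pos, fun y => by
    rw [one_mul]; exact (hT y).ge⟩

end

open Filter Topology MeasureTheory

/-! ### Part 3d: the Bourgain–Pisier extension along a sequence -/

noncomputable section

theorem sn_sum_le {V ι : Type*} [AddCommGroup V] [Module ℝ V] (p : SemiN V) (s : Finset ι)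
    (f : ι → V) : p (∑ i ∈ s, f i) ≤ ∑ i ∈ s, p (f i) :=
  Finset.le_sum_of_subadditive p (map_zero p).le (map_add_le_add p) s f

theorem embeds_subtype {Y : Type*} [NormedAddCommGroup Y] [NormedSpace ℝ Y] (Z : Submodule ℝ Y) :
    Embeds Z Y := ⟨Z.subtypeL, 1, one_pos, fun x => by simp⟩

variable {ι B : Type*} [NormedAddCommGroup B] [NormedSpace ℝ B]

/-- An infinite run of the construction. -/
structure BPSeq (lam κ : ℝ) (z : ℕ → B) (S : ℕ → BPS ι B) : Prop where
  good : ∀ n, (S n).Good lam n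
  rel : ∀ n, BPRel κ (z n) (S n) (S (n + 1))

/-- vectors which are carried, along the run, by `F n` -/
def BPE (S : ℕ → BPS ι B) (n : ℕ) : Submodule ℝ (ι →₀ ℝ) where
  carrier := {x | ∀ m, ∀ c ∈ (S m).F, c ∉ (S n).F → x c = 0}
  add_mem' := fun {x y} hx hy m c h1 h2 => by simp [hx m c h1 h2, hy m c h1 h2]
  zero_mem' := fun m c _ _ => rfl
  smul_mem' := fun t x hx m c h1 h2 => by simp [hx m c h1 h2]

theorem mem_BPE {S : ℕ → BPS ι B} {n : ℕ} {x : ι →₀ ℝ} :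
    x ∈ BPE S n ↔ ∀ m, ∀ c ∈ (S m).F, c ∉ (S n).F → x c = 0 := Iff.rfl

theorem mem_BPE_of_supp {S : ℕ → BPS ι B} {n : ℕ} {x : ι →₀ ℝ} (h : ∀ c ∉ (S n).F, x c = 0) :
    x ∈ BPE S n := fun _ c _ h2 => h c h2

variable {lam κ : ℝ} {z : ℕ → B} {S : ℕ → BPS ι B}

namespace BPSeq

theorem F_mono (H : BPSeq lam κ z S) : Monotone fun n => (S n).F :=
  monotone_nat_of_le_succ fun n => (H.rel n).sub

theorem M_mono (H : BPSeq lam κ z S) (v) : Monotone fun n => (S n).M v :=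
  monotone_nat_of_le_succ fun n => (H.rel n).mono v

theorem E_mono (H : BPSeq lam κ z S) : Monotone (BPE S) := fun _ _ h _ hx m c h1 h2 =>
  hx m c h1 fun h3 => h2 (H.F_mono h h3)

theorem E_exh (H : BPSeq lam κ z S) (x : ι →₀ ℝ) : ∃ n, x ∈ BPE S n := by
  classical
  have h : ∀ c, ∃ n, ∀ m, c ∈ (S m).F → c ∈ (S n).F := fun c => by
    by_cases hc : ∃ n, c ∈ (S n).F
    · obtain ⟨n, hn⟩ := hc
      exact ⟨n, fun _ _ => hn⟩
    · push Not at hc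
      exact ⟨0, fun m hm => absurd hm (hc m)⟩
  choose N hN using h
  refine ⟨x.support.sup N, fun m c h1 h2 => ?_⟩
  by_contra h3
  exact h2 (H.F_mono (Finset.le_sup (Finsupp.mem_support_iff.2 h3)) (hN c m h1))

/-- replacement by an honestly supported vector -/
theorem exists_filter (H : BPSeq lam κ z S) {n : ℕ} {x : ι →₀ ℝ} (hx : x ∈ BPE S n) :
    ∃ u : ι →₀ ℝ, (∀ c ∉ (S n).F, u c = 0) ∧ (∀ m b, (S m).Q (x, b) = (S m).Q (u, b)) ∧
      (∀ m b, (S m).M (x, b) = (S m).M (u, b)) ∧ ∀ m, (S m).M (x - u, 0) = 0 := by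
  classical
  refine ⟨x.filter (· ∈ (S n).F), fun c hc => Finsupp.filter_apply_neg _ _ hc, ?_⟩
  have h0 : ∀ m, ∀ c ∈ (S m).F, (x - x.filter (· ∈ (S n).F)) c = 0 := fun m c hc => by
    by_cases h : c ∈ (S n).F
    · simp [h]
    · simp [h, hx m c hc h]
  have hs : ∀ b : B, ((x, b) - (x.filter (· ∈ (S n).F), b) : (ι →₀ ℝ) × B) =
    (x - x.filter (· ∈ (S n).F), 0) := by simp
  refine ⟨fun m b => sn_eq_of_sub_zero _ ?_, fun m b => sn_eq_of_sub_zero _ ?_,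
    fun m => ((H.good m).null _ (h0 m)).1⟩
  · rw [hs]
    exact ((H.good m).null _ (h0 m)).2
  · rw [hs]
    exact ((H.good m).null _ (h0 m)).1

theorem Q_stab (H : BPSeq lam κ z S) {n : ℕ} {x : ι →₀ ℝ} (hx : x ∈ BPE S n) (b : B) :
    ∀ m ≥ n, (S m).Q (x, b) = (S n).Q (x, b) := by
  obtain ⟨u, hu, hQ, _⟩ := H.exists_filter hx
  intro m hm
  rw [hQ, hQ]
  induction m, hm using Nat.le_induction with
  | base => rfl
  | succ m hm ih =>
    rw [← ih, (H.rel m).stab u (fun c hc => hu c fun h => hc (H.F_mono hm h))]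

theorem exists_lim (H : BPSeq lam κ z S) :
    ∃ Q : SemiN ((ι →₀ ℝ) × B), ∀ n, ∀ x ∈ BPE S n, ∀ b, Q (x, b) = (S n).Q (x, b) := by
  obtain ⟨Q, hQ⟩ := exists_evSN (fun n => (S n).Q) (fun v => by
    obtain ⟨n, hn⟩ := H.E_exh v.1
    exact ⟨n, fun m hm => H.Q_stab hn v.2 m hm⟩)
  refine ⟨Q, fun n x hx b => ?_⟩
  obtain ⟨N, hN⟩ := hQ (x, b)
  rw [hN (max N n) (le_max_left _ _), H.Q_stab hx b _ (le_max_right _ _)]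

end BPSeq

/-- A run with its limit seminorm. -/
structure BPLim (lam κ : ℝ) (z : ℕ → B) (S : ℕ → BPS ι B) (Q : SemiN ((ι →₀ ℝ) × B)) : Prop
    extends BPSeq lam κ z S where
  lim : ∀ n, ∀ x ∈ BPE S n, ∀ b, Q (x, b) = (S n).Q (x, b)

/-- The seminorm on `ι →₀ ℝ`. -/
def bpq (Q : SemiN ((ι →₀ ℝ) × B)) : Seminorm ℝ (ι →₀ ℝ) := pullSN Q (LinearMap.inl ℝ (ι →₀ ℝ) B)

theorem bpq_apply (Q : SemiN ((ι →₀ ℝ) × B)) (x) : bpq Q x = Q (x, 0) := rfl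

namespace BPLim
variable {Q : SemiN ((ι →₀ ℝ) × B)}

theorem loc (H : BPLim lam κ z S Q) (x : ι →₀ ℝ) (hx : ∀ m, ∀ c ∈ (S m).F, x c = 0) :
    bpq Q x = 0 := by
  rw [bpq_apply, H.lim 0 x (fun m c hc _ => hx m c hc)]
  exact ((H.good 0).null x (hx 0)).2

theorem c3 (H : BPLim lam κ z S Q) (n : ℕ) (x u : ι →₀ ℝ) (hu : ∀ c ∉ (S n).F, u c = 0)
    (hxu : ∀ c ∈ (S n).F, u c = x c) : bpq Q u ≤ lam * bpq Q x := by
  obtain ⟨N, hN⟩ := H.E_exh x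
  have hN' := H.E_mono (le_max_left N n) hN
  rw [bpq_apply, bpq_apply, H.lim n u (mem_BPE_of_supp hu), H.lim _ x hN']
  calc (S n).Q (u, 0) ≤ (S n).M (u, 0) := (H.good n).le' u
    _ = (S n).M (x, 0) := by
      refine sn_eq_of_sub_zero _ ?_
      have : ((u, 0) - (x, 0) : (ι →₀ ℝ) × B) = (u - x, 0) := by simp
      rw [this]
      exact ((H.good n).null _ fun c hc => by simp [hxu c hc]).1
    _ ≤ (S (max N n)).M (x, 0) := H.M_mono _ (le_max_right _ _)
    _ ≤ _ := (H.good _).le _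

theorem linfty (H : BPLim lam κ z S Q) (hlam : 1 ≤ lam) : IsLinftyPlus lam (Cmp (bpq Q)) := by
  classical
  have key : ∀ n, ∃ m, n ≤ m ∧ ∃ η : (Fin m → ℝ) →ₗ[ℝ] (ι →₀ ℝ),
      (∀ y, ∀ c ∉ (S n).F, η y c = 0) ∧ (∀ y, (S n).M (η y, 0) = ‖y‖) ∧
      ∀ x, ∃ y, (S n).M (x - η y, 0) = 0 := by
    intro n
    obtain ⟨k, hk, θ, hc, hθ, hsurj⟩ := (H.good n).iso
    choose x hx hxθ using fun j : k => hsurj (Pi.single j 1)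
    let e := Fintype.equivFin k
    let η : (Fin (Fintype.card k) → ℝ) →ₗ[ℝ] (ι →₀ ℝ) :=
      ∑ j : k, (LinearMap.proj (e j) : (Fin (Fintype.card k) → ℝ) →ₗ[ℝ] ℝ).smulRight (x j)
    have hη : ∀ y, η y = ∑ j, y (e j) • x j := fun y => by simp [η]
    have hθη : ∀ y, θ (η y) = y ∘ e := fun y => by
      rw [hη, map_sum]
      simp only [map_smul, hxθ]
      ext j
      rw [Finset.sum_apply, Finset.sum_eq_single j]
      · simp
      · intro i _ hi
        simp [Pi.single_apply, hi.symm]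
      · simp
    refine ⟨_, hc, η, fun y c hc => ?_, fun y => ?_, fun u => ⟨θ u ∘ e.symm, ?_⟩⟩
    · rw [hη, Finsupp.finsetSum_apply]
      exact Finset.sum_eq_zero fun j _ => by simp [hx j c hc]
    · rw [hθ, hθη]
      apply le_antisymm
      · exact (pi_norm_le_iff_of_nonneg (norm_nonneg _)).2 fun j => norm_le_pi_norm y (e j)
      · refine (pi_norm_le_iff_of_nonneg (norm_nonneg _)).2 fun j => ?_
        have := norm_le_pi_norm (y ∘ e) (e.symm j)
        simpa using this
    · rw [hθ, map_sub, hθη]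
      simp [Function.comp_assoc]
  choose m hm η hη1 hη2 hη3 using key
  have hq : ∀ n x, x ∈ BPE S n → bpq Q x ≤ (S n).M (x, 0) := fun n x hx => by
    rw [bpq_apply, H.lim n x hx]
    exact (H.good n).le' x
  have hηE : ∀ n y, η n y ∈ BPE S n := fun n y => mem_BPE_of_supp (hη1 n y)
  have hr : ∀ n x, x ∈ BPE S n → ∃ y, toCmp (bpq Q) (η n y) = toCmp (bpq Q) x := fun n x hx => by
    obtain ⟨y, hy⟩ := hη3 n x
    refine ⟨y, ?_⟩
    rw [eq_comm, ← sub_eq_zero, ← map_sub, ← norm_eq_zero, norm_toCmp]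
    refine le_antisymm ?_ (apply_nonneg _ _)
    exact (hq n _ (Submodule.sub_mem _ hx (hηE n y))).trans hy.le
  refine linfty_of_chain lam hlam m hm (fun n => toCmp (bpq Q) ∘ₗ η n) ?_ ?_ ?_ ?_
  · intro n y
    rw [LinearMap.comp_apply, norm_toCmp]
    exact (hq n _ (hηE n y)).trans (hη2 n y).le
  · intro n y
    rw [LinearMap.comp_apply, norm_toCmp, bpq_apply, H.lim n _ (hηE n y), ← hη2 n y]
    exact (H.good n).le _
  · rintro n n' hn _ ⟨y, rfl⟩
    obtain ⟨y', hy'⟩ := hr n' _ (H.E_mono hn (hηE n y))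
    exact ⟨y', hy'⟩
  · intro y δ hδ
    obtain ⟨v, hv⟩ := approx_toCmp (bpq Q) y hδ
    obtain ⟨n, hn⟩ := H.E_exh v
    obtain ⟨w, hw⟩ := hr n v hn
    exact ⟨n, w, by rwa [LinearMap.comp_apply, hw]⟩

theorem exists_zeta (H : BPLim lam κ z S Q) : ∃ ζ : ℕ → (ι →₀ ℝ),
    ∀ x b (a : ℕ →₀ ℝ), Q (x, b + lc z a) = Q (x + lc ζ a, b) := by
  have h : ∀ n, ∃ ζ : ι →₀ ℝ, Q (ζ, - z n) = 0 := fun n => by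
    obtain ⟨x, hx, hM⟩ := (H.good (n + 1)).kill (z n)
    refine ⟨x, le_antisymm ?_ (apply_nonneg _ _)⟩
    rw [H.lim (n + 1) x (mem_BPE_of_supp hx)]
    have := (H.rel n).le' x (-1)
    rw [neg_one_smul] at this
    exact this.trans hM.le
  choose ζ hζ using h
  have h2 : ∀ a : ℕ →₀ ℝ, Q (lc ζ a, - lc z a) = 0 := fun a => by
    obtain ⟨N, hN⟩ := exists_bound_support a
    have : ((lc ζ a, - lc z a) : (ι →₀ ℝ) × B) = ∑ k ∈ Finset.range N, a k • (ζ k, - z k) := by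
      rw [lc_eq_sum_range ζ a hN, lc_eq_sum_range z a hN]
      ext1
      · simp [Prod.fst_sum]
      · simp [Prod.snd_sum]
    rw [this]
    refine le_antisymm ((sn_sum_le Q _ _).trans (Finset.sum_nonpos fun k _ => ?_))
      (apply_nonneg _ _)
    rw [map_smul_eq_mul, hζ, mul_zero]
  refine ⟨ζ, fun x b a => (sn_eq_of_sub_zero Q ?_).symm⟩
  have : ((x + lc ζ a, b) - (x, b + lc z a) : (ι →₀ ℝ) × B) = (lc ζ a, - lc z a) := by simp
  rw [this, h2]

theorem Q0 (H : BPLim lam κ z S Q) (b : B) : Q (0, b) = ‖b‖ := by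
  rw [H.lim 0 0 (Submodule.zero_mem _), (H.good 0).Q0]

theorem embeds_span [CompleteSpace B] (H : BPLim lam κ z S Q) :
    Embeds (Submodule.span ℝ (Set.range z)).topologicalClosure (Cmp (bpq Q)) := by
  obtain ⟨ζ, hζ⟩ := H.exists_zeta
  refine Embeds.trans' (embeds_closedSpan z (fun k => toCmp (bpq Q) (ζ k)) fun a => ?_)
    (embeds_subtype _)
  rw [← lc_map, norm_toCmp, bpq_apply]
  have := hζ 0 0 a
  rw [zero_add, zero_add, H.Q0] at this
  exact this

theorem embeds_of_embeds [CompleteSpace B] (H : BPLim lam κ z S Q) (hκ : 1 < κ)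
    {X : Type*} [NormedAddCommGroup X]
    [NormedSpace ℝ X] [CompleteSpace X] (hmin : IsMinimal X) (hXl1 : ¬ Embeds EllOne X)
    (hX : Embeds X (Cmp (bpq Q))) :
    Embeds X (Submodule.span ℝ (Set.range z)).topologicalClosure := by
  obtain ⟨ζ, hζ⟩ := H.exists_zeta
  obtain ⟨T, c, hc, hT⟩ := hX
  let L : LinM ((ι →₀ ℝ) × (ℕ →₀ ℝ)) ((ι →₀ ℝ) × B) :=
    LinearMap.prodMap LinearMap.id (lc z)
  let D : Seminorm ℝ (ι →₀ ℝ) := minSN (pullSN Q L)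
  have hDle : ∀ x a, D x ≤ Q (x, lc z a) := fun x a => minSN_le (pullSN Q L) x a
  have hDlt : ∀ x, ∀ ε > 0, ∃ a, Q (x, lc z a) < D x + ε := fun x ε hε =>
    exists_minSN_lt (pullSN Q L) x hε
  let Lm : ∀ n, LinM ((ι →₀ ℝ) × ℝ) ((ι →₀ ℝ) × B) := fun n =>
    LinearMap.prodMap LinearMap.id (LinearMap.toSpanSingleton ℝ B (z n))
  let m : ℕ → Seminorm ℝ (ι →₀ ℝ) := fun n =>
    minSN (pullSN (S n).M (Lm (n - 1)))
  have hmle : ∀ n x (t : ℝ), m (n + 1) x ≤ (S (n + 1)).M (x, t • z n) := fun n x t =>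
    minSN_le (pullSN (S (n + 1)).M (Lm n)) x t
  have hlem : ∀ n x c, (∀ t : ℝ, c ≤ (S (n + 1)).M (x, t • z n)) → c ≤ m (n + 1) x :=
    fun n x c h => le_minSN (pullSN (S (n + 1)).M (Lm n)) x c h
  have hlc : ∀ n (t : ℝ), t • z n = lc z (Finsupp.single n t) := fun n t => by simp
  have HD : SchurData (BPE S) D m κ := by
    refine ⟨H.E_mono, H.E_exh, ?_, ?_, ?_, ?_⟩
    · intro N x hx ε hε
      obtain ⟨a, ha⟩ := hDlt x (ε / 2) (half_pos hε)
      obtain ⟨u, hu, hQ, hM, hM0⟩ := H.exists_filter hx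
      obtain ⟨x', t, hx', h⟩ := (H.rel N).dec u (lc z a) (ε / 2) (half_pos hε)
      refine ⟨x', mem_BPE_of_supp hx', ?_⟩
      have h1 : D x' ≤ Q (x', lc z a + t • z N) := by
        have := hDle x' (a + Finsupp.single N t)
        rwa [map_add, ← hlc] at this
      rw [H.lim N x' (mem_BPE_of_supp hx')] at h1
      rw [H.lim (N + 1) x hx, hQ] at ha
      have h2 := hmle N (x - x') (-t)
      have h3 : (S (N + 1)).M (x - x', (-t) • z N) = (S (N + 1)).M (u - x', (-t) • z N) := by
        refine sn_eq_of_sub_zero _ ?_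
        have e1 : ((x - x', (-t) • z N) - (u - x', (-t) • z N) : (ι →₀ ℝ) × B) =
          (x - u, 0) := by simp
        rw [e1, hM0]
      linarith
    · intro N x hx
      refine hlem N x _ fun t => ?_
      refine (hDle x (Finsupp.single N t)).trans ?_
      rw [← hlc, H.lim (N + 1) x hx]
      exact (H.rel N).le' x t
    · intro N x hx
      refine hlem N x _ fun t => ?_
      obtain ⟨u, hu, hQ, hM, hM0⟩ := H.exists_filter hx
      refine le_trans ?_ (((H.rel N).exp u hu t).trans (hM _ _).ge)
      refine mul_le_mul_of_nonneg_left ?_ (by linarith)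
      rw [← hQ, ← H.lim N x hx, hlc]
      exact hDle x _
    · intro N
      refine ⟨Finsupp.supported ℝ ℝ ((S N).F : Set ι),
        Module.Finite.equiv (Finsupp.supportedEquivFinsupp ((S N).F : Set ι)).symm,
        fun x hx => ?_⟩
      classical
      refine ⟨x.filter (· ∈ (S N).F), ?_, ?_⟩
      · rw [Finsupp.mem_supported']
        exact fun c hc => Finsupp.filter_apply_neg _ _ hc
      · refine le_antisymm ((hDle _ 0).trans ?_) (apply_nonneg _ _)
        rw [map_zero]
        refine (H.loc _ fun m c hc => ?_).le
        by_cases h : c ∈ (S N).F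
        · have : (x - x.filter (· ∈ (S N).F)) c = 0 := by simp [h]
          exact this
        · have : (x - x.filter (· ∈ (S N).F)) c = 0 := by simp [h, hx m c hc h]
          exact this
  have hDq : ∀ v, D v ≤ 1 * bpq Q v := fun v => by
    have := hDle v 0
    rwa [map_zero, ← bpq_apply, ← one_mul (bpq Q v)] at this
  obtain ⟨π, hπ, hπ2, _⟩ := exists_liftCmp (bpq Q) (toCmp D) 1 fun v => by
    rw [norm_toCmp]
    exact hDq v
  let ρ : Seminorm ℝ X := (normSeminorm ℝ (Cmp D)).comp (π.toLinearMap ∘ₗ T.toLinearMap)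
  have hρ : ∀ x, ρ x = ‖π (T x)‖ := fun x => rfl
  have hcl := Submodule.isClosed_topologicalClosure
    (Submodule.span ℝ (Set.range fun k => toCmp (bpq Q) (ζ k)))
  rcases dist_dichotomy hmin T c hc hT _ hcl ρ (fun x t ht => by
    have hη : 0 < (t - ρ x) / 4 := by linarith
    set η := (t - ρ x) / 4 with hηdef
    obtain ⟨v, hv⟩ := approx_toCmp (bpq Q) (T x) hη
    have h1 : D v ≤ ρ x + η := by
      rw [← norm_toCmp, ← hπ, hρ]
      have h2 := hπ2 (T x - toCmp (bpq Q) v)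
      have h3 := norm_sub_norm_le (π (toCmp (bpq Q) v)) (π (T x))
      rw [norm_sub_rev, ← map_sub] at h3
      linarith
    obtain ⟨a, ha⟩ := hDlt v η hη
    have h4 := hζ v 0 a
    rw [zero_add] at h4
    rw [h4, ← bpq_apply, ← norm_toCmp, map_add, lc_map] at ha
    refine ⟨- lc (fun k => toCmp (bpq Q) (ζ k)) a, ?_, ?_⟩
    · exact neg_mem (Submodule.le_topologicalClosure _
        ((Finsupp.mem_span_range_iff_exists_finsupp).2 ⟨a, rfl⟩))
    · have h5 := norm_add_le (T x - toCmp (bpq Q) v)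
        (toCmp (bpq Q) v + lc (fun k => toCmp (bpq Q) (ζ k)) a)
      have h6 : T x - toCmp (bpq Q) v + (toCmp (bpq Q) v + lc (fun k => toCmp (bpq Q) (ζ k)) a) =
        T x - - lc (fun k => toCmp (bpq Q) (ζ k)) a := by abel
      rw [h6] at h5
      linarith) with h | h
  · exfalso
    obtain ⟨Φ, hΦ, c', hc', hlow⟩ := h
    refine hXl1 (HD.l1 hκ hmin.1 (bpq Q) 1 one_pos hDq T Φ hΦ c' hc' fun x hx v => ?_)
    have h1 := hlow x hx
    have h2 := hπ2 (T x - toCmp (bpq Q) v)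
    have h3 := norm_sub_norm_le (π (T x)) (π (toCmp (bpq Q) v))
    rw [← map_sub, hπ, norm_toCmp] at h3
    rw [hρ] at h1
    linarith
  · refine Embeds.trans' h (embeds_closedSpan (fun k => toCmp (bpq Q) (ζ k)) z fun a => ?_)
    rw [← lc_map, norm_toCmp, bpq_apply]
    have := hζ 0 0 a
    rw [zero_add, zero_add, H.Q0] at this
    exact this.symm

end BPLim
end

open Filter Topology MeasureTheory

noncomputable section

variable {B : Type*} [NormedAddCommGroup B] [NormedSpace ℝ B]

theorem res_len (σ : ℕ → ℕ) (n : ℕ) : (PiNat.res σ n).length = n := PiNat.res_length σ n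

theorem suffix_res {s : List ℕ} {σ : ℕ → ℕ} {n : ℕ} :
    s <:+ PiNat.res σ n ↔ ∃ k ≤ n, s = PiNat.res σ k := by
  induction n with
  | zero => simp [PiNat.res_zero]
  | succ n ih =>
    rw [PiNat.res_succ, List.suffix_cons_iff, ih]
    constructor
    · rintro (h | ⟨k, hk, h⟩)
      · exact ⟨n + 1, le_rfl, by rw [h, PiNat.res_succ]⟩
      · exact ⟨k, hk.trans n.le_succ, h⟩
    · rintro ⟨k, hk, h⟩
      rcases Nat.lt_or_ge n k with h1 | h1
      · have : k = n + 1 := by omega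
        subst this
        exact Or.inl (by rw [h, PiNat.res_succ])
      · exact Or.inr ⟨k, h1, h⟩

/-- The tree of states. -/
theorem exists_tree {lam κ : ℝ} (hκ : 1 ≤ κ) (hl : κ < lam) (z : List ℕ → B) :
    ∃ (st : List ℕ → BPS (List ℕ × ℕ) B) (r : List ℕ → ℕ),
      (∀ s, (st s).Good lam s.length) ∧
      (∀ a s, BPRel κ (z (a :: s)) (st s) (st (a :: s))) ∧
      ∀ s c, c ∈ (st s).F ↔ c.1 <:+ s ∧ c.1 ≠ [] ∧ c.2 < r c.1 := by
  classical
  let P : List ℕ → Type _ := fun s =>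
    {S : BPS (List ℕ × ℕ) B × ℕ // S.1.Good lam s.length ∧ ∀ c ∈ S.1.F, c.1 <:+ s}
  have hstep : ∀ (a : ℕ) (s : List ℕ) (S : P s), ∃ S' : P (a :: s),
      BPRel κ (z (a :: s)) S.1.1 S'.1.1 ∧
      ∀ c, c ∈ S'.1.1.F ↔ c ∈ S.1.1.F ∨ ∃ i < S'.1.2, c = (a :: s, i) := by
    rintro a s ⟨⟨S, r0⟩, hS, hF⟩
    obtain ⟨S', r, h1, h2, h3, h4⟩ := BPS.step S hS hκ hl (fun i => (a :: s, i))
      (fun i j h => (Prod.ext_iff.1 h).2) (fun i hi => by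
        have := (hF _ hi).length_le
        simp at this) (z (a :: s))
    refine ⟨⟨⟨S', r⟩, h1, fun c hc => ?_⟩, h2, h4⟩
    rcases (h4 c).1 hc with h | ⟨i, _, h⟩
    · exact (hF c h).trans (List.suffix_cons a s)
    · rw [h]
  choose nx hnx1 hnx2 using hstep
  let st : ∀ s, P s := fun s => List.rec (motive := fun s => P s)
    ⟨(BPS.initial _ B, 0), BPS.initial_good (by linarith), fun c hc => by simp [BPS.initial] at hc⟩
    (fun a s S => nx a s S) s
  have hcons : ∀ a s, st (a :: s) = nx a s (st s) := fun a s => rfl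
  refine ⟨fun s => (st s).1.1, fun s => (st s).1.2, fun s => (st s).2.1, fun a s => ?_, fun s => ?_⟩
  · exact hnx1 a s (st s)
  · induction s with
    | nil =>
      intro c
      have : (st []).1.1.F = ∅ := rfl
      rw [this]
      simp
      intro h h'
      exact absurd h h'
    | cons a s ih =>
      intro c
      have := hnx2 a s (st s) c
      rw [← hcons] at this
      rw [this, ih, List.suffix_cons_iff]
      constructor
      · rintro (⟨h1, h2, h3⟩ | ⟨i, h1, h2⟩)
        · exact ⟨Or.inr h1, h2, h3⟩
        · subst h2
          exact ⟨Or.inl rfl, by simp, h1⟩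
      · rintro ⟨h1 | h1, h2, h3⟩
        · right
          refine ⟨c.2, ?_, Prod.ext h1 rfl⟩
          rwa [h1] at h3
        · exact Or.inl ⟨h1, h2, h3⟩

/-- Data on which the amalgamation is built. -/
structure TreeSN (I : Type) (nd : I → List ℕ) (p : (ℕ → ℕ) → Seminorm ℝ (I →₀ ℝ)) (lam : ℝ) :
    Prop where
  one_le : 1 ≤ lam
  fin : ∀ t, {c | nd c = t}.Finite
  loc : ∀ σ x, (∀ c, nd c = PiNat.res σ (nd c).length → x c = 0) → p σ x = 0
  coh : ∀ σ τ n x, PiNat.res σ n = PiNat.res τ n → (∀ c, x c ≠ 0 → nd c <:+ PiNat.res σ n) →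
    p σ x = p τ x
  c3 : ∀ σ n (x : I →₀ ℝ), p σ (x.filter fun c => (nd c).length < n) ≤ lam * p σ x

theorem exists_treeSN [CompleteSpace B] {lam : ℝ} (hl : 1 < lam) (z : List ℕ → B)
    {X : Type*} [NormedAddCommGroup X]
    [NormedSpace ℝ X] [CompleteSpace X] (hmin : IsMinimal X) (hXl1 : ¬ Embeds EllOne X)
    (hX : ∀ σ : ℕ → ℕ, ¬ Embeds X
      (Submodule.span ℝ (Set.range fun n => z (PiNat.res σ (n + 1)))).topologicalClosure) :
    ∃ (I : Type) (_ : Countable I) (nd : I → List ℕ) (p : (ℕ → ℕ) → Seminorm ℝ (I →₀ ℝ)),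
      TreeSN I nd p lam ∧ (∀ σ, ¬ Embeds X (Cmp (p σ))) ∧
      ∀ σ, Embeds (Submodule.span ℝ (Set.range fun n => z (PiNat.res σ (n + 1)))).topologicalClosure
        (Cmp (p σ)) := by
  classical
  obtain ⟨κ, hκ1, hκ2⟩ := exists_between hl
  obtain ⟨st, r, hgood, hrel, hF⟩ := exists_tree hκ1.le hκ2 z
  have hseq : ∀ σ : ℕ → ℕ, BPSeq lam κ (fun n => z (PiNat.res σ (n + 1)))
      (fun n => st (PiNat.res σ n)) := fun σ =>
    ⟨fun n => by simpa using hgood (PiNat.res σ n), fun n => by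
      simpa [PiNat.res_succ] using hrel (σ n) (PiNat.res σ n)⟩
  choose Q hQ using fun σ => (hseq σ).exists_lim
  have H : ∀ σ : ℕ → ℕ, BPLim lam κ (fun n => z (PiNat.res σ (n + 1)))
      (fun n => st (PiNat.res σ n)) (Q σ) := fun σ => ⟨hseq σ, hQ σ⟩
  let I : Type := {c : List ℕ × ℕ // c.1 ≠ [] ∧ c.2 < r c.1}
  let val : I → List ℕ × ℕ := Subtype.val
  have hinj : Function.Injective val := Subtype.val_injective
  let m : (I →₀ ℝ) →ₗ[ℝ] ((List ℕ × ℕ) →₀ ℝ) := Finsupp.lmapDomain ℝ ℝ val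
  have hm : ∀ x c, m x (val c) = x c := fun x c => Finsupp.mapDomain_apply hinj x c
  have hm0 : ∀ x c, ¬ (c.1 ≠ [] ∧ c.2 < r c.1) → m x c = 0 := fun x c hc =>
    Finsupp.mapDomain_notin_range x c (by
      rintro ⟨d, rfl⟩
      exact hc d.2)
  have hmem : ∀ σ n (c : List ℕ × ℕ), c ∈ (st (PiNat.res σ n)).F → (c.1 ≠ [] ∧ c.2 < r c.1) ∧
      c.1.length ≤ n ∧ c.1 = PiNat.res σ c.1.length := fun σ n c hc => by
    rw [hF, suffix_res] at hc
    obtain ⟨⟨k, hk, h⟩, h2⟩ := hc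
    have := congrArg List.length h
    rw [res_len] at this
    exact ⟨h2, by omega, by rw [this, ← h]⟩
  have hmem' : ∀ σ n (c : List ℕ × ℕ), (c.1 ≠ [] ∧ c.2 < r c.1) →
      c.1.length ≤ n → c.1 = PiNat.res σ c.1.length → c ∈ (st (PiNat.res σ n)).F :=
    fun σ n c h1 h2 h3 => by
      rw [hF, suffix_res]
      exact ⟨⟨_, h2, h3⟩, h1⟩
  let p : (ℕ → ℕ) → Seminorm ℝ (I →₀ ℝ) := fun σ => (bpq (Q σ)).comp m
  have hp : ∀ σ x, p σ x = bpq (Q σ) (m x) := fun σ x => rfl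
  refine ⟨I, inferInstance, fun c => c.1.1, p, ⟨hl.le, fun t => ?_, fun σ x hx => ?_,
    fun σ τ n x hn hx => ?_, fun σ n x => ?_⟩, fun σ hE => ?_, fun σ => ?_⟩
  · refine Set.Finite.of_finite_image (f := val) (Set.Finite.subset
      ((Set.finite_singleton t).prod (Set.finite_Iio (r t))) ?_) hinj.injOn
    rintro _ ⟨c, rfl, rfl⟩
    exact ⟨rfl, c.2.2⟩
  · rw [hp]
    refine (H σ).loc _ fun n c hc => ?_
    obtain ⟨h1, _, h3⟩ := hmem σ n c hc
    rw [show c = val ⟨c, h1⟩ from rfl, hm]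
    exact hx ⟨c, h1⟩ h3
  · rw [hp, hp, bpq_apply, bpq_apply]
    have hs : ∀ c ∉ (st (PiNat.res σ n)).F, m x c = 0 := fun c hc => by
      by_cases h1 : c.1 ≠ [] ∧ c.2 < r c.1
      · rw [show c = val ⟨c, h1⟩ from rfl, hm]
        by_contra h2
        exact hc ((hF _ _).2 ⟨hx ⟨c, h1⟩ h2, h1⟩)
      · exact hm0 _ _ h1
    rw [(H σ).lim n _ (mem_BPE_of_supp hs), (H τ).lim n _ (mem_BPE_of_supp (by
      rw [← hn]; exact hs)), hn]
  · rcases n with _ | n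
    · have h0 : (x.filter fun c : I => c.1.1.length < 0) = 0 := by
        ext c
        simp
      rw [h0, map_zero]
      exact mul_nonneg (by linarith) (apply_nonneg _ _)
    · -- restrict to `σ` to apply `c3`
      set f := x.filter fun c : I => c.1.1.length < n + 1
      let u := (m x).filter (· ∈ (st (PiNat.res σ n)).F)
      have h0 : bpq (Q σ) (m f - u) = 0 := (H σ).loc _ fun k c hc => by
        obtain ⟨h1, _, h3⟩ := hmem σ k c hc
        have e1 : m f c = f ⟨c, h1⟩ := hm f ⟨c, h1⟩
        have e2 : m x c = x ⟨c, h1⟩ := hm x ⟨c, h1⟩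
        by_cases hl : c.1.length < n + 1
        · have hc' := hmem' σ n c h1 (by omega) h3
          have : (m f - u) c = m f c - u c := rfl
          rw [this, e1, show u c = m x c from Finsupp.filter_apply_pos _ _ hc', e2,
            show f ⟨c, h1⟩ = x ⟨c, h1⟩ from Finsupp.filter_apply_pos _ _ hl, sub_self]
        · have hc' : c ∉ (st (PiNat.res σ n)).F := fun h => hl (by have := (hmem σ n c h).2.1; omega)
          have : (m f - u) c = m f c - u c := rfl
          rw [this, e1, show u c = 0 from Finsupp.filter_apply_neg _ _ hc',
            show f ⟨c, h1⟩ = 0 from Finsupp.filter_apply_neg _ _ hl, sub_self]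
      rw [hp, hp, sn_eq_of_sub_zero _ h0]
      exact (H σ).c3 n _ _ (fun c hc => Finsupp.filter_apply_neg _ _ hc)
        (fun c hc => Finsupp.filter_apply_pos _ _ hc)
  · refine hX σ ((H σ).embeds_of_embeds hκ1 hmin hXl1 (hE.trans' ?_))
    obtain ⟨F, _, _, hF3⟩ := exists_liftCmp (p σ) (toCmp (bpq (Q σ)) ∘ₗ m) 1 (fun v => by
      rw [LinearMap.comp_apply, norm_toCmp, one_mul, hp])
    exact ⟨F, 1, one_pos, hF3 1 fun v => by
      rw [LinearMap.comp_apply, norm_toCmp, one_mul, hp]⟩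
  · refine (H σ).embeds_span.trans' ?_
    let g : ((List ℕ × ℕ) →₀ ℝ) →ₗ[ℝ] (I →₀ ℝ) := Finsupp.lcomapDomain val hinj
    have hg : ∀ x c, g x c = x (val c) := fun x c => rfl
    have key : ∀ v, ‖(toCmp (p σ) ∘ₗ g) v‖ = bpq (Q σ) v := fun v => by
      rw [LinearMap.comp_apply, norm_toCmp, hp]
      refine sn_eq_of_sub_zero _ ((H σ).loc _ fun n c hc => ?_)
      obtain ⟨h1, _, h3⟩ := hmem σ n c hc
      have : (m (g v) - v) c = m (g v) c - v c := rfl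
      rw [this, show m (g v) c = _ from hm _ ⟨c, h1⟩, hg, sub_self]
    obtain ⟨F, _, _, hF3⟩ := exists_liftCmp (bpq (Q σ)) (toCmp (p σ) ∘ₗ g) 1 (fun v => by
      rw [key, one_mul])
    exact ⟨F, 1, one_pos, hF3 1 fun v => by rw [key, one_mul]⟩

end

open Filter Topology MeasureTheory

noncomputable section

variable {I : Type} (nd : I → List ℕ)

open Classical in
/-- Restriction to the coordinates sitting on nodes of `K`. -/
def rr (K : Set (List ℕ)) : (I →₀ ℝ) →ₗ[ℝ] (I →₀ ℝ) where
  toFun x := x.filter (fun c => nd c ∈ K)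
  map_add' x y := Finsupp.filter_add
  map_smul' t x := Finsupp.filter_smul

variable {nd}

open Classical in
theorem rr_apply (K : Set (List ℕ)) (x : I →₀ ℝ) (c : I) :
    rr nd K x c = if nd c ∈ K then x c else 0 := Finsupp.filter_apply _ _ _

theorem rr_pos {K : Set (List ℕ)} {c : I} (h : nd c ∈ K) (x : I →₀ ℝ) : rr nd K x c = x c := by
  rw [rr_apply, if_pos h]

theorem rr_neg {K : Set (List ℕ)} {c : I} (h : nd c ∉ K) (x : I →₀ ℝ) : rr nd K x c = 0 := by
  rw [rr_apply, if_neg h]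

theorem rr_congr {K K' : Set (List ℕ)} {x x' : I →₀ ℝ}
    (h : ∀ c, (nd c ∈ K ∧ x c ≠ 0 ∨ nd c ∈ K' ∧ x' c ≠ 0) →
      (nd c ∈ K ∧ nd c ∈ K' ∧ x c = x' c)) : rr nd K x = rr nd K' x' := by
  ext c
  by_cases h1 : nd c ∈ K ∧ x c ≠ 0 ∨ nd c ∈ K' ∧ x' c ≠ 0
  · obtain ⟨h2, h3, h4⟩ := h c h1
    rw [rr_pos h2, rr_pos h3, h4]
  · push Not at h1
    have e1 : rr nd K x c = 0 := by
      by_cases h2 : nd c ∈ K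
      · rw [rr_pos h2, h1.1 h2]
      · exact rr_neg h2 x
    have e2 : rr nd K' x' c = 0 := by
      by_cases h2 : nd c ∈ K'
      · rw [rr_pos h2, h1.2 h2]
      · exact rr_neg h2 x'
    rw [e1, e2]

theorem rr_rr (K K' : Set (List ℕ)) (x : I →₀ ℝ) : rr nd K (rr nd K' x) = rr nd (K ∩ K') x := by
  ext c
  by_cases h : nd c ∈ K <;> by_cases h' : nd c ∈ K' <;> simp [rr_apply, h, h']

/-- downward closed sets of nodes -/
def DC (K : Set (List ℕ)) : Prop := ∀ s t, s <:+ t → t ∈ K → s ∈ K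

theorem DC.union {K L : Set (List ℕ)} (hK : DC K) (hL : DC L) : DC (K ∪ L) := fun s t h ht =>
  ht.imp (hK s t h) (hL s t h)

theorem DC.inter {K L : Set (List ℕ)} (hK : DC K) (hL : DC L) : DC (K ∩ L) := fun s t h ht =>
  ⟨hK s t h ht.1, hL s t h ht.2⟩

/-- `t` is on the branch `σ` -/
def On (σ : ℕ → ℕ) (t : List ℕ) : Prop := t = PiNat.res σ t.length

theorem on_res (σ : ℕ → ℕ) (n : ℕ) : On σ (PiNat.res σ n) := by
  rw [On, res_len]

theorem On.suffix_res {σ : ℕ → ℕ} {t : List ℕ} (h : On σ t) {n : ℕ} (hn : t.length ≤ n) :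
    t <:+ PiNat.res σ n := _root_.suffix_res.2 ⟨_, hn, h⟩

theorem On.of_suffix {σ : ℕ → ℕ} {s t : List ℕ} (h : On σ t) (hs : s <:+ t) : On σ s := by
  rw [On] at h
  rw [h, _root_.suffix_res] at hs
  obtain ⟨k, _, rfl⟩ := hs
  exact on_res σ k

theorem On.suffix {σ : ℕ → ℕ} {s t : List ℕ} (h : On σ s) (ht : On σ t)
    (hl : s.length ≤ t.length) : s <:+ t := by
  rw [On] at ht
  rw [ht]
  exact h.suffix_res hl

theorem dc_on (σ : ℕ → ℕ) : DC {t | On σ t} := fun _ _ h ht => ht.of_suffix h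

theorem dc_lemma {K : Set (List ℕ)} (hK : DC K) (σ : ℕ → ℕ) (x : I →₀ ℝ) :
    ∃ n, (∀ c, On σ (nd c) → x c ≠ 0 → (nd c ∈ K ↔ (nd c).length < n)) ∧
      (n = 0 ∨ PiNat.res σ (n - 1) ∈ K) := by
  classical
  by_cases h : ∃ n, PiNat.res σ n ∉ K
  · refine ⟨Nat.find h, fun c hc hx => ⟨fun h1 => ?_, fun h1 => ?_⟩, ?_⟩
    · by_contra h2
      exact Nat.find_spec h (hK _ _ ((on_res σ _).suffix hc (by rw [res_len]; omega)) h1)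
    · have := Nat.find_min h h1
      push Not at this
      rwa [hc]
    · rcases Nat.eq_zero_or_pos (Nat.find h) with h0 | h0
      · exact Or.inl h0
      · right
        have := Nat.find_min h (m := Nat.find h - 1) (by omega)
        push Not at this
        exact this
  · push Not at h
    refine ⟨x.support.sup (fun c => (nd c).length) + 1, fun c hc hx => ⟨fun _ => ?_, fun _ => ?_⟩,
      Or.inr (h _)⟩
    · have := Finset.le_sup (f := fun c => (nd c).length) (Finsupp.mem_support_iff.2 hx)
      exact Nat.lt_succ_of_le this
    · rw [hc]
      exact h _

variable {p : (ℕ → ℕ) → Seminorm ℝ (I →₀ ℝ)} {lam : ℝ}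

namespace TreeSN

theorem lam_pos (H : TreeSN I nd p lam) : 0 < lam := zero_lt_one.trans_le H.one_le

theorem congr (H : TreeSN I nd p lam) (σ) {x y : I →₀ ℝ} (h : ∀ c, On σ (nd c) → x c = y c) :
    p σ x = p σ y :=
  sn_eq_of_sub_zero _ (H.loc σ _ fun c hc => by
    have : (x - y) c = x c - y c := rfl
    rw [this, h c hc, sub_self])

theorem zero (H : TreeSN I nd p lam) (σ) {x : I →₀ ℝ} (h : ∀ c, On σ (nd c) → x c = 0) :
    p σ x = 0 := H.loc σ x h

/-- restricting to a downward closed set -/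
theorem dc' (H : TreeSN I nd p lam) (σ) {K : Set (List ℕ)} (hK : DC K) (x : I →₀ ℝ) :
    p σ (rr nd K x) = 0 ∨ ∃ n, PiNat.res σ n ∈ K ∧
      ∀ τ, PiNat.res τ n = PiNat.res σ n → p σ (rr nd K x) ≤ lam * p τ x := by
  classical
  obtain ⟨n, hn, h0⟩ := dc_lemma (nd := nd) hK σ x
  have key : p σ (rr nd K x) = p σ (x.filter fun c => (nd c).length < n) := H.congr σ fun c hc => by
    by_cases hx : x c = 0
    · have h1 : rr nd K x c = 0 := by
        by_cases h2 : nd c ∈ K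
        · rw [rr_pos h2, hx]
        · rw [rr_neg h2]
      rw [h1, Finsupp.filter_apply, hx, ite_self]
    · by_cases h2 : nd c ∈ K
      · simp [rr_apply, h2, Finsupp.filter_apply, (hn c hc hx).1 h2]
      · simp [rr_apply, h2, Finsupp.filter_apply, mt (hn c hc hx).2 h2]
  rcases h0 with h0 | h0
  · subst h0
    left
    rw [key]
    have h0 : (x.filter fun c => (nd c).length < 0) = 0 := by
      ext c
      simp
    rw [h0, map_zero]
  rcases Nat.eq_zero_or_pos n with hn0 | hn0
  · subst hn0
    left
    rw [key]
    have h0 : (x.filter fun c => (nd c).length < 0) = 0 := by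
      ext c
      simp
    rw [h0, map_zero]
  right
  refine ⟨n - 1, h0, fun τ hτ => ?_⟩
  have e2 : p σ (x.filter fun c => (nd c).length < n) =
      p σ (rr nd {t | On σ t} (x.filter fun c => (nd c).length < n)) :=
    H.congr σ fun c hc => by simp [rr_apply, hc]
  have e3 : p τ (x.filter fun c => (nd c).length < n) =
      p τ (rr nd {t | On σ t} (x.filter fun c => (nd c).length < n)) :=
    H.congr τ fun c hc => by
      by_cases h : On σ (nd c)
      · simp [rr_apply, h]
      · rw [rr_apply, if_neg (show ¬ nd c ∈ {t | On σ t} from h)]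
        refine Finsupp.filter_apply_neg _ _ fun hl => ?_
        have := hc.suffix_res (n := n - 1) (by omega)
        rw [hτ] at this
        exact h ((on_res σ _).of_suffix this)
  rw [key, e2, H.coh σ τ (n - 1) _ hτ.symm, ← e3]
  · exact H.c3 τ n x
  · intro c hc
    have h1 : On σ (nd c) := by
      by_contra h
      exact hc (by simp [rr_apply, h])
    rw [rr_pos (show nd c ∈ {t | On σ t} from h1)] at hc
    refine h1.suffix_res ?_
    by_contra h2
    exact hc (Finsupp.filter_apply_neg _ _ (by omega))

theorem dc (H : TreeSN I nd p lam) (σ) {K : Set (List ℕ)} (hK : DC K) (x : I →₀ ℝ) :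
    p σ (rr nd K x) ≤ lam * p σ x := by
  rcases H.dc' σ hK x with h | ⟨n, _, h⟩
  · rw [h]
    exact mul_nonneg H.lam_pos.le (apply_nonneg _ _)
  · exact h σ rfl

theorem sdiff (H : TreeSN I nd p lam) (σ) {P Q : Set (List ℕ)} (hP : DC P) (hQ : DC Q)
    (x : I →₀ ℝ) : p σ (rr nd (Q \ P) x) ≤ 2 * lam * p σ x := by
  have : rr nd (Q \ P) x = rr nd Q x - rr nd (Q ∩ P) x := by
    ext c
    have : (rr nd Q x - rr nd (Q ∩ P) x) c = rr nd Q x c - rr nd (Q ∩ P) x c := rfl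
    rw [this]
    by_cases h : nd c ∈ Q <;> by_cases h' : nd c ∈ P <;> simp [rr_apply, h, h']
  rw [this]
  have h1 := H.dc σ hQ x
  have h2 := H.dc σ (hQ.inter hP) x
  have h3 := map_sub_le_add (p σ) (rr nd Q x) (rr nd (Q ∩ P) x)
  linarith

theorem on_le (H : TreeSN I nd p lam) (σ τ) (x : I →₀ ℝ) (hx : ∀ c, x c ≠ 0 → On τ (nd c)) :
    p σ x ≤ lam * p τ x := by
  have e : rr nd {t | On τ t} x = x := by
    ext c
    by_cases h : On τ (nd c)
    · simp [rr_apply, h]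
    · rw [rr_apply, if_neg (show ¬ nd c ∈ {t | On τ t} from h)]
      by_contra h1
      exact h (hx c (Ne.symm h1))
  have := H.dc' σ (dc_on τ) x
  rw [e] at this
  rcases this with h | ⟨n, h1, h⟩
  · rw [h]
    exact mul_nonneg H.lam_pos.le (apply_nonneg _ _)
  · refine h τ ?_
    have h1' : On τ (PiNat.res σ n) := h1
    rw [On, res_len] at h1'
    exact h1'.symm

/-- a uniform pointwise bound -/
theorem exists_weight (H : TreeSN I nd p lam) : ∃ w : I → ℝ, (∀ c, 0 ≤ w c) ∧
    ∀ σ x (s : Finset I), (∀ c, x c ≠ 0 → On σ (nd c) → c ∈ s) →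
      p σ x ≤ ∑ c ∈ s, |x c| * w c := by
  classical
  have hτ : ∀ t : List ℕ, ∃ τ, On τ t := fun t => by
    induction t with
    | nil => exact ⟨0, by simp [On]⟩
    | cons a t ih =>
      obtain ⟨τ, h⟩ := ih
      refine ⟨Function.update τ t.length a, ?_⟩
      have e : ∀ n ≤ t.length, PiNat.res (Function.update τ t.length a) n = PiNat.res τ n := by
        intro n hn
        rw [PiNat.res_eq_res]
        intro k hk
        exact Function.update_of_ne (by omega) _ _
      rw [On, List.length_cons, PiNat.res_succ, e _ le_rfl, Function.update_self, ← h]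
  choose τ hτ using hτ
  refine ⟨fun c => p (τ (nd c)) (Finsupp.single c 1), fun c => apply_nonneg _ _,
    fun σ x s hs => ?_⟩
  have h1 : p σ x = p σ (∑ c ∈ s with On σ (nd c), Finsupp.single c (x c)) :=
    H.congr σ fun c hc => by
      rw [Finsupp.finsetSum_apply]
      by_cases h : c ∈ s
      · rw [Finset.sum_eq_single c]
        · simp
        · intro d _ hd
          simp [hd]
        · intro h'
          exact absurd (Finset.mem_filter.2 ⟨h, hc⟩) h'
      · have : x c = 0 := by
          by_contra h'
          exact h (hs c h' hc)
        rw [this, Finset.sum_eq_zero]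
        intro d hd
        rw [Finsupp.single_apply, if_neg]
        rintro rfl
        exact h (Finset.mem_filter.1 hd).1
  rw [h1]
  refine (sn_sum_le _ _ _).trans ?_
  have h2 : ∀ c ∈ s.filter (fun c => On σ (nd c)), p σ (Finsupp.single c (x c)) ≤
      |x c| * p (τ (nd c)) (Finsupp.single c 1) := fun c hc => by
    have : Finsupp.single c (x c) = (x c) • Finsupp.single c (1 : ℝ) := by simp
    rw [this, map_smul_eq_mul, Real.norm_eq_abs]
    refine le_of_eq (congrArg _ (H.coh _ _ (nd c).length _ ?_ ?_))
    · rw [← (Finset.mem_filter.1 hc).2, ← hτ]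
    · intro d hd
      rw [Finsupp.single_apply] at hd
      have : c = d := by
        by_contra h
        simp [h] at hd
      subst this
      exact (Finset.mem_filter.1 hc).2.suffix_res le_rfl
  refine (Finset.sum_le_sum h2).trans (Finset.sum_le_sum_of_subset_of_nonneg
    (Finset.filter_subset _ _) fun c _ _ => mul_nonneg (abs_nonneg _) (apply_nonneg _ _))

end TreeSN

end

open Filter Topology MeasureTheory

noncomputable section

theorem exists_supSN {κ V : Type*} [Nonempty κ] [AddCommGroup V] [Module ℝ V]
    (q : κ → Seminorm ℝ V) (h : ∀ x, ∃ C, ∀ k, q k x ≤ C) :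
    ∃ U : Seminorm ℝ V, (∀ k x, q k x ≤ U x) ∧ ∀ x C, (∀ k, q k x ≤ C) → U x ≤ C := by
  have hb : BddAbove (Set.range q) := by
    rw [Seminorm.bddAbove_range_iff]
    intro x
    obtain ⟨C, hC⟩ := h x
    exact ⟨C, by rintro _ ⟨k, rfl⟩; exact hC k⟩
  refine ⟨⨆ k, q k, fun k x => ?_, fun x C hC => ?_⟩
  · rw [Seminorm.iSup_apply hb]
    obtain ⟨C, hC⟩ := h x
    exact le_ciSup (f := fun k => q k x) ⟨C, by rintro _ ⟨k, rfl⟩; exact hC k⟩ k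
  · rw [Seminorm.iSup_apply hb]
    exact ciSup_le hC

theorem exists_sumSN {V : Type*} [AddCommGroup V] [Module ℝ V]
    (q : ℕ → Seminorm ℝ V) (h : ∀ x, Summable fun n => q n x) :
    ∃ U : Seminorm ℝ V, ∀ x, U x = ∑' n, q n x := by
  refine ⟨Seminorm.of (fun x => ∑' n, q n x) (fun x y => ?_) (fun t x => ?_), fun x => rfl⟩
  · rw [← (h x).tsum_add (h y)]
    exact (h _).tsum_le_tsum (fun n => map_add_le_add _ _ _) ((h x).add (h y))
  · simp only [map_smul_eq_mul, tsum_mul_left]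

/-- finite sums of seminorms -/
theorem exists_finsumSN {α V : Type*} [AddCommGroup V] [Module ℝ V] (s : Finset α)
    (q : α → Seminorm ℝ V) : ∃ U : Seminorm ℝ V, ∀ x, U x = ∑ n ∈ s, q n x := by
  refine ⟨Seminorm.of (fun x => ∑ n ∈ s, q n x) (fun x y => ?_) (fun t x => ?_), fun x => rfl⟩
  · rw [← Finset.sum_add_distrib]
    exact Finset.sum_le_sum (fun n _ => map_add_le_add _ _ _)
  · simp only [map_smul_eq_mul, Finset.mul_sum]

/-- intervals of a branch -/
structure Itv where
  σ : ℕ → ℕ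
  P : Set (List ℕ)
  Q : Set (List ℕ)
  hP : DC P
  hQ : DC Q

def Itv.S (J : Itv) : Set (List ℕ) := {t | On J.σ t ∧ t ∈ J.Q ∧ t ∉ J.P}

def Valid {α : Type} (s : Finset α) (J : α → Itv) : Prop :=
  ∀ a ∈ s, ∀ b ∈ s, a ≠ b → ∀ t ∈ (J a).S, ∀ t' ∈ (J b).S, ¬ t <:+ t'

variable {I : Type} (nd : I → List ℕ) (p : (ℕ → ℕ) → Seminorm ℝ (I →₀ ℝ))

def Itv.q (J : Itv) : Seminorm ℝ (I →₀ ℝ) := (p J.σ).comp (rr nd (J.Q \ J.P))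

theorem Itv.q_apply (J : Itv) (x) : J.q nd p x = p J.σ (rr nd (J.Q \ J.P) x) := rfl

theorem Valid.disj {α : Type} {s : Finset α} {J : α → Itv} (h : Valid s J) {a b : α} (ha : a ∈ s)
    (hb : b ∈ s) {t : List ℕ} (h1 : t ∈ (J a).S) (h2 : t ∈ (J b).S) : a = b := by
  by_contra hab
  exact h a ha b hb hab t h1 t h2 (List.suffix_refl _)

variable {nd p} {lam : ℝ}

theorem TreeSN.exists_U (H : TreeSN I nd p lam) : ∃ U : Seminorm ℝ (I →₀ ℝ),
    (∀ (α : Type) (s : Finset α) (J : α → Itv), Valid s J → ∀ x, ∑ a ∈ s, (J a).q nd p x ≤ U x) ∧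
    ∀ x C, (∀ (s : Finset ℕ) (J : ℕ → Itv), Valid s J → ∑ a ∈ s, (J a).q nd p x ≤ C) → U x ≤ C := by
  classical
  obtain ⟨w, hw0, hw⟩ := H.exists_weight
  choose q hq using fun (j : {j : Finset ℕ × (ℕ → Itv) // Valid j.1 j.2}) =>
    exists_finsumSN j.1.1 (fun m => (j.1.2 m).q nd p)
  haveI : Nonempty {j : Finset ℕ × (ℕ → Itv) // Valid j.1 j.2} :=
    ⟨⟨(∅, fun _ => ⟨0, ∅, ∅, fun _ _ _ h => h, fun _ _ _ h => h⟩), fun a ha => by simp at ha⟩⟩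
  obtain ⟨U, hU1, hU2⟩ := exists_supSN q (fun x => ⟨∑ c ∈ x.support, |x c| * w c, by
    rintro ⟨⟨s, J⟩, hJ⟩
    rw [hq]
    let sc : ℕ → Finset I := fun m => x.support.filter fun c => nd c ∈ (J m).S
    have h1 : ∀ m ∈ s, (J m).q nd p x ≤ ∑ c ∈ sc m, |x c| * w c := fun m hm => by
      rw [Itv.q_apply]
      refine (hw _ _ (sc m) fun c hc hon => ?_).trans (Finset.sum_le_sum fun c hc => ?_)
      · have hc' : nd c ∈ (J m).Q \ (J m).P := by
          by_contra h
          exact hc (rr_neg h x)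
        rw [rr_pos hc'] at hc
        exact Finset.mem_filter.2 ⟨Finsupp.mem_support_iff.2 hc, hon, hc'.1, hc'.2⟩
      · have := (Finset.mem_filter.1 hc).2
        rw [rr_pos (show nd c ∈ (J m).Q \ (J m).P from ⟨this.2.1, this.2.2⟩)]
    refine (Finset.sum_le_sum h1).trans ?_
    rw [← Finset.sum_biUnion]
    · refine Finset.sum_le_sum_of_subset_of_nonneg ?_ fun c _ _ => mul_nonneg (abs_nonneg _) (hw0 c)
      exact Finset.biUnion_subset.2 fun m _ => Finset.filter_subset _ _
    · intro a ha b hb hab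
      rw [Function.onFun, Finset.disjoint_left]
      intro c hc hc'
      exact hab (hJ.disj ha hb (Finset.mem_filter.1 hc).2 (Finset.mem_filter.1 hc').2)⟩)
  refine ⟨U, fun α s J hJ x => ?_, fun x C hC => hU2 x C ?_⟩
  · -- transfer to ℕ
    obtain ⟨f, hf⟩ : ∃ f : α → ℕ, Set.InjOn f s := by
      refine ⟨fun a => if h : a ∈ s then (s.equivFin ⟨a, h⟩ : ℕ) else 0, ?_⟩
      intro a ha b hb hab
      have ha' : a ∈ s := ha
      have hb' : b ∈ s := hb
      simp only [ha', hb', dif_pos] at hab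
      have := s.equivFin.injective (Fin.ext hab)
      exact congrArg Subtype.val this
    let J' : ℕ → Itv := fun n => if h : ∃ a ∈ s, f a = n then J h.choose else
      ⟨0, ∅, ∅, fun _ _ _ h => h, fun _ _ _ h => h⟩
    have hJ' : ∀ a ∈ s, J' (f a) = J a := fun a ha => by
      have h : ∃ b ∈ s, f b = f a := ⟨a, ha, rfl⟩
      simp only [J', dif_pos h]
      rw [hf h.choose_spec.1 ha h.choose_spec.2]
    have hv : Valid (s.image f) J' := by
      intro a ha b hb hab
      obtain ⟨a, ha', rfl⟩ := Finset.mem_image.1 ha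
      obtain ⟨b, hb', rfl⟩ := Finset.mem_image.1 hb
      rw [hJ' a ha', hJ' b hb']
      exact hJ a ha' b hb' fun h => hab (h ▸ rfl)
    have := hU1 ⟨(s.image f, J'), hv⟩ x
    rw [hq, Finset.sum_image hf] at this
    refine le_trans (le_of_eq (Finset.sum_congr rfl fun a ha => ?_)) this
    show _ = (J' (f a)).q nd p x
    rw [hJ' a ha]
  · rintro ⟨⟨s, J⟩, hJ⟩
    rw [hq]
    exact hC s J hJ

/-- The amalgamated norm. -/
structure AMN (nd : I → List ℕ) (p : (ℕ → ℕ) → Seminorm ℝ (I →₀ ℝ)) (lam : ℝ)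
    (A : Seminorm ℝ (I →₀ ℝ)) : Prop where
  le : ∀ σ x, p σ x ≤ A x
  dc : ∀ K x, DC K → A (rr nd K x) ≤ lam * A x
  conc : ∀ ε > 0, ∃ N : ℕ, ∀ x, A x ≤ 1 → ∀ (α : Type) (s : Finset α) (J : α → Itv), Valid s J →
    (∀ a ∈ s, ε ≤ (J a).q nd p x) → s.card ≤ N
  on : ∀ τ x, (∀ c, x c ≠ 0 → On τ (nd c)) → A x ≤ 4 * lam ^ 2 * p τ x
  ht : ∃ U V : Seminorm ℝ (I →₀ ℝ), (∀ x C, (∀ σ, p σ x ≤ C) → V x ≤ C) ∧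
    ∀ k : ℕ, ∃ h t : Seminorm ℝ (I →₀ ℝ), (∀ x, A x = h x + t x) ∧ (∃ C, ∀ x, h x ≤ C * V x) ∧
      ∀ x, t x ≤ 2 * (1 / 2) ^ k * U x

theorem TreeSN.exists_A (H : TreeSN I nd p lam) : ∃ A, AMN nd p lam A := by
  classical
  have hlam := H.one_le
  obtain ⟨U, hU1, hU2⟩ := H.exists_U
  have hpU : ∀ σ x, p σ x ≤ U x := fun σ x => by
    have := hU1 Unit {()} (fun _ => ⟨σ, ∅, Set.univ, fun _ _ _ h => h, fun _ _ _ h => h⟩)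
      (fun a _ b _ h => absurd (Subsingleton.elim a b) h) x
    rw [Finset.sum_singleton, Itv.q_apply] at this
    refine le_trans (le_of_eq (H.congr σ fun c hc => ?_)) this
    rw [rr_pos (by simp)]
  obtain ⟨V, hV1, hV2⟩ := exists_supSN p fun x => ⟨U x, fun σ => hpU σ x⟩
  have hVU : ∀ x, V x ≤ U x := fun x => hV2 x _ fun σ => hpU σ x
  have hUK : ∀ K x, DC K → U (rr nd K x) ≤ U x := fun K x hK => hU2 _ _ fun s J hJ => by
    refine le_trans (le_of_eq ?_) (hU1 ℕ s (fun m => ⟨(J m).σ, (J m).P, (J m).Q ∩ K, (J m).hP,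
      (J m).hQ.inter hK⟩) ?_ x)
    · refine Finset.sum_congr rfl fun m _ => ?_
      rw [Itv.q_apply, Itv.q_apply, rr_rr]
      have e : ((J m).Q \ (J m).P) ∩ K = ((J m).Q ∩ K) \ (J m).P := by
        ext t
        simp only [Set.mem_inter_iff, Set.mem_diff]
        tauto
      rw [e]
    · intro a ha b hb hab t ht t' ht'
      exact hJ a ha b hb hab t ⟨ht.1, ht.2.1.1, ht.2.2⟩ t' ⟨ht'.1, ht'.2.1.1, ht'.2.2⟩
  have hVK : ∀ K x, DC K → V (rr nd K x) ≤ lam * V x := fun K x hK => hV2 _ _ fun σ =>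
    (H.dc σ hK x).trans (mul_le_mul_of_nonneg_left (hV1 σ x) H.lam_pos.le)
  have hUon : ∀ τ x, (∀ c, x c ≠ 0 → On τ (nd c)) → U x ≤ 2 * lam ^ 2 * p τ x := fun τ x hx => by
    have hB0 : 0 ≤ 2 * lam ^ 2 * p τ x := mul_nonneg (by positivity) (apply_nonneg _ _)
    refine hU2 _ _ fun s J hJ => ?_
    have h0 : ∀ m, (∀ t, On τ t → t ∉ (J m).S) → (J m).q nd p x = 0 := fun m hm => by
      rw [Itv.q_apply]
      refine H.zero _ fun c hc => ?_
      by_cases h : nd c ∈ (J m).Q \ (J m).P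
      · rw [rr_pos h]
        by_contra h1
        exact hm _ (hx c h1) ⟨hc, h.1, h.2⟩
      · exact rr_neg h x
    by_cases h1 : ∃ m ∈ s, ∃ t, On τ t ∧ t ∈ (J m).S
    · obtain ⟨m, hm, t, ht, htS⟩ := h1
      rw [Finset.sum_eq_single_of_mem m hm]
      · rw [Itv.q_apply]
        refine (H.sdiff _ (J m).hP (J m).hQ x).trans ?_
        have := mul_le_mul_of_nonneg_left (H.on_le (J m).σ τ x hx) (by positivity : 0 ≤ 2 * lam)
        linarith
      · intro b hb hbm
        refine h0 b fun t' ht' hS' => ?_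
        rcases le_total t.length t'.length with h | h
        · exact hJ m hm b hb hbm.symm t htS t' hS' (ht.suffix ht' h)
        · exact hJ b hb m hm hbm t' hS' t htS (ht'.suffix ht h)
    · push Not at h1
      rw [Finset.sum_eq_zero fun m hm => h0 m (h1 m hm)]
      exact hB0
  have hpow : ∀ n : ℕ, 0 < ((1 / 2 : ℝ)) ^ n := fun n => by positivity
  choose U' hU' using fun n : ℕ => (⟨Seminorm.of (fun x => (1 / 2 : ℝ) ^ n * U x) (fun x y => by
    rw [← mul_add]
    exact mul_le_mul_of_nonneg_left (map_add_le_add _ _ _) (hpow n).le) (fun t x => by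
      rw [map_smul_eq_mul]; ring), fun x => rfl⟩ :
        ∃ W : Seminorm ℝ (I →₀ ℝ), ∀ x, W x = (1 / 2 : ℝ) ^ n * U x)
  choose V' hV' using fun n : ℕ => (⟨Seminorm.of (fun x => (2 : ℝ) ^ n * V x) (fun x y => by
    rw [← mul_add]
    exact mul_le_mul_of_nonneg_left (map_add_le_add _ _ _) (by positivity)) (fun t x => by
      rw [map_smul_eq_mul]; ring), fun x => rfl⟩ :
        ∃ W : Seminorm ℝ (I →₀ ℝ), ∀ x, W x = (2 : ℝ) ^ n * V x)
  let N : ℕ → Seminorm ℝ (I →₀ ℝ) := fun n => U' n ⊓ V' n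
  have hN1 : ∀ n x u, N n x ≤ (1 / 2 : ℝ) ^ n * U u + 2 ^ n * V (x - u) := fun n x u => by
    have : N n x = ⨅ u, U' n u + V' n (x - u) := Seminorm.inf_apply _ _ _
    rw [this, ← hU', ← hV']
    exact ciInf_le ⟨0, by rintro _ ⟨v, rfl⟩; exact add_nonneg (apply_nonneg _ _) (apply_nonneg _ _)⟩ u
  have hN2 : ∀ n x C, (∀ u, C ≤ (1 / 2 : ℝ) ^ n * U u + 2 ^ n * V (x - u)) → C ≤ N n x :=
    fun n x C h => by
      have : N n x = ⨅ u, U' n u + V' n (x - u) := Seminorm.inf_apply _ _ _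
      rw [this]
      refine le_ciInf fun u => ?_
      rw [hU', hV']
      exact h u
  have hN3 : ∀ n x C, N n x < C → ∃ u, (1 / 2 : ℝ) ^ n * U u + 2 ^ n * V (x - u) < C := by
    intro n x C h
    by_contra h1
    push Not at h1
    exact absurd (hN2 n x C h1) (not_le.2 h)
  have hNU : ∀ n x, N n x ≤ (1 / 2 : ℝ) ^ n * U x := fun n x => by
    have := hN1 n x x
    simpa using this
  have hNV : ∀ n x, N n x ≤ 2 ^ n * V x := fun n x => by
    have := hN1 n x 0
    simpa using this
  have hsum : ∀ x, Summable fun n => N n x := fun x =>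
    Summable.of_nonneg_of_le (fun n => apply_nonneg _ _) (fun n => hNU n x)
      (summable_geometric_two.mul_right _)
  have htail : ∀ k x, ∑' n, N (n + k) x ≤ 2 * (1 / 2) ^ k * U x := fun k x => by
    have h1 : HasSum (fun n => (1 / 2 : ℝ) ^ (n + k) * U x) (2 * (1 / 2) ^ k * U x) := by
      have := (hasSum_geometric_two.mul_right ((1 / 2 : ℝ) ^ k * U x))
      have e : (fun n => (1 / 2 : ℝ) ^ (n + k) * U x) =
          fun n => (1 / 2 : ℝ) ^ n * ((1 / 2) ^ k * U x) := by
        ext n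
        rw [pow_add]; ring
      rw [e, show 2 * (1 / 2 : ℝ) ^ k * U x = 2 * ((1 / 2) ^ k * U x) by ring]
      exact this
    rw [← h1.tsum_eq]
    exact ((summable_nat_add_iff k).2 (hsum x)).tsum_le_tsum (fun n => hNU _ x) h1.summable
  obtain ⟨A, hA⟩ := exists_sumSN N hsum
  have hNA : ∀ n x, N n x ≤ A x := fun n x => by
    rw [hA]
    exact (hsum x).le_tsum n fun _ _ => apply_nonneg _ _
  have hVA : ∀ x, V x ≤ A x := fun x => by
    refine le_trans (hN2 0 x _ fun u => ?_) (hNA 0 x)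
    have h1 := map_add_le_add V u (x - u)
    rw [add_sub_cancel] at h1
    have h2 := hVU u
    rw [pow_zero, pow_zero, one_mul, one_mul]
    linarith
  have hAU : ∀ x, A x ≤ 2 * U x := fun x => by
    have := htail 0 x
    rw [hA]
    simpa using this
  refine ⟨A, fun σ x => (hV1 σ x).trans (hVA x), fun K x hK => ?_, fun ε hε => ?_,
    fun τ x hx => ?_, U, V, hV2, fun k => ?_⟩
  · rw [hA, hA, ← tsum_mul_left]
    refine (hsum _).tsum_le_tsum (fun n => ?_) ((hsum x).mul_left _)
    have hl := H.lam_pos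
    rw [← div_le_iff₀' hl]
    refine hN2 n x _ fun u => ?_
    rw [div_le_iff₀' hl]
    refine (hN1 n _ (rr nd K u)).trans ?_
    rw [← map_sub]
    have h1 := hUK K u hK
    have h2 := hVK K (x - u) hK
    have h3 : U u ≤ lam * U u := le_mul_of_one_le_left (apply_nonneg _ _) hlam
    have h4 := mul_le_mul_of_nonneg_left (h1.trans h3) (hpow n).le
    have h5 := mul_le_mul_of_nonneg_left h2 (by positivity : (0 : ℝ) ≤ 2 ^ n)
    linarith
  · obtain ⟨n, hn⟩ := exists_nat_gt (8 * lam / ε)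
    have hn2 : (n : ℝ) ≤ 2 ^ n := by exact_mod_cast Nat.lt_two_pow_self.le
    have hn3 : 8 * lam < ε * 2 ^ n := by
      rw [div_lt_iff₀ hε] at hn
      nlinarith
    obtain ⟨M, hM⟩ := exists_nat_ge (2 ^ n * 4 / ε)
    refine ⟨M, fun x hx α s J hJ hs => ?_⟩
    obtain ⟨u, hu⟩ := hN3 n x 2 (lt_of_le_of_lt ((hNA n x).trans hx) one_lt_two)
    have hU0 := apply_nonneg U u
    have hV0 := apply_nonneg V (x - u)
    have hUu : U u ≤ 2 ^ n * 2 := by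
      have h1 : (1 / 2 : ℝ) ^ n * U u ≤ 2 := by
        have : 0 ≤ (2 : ℝ) ^ n * V (x - u) := by positivity
        linarith
      have h2 : (2 : ℝ) ^ n * (1 / 2) ^ n = 1 := by rw [← mul_pow]; norm_num
      calc U u = 2 ^ n * ((1 / 2 : ℝ) ^ n * U u) := by rw [← mul_assoc, h2, one_mul]
        _ ≤ _ := mul_le_mul_of_nonneg_left h1 (by positivity)
    have hVu : 2 ^ n * V (x - u) ≤ 2 := by
      have : 0 ≤ (1 / 2 : ℝ) ^ n * U u := mul_nonneg (hpow n).le hU0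
      linarith
    have hq : ∀ a ∈ s, ε / 2 ≤ (J a).q nd p u := fun a ha => by
      have h1 := hs a ha
      have h2 : (J a).q nd p x ≤ (J a).q nd p u + (J a).q nd p (x - u) := by
        have := map_add_le_add ((J a).q nd p) u (x - u)
        rwa [add_sub_cancel] at this
      have h3 : (J a).q nd p (x - u) ≤ 2 * lam * V (x - u) :=
        (H.sdiff _ (J a).hP (J a).hQ _).trans
          (mul_le_mul_of_nonneg_left (hV1 _ _) (by positivity))
      have h4 : 2 * lam * V (x - u) ≤ ε / 2 := by
        have h5 : (2 * lam * V (x - u)) * 2 ^ n ≤ ε / 2 * 2 ^ n := by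
          have : 2 * lam * (2 ^ n * V (x - u)) ≤ 2 * lam * 2 :=
            mul_le_mul_of_nonneg_left hVu (by positivity)
          nlinarith
        exact le_of_mul_le_mul_right h5 (by positivity)
      linarith
    have h6 : s.card * (ε / 2) ≤ U u := by
      refine le_trans ?_ (hU1 α s J hJ u)
      rw [← nsmul_eq_mul, ← Finset.sum_const]
      exact Finset.sum_le_sum hq
    have h7 : (s.card : ℝ) ≤ 2 ^ n * 4 / ε := by
      rw [le_div_iff₀ hε]
      linarith
    exact_mod_cast h7.trans hM
  · have := hUon τ x hx
    linarith [hAU x]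
  · obtain ⟨h, hh⟩ := exists_finsumSN (Finset.range k) N
    obtain ⟨t, ht⟩ := exists_sumSN (fun n => N (n + k)) fun x => (summable_nat_add_iff k).2 (hsum x)
    refine ⟨h, t, fun x => ?_, ⟨∑ n ∈ Finset.range k, 2 ^ n, fun x => ?_⟩, fun x => ?_⟩
    · rw [hA, hh, ht, (hsum x).sum_add_tsum_nat_add]
    · rw [hh, Finset.sum_mul]
      exact Finset.sum_le_sum fun n _ => hNV n x
    · rw [ht]
      exact htail k x

end

open Filter Topology MeasureTheory

noncomputable section

variable {I : Type} {nd : I → List ℕ} {p : (ℕ → ℕ) → Seminorm ℝ (I →₀ ℝ)} {lam : ℝ}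

theorem sn_sub_le {V : Type*} [AddCommGroup V] [Module ℝ V] (h : Seminorm ℝ V) (y e : V) :
    h y - h e ≤ h (y + e) := by
  have := map_add_le_add h (y + e) (-e)
  rw [add_neg_cancel_right, map_neg_eq_map] at this
  linarith

theorem AMN.case2 {A : Seminorm ℝ (I →₀ ℝ)} (M : AMN nd p lam A) {X : Type*}
    [NormedAddCommGroup X] [NormedSpace ℝ X] [CompleteSpace X] (T : X →L[ℝ] Cmp A) {c : ℝ}
    (hc : 0 < c) (hT : ∀ x, c * ‖x‖ ≤ ‖T x‖)
    (h : ∀ ε > 0, ∃ (x : X) (e : I →₀ ℝ), ‖x‖ = 1 ∧ ‖T x - toCmp A e‖ < ε ∧ ∀ σ, p σ e < ε) :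
    Embeds EllOne X := by
  obtain ⟨U, V, hV, hk⟩ := M.ht
  refine step_l1 A A 1 (fun v => by rw [one_mul]) T (c / 2) (by positivity) ?_
  intro n e he θ hθ η hη
  set B : ℝ := ∑ j ∈ Finset.range n, U (e j) with hB
  have hB0 : 0 ≤ B := Finset.sum_nonneg fun _ _ => apply_nonneg _ _
  have hU : ∀ a : ℕ → ℝ, U (∑ j ∈ Finset.range n, a j • e j) ≤
      B * (4 / c) * A (∑ j ∈ Finset.range n, a j • e j) := fun a => by
    have h1 : U (∑ j ∈ Finset.range n, a j • e j) ≤ B * ∑ j ∈ Finset.range n, |a j| := by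
      refine (sn_sum_le U _ _).trans ?_
      rw [Finset.mul_sum]
      refine Finset.sum_le_sum fun j hj => ?_
      rw [map_smul_eq_mul, Real.norm_eq_abs, mul_comm]
      exact mul_le_mul_of_nonneg_right
        (Finset.single_le_sum (f := fun j => U (e j)) (fun _ _ => apply_nonneg _ _) hj) (abs_nonneg _)
    have h2 : ∑ j ∈ Finset.range n, |a j| ≤ 4 / c * A (∑ j ∈ Finset.range n, a j • e j) := by
      have := he a
      rw [div_mul_eq_mul_div, le_div_iff₀ hc]
      linarith
    rw [mul_assoc]
    exact h1.trans (mul_le_mul_of_nonneg_left h2 hB0)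
  obtain ⟨k, hk'⟩ : ∃ k : ℕ, (1 / 2 : ℝ) ^ k * (4 * (B * (4 / c))) ≤ 1 - θ := by
    have : Tendsto (fun k : ℕ => (1 / 2 : ℝ) ^ k * (4 * (B * (4 / c)))) atTop (𝓝 (0 * _)) :=
      (tendsto_pow_atTop_nhds_zero_of_lt_one (by norm_num) (by norm_num)).mul_const _
    rw [zero_mul] at this
    exact (this.eventually (ge_mem_nhds (by linarith : (0 : ℝ) < 1 - θ))).exists
  obtain ⟨g, t, hA, ⟨C, hC⟩, ht⟩ := hk k
  set ε : ℝ := min η (min (c / 4) (c / (8 * (|C| + 1)))) with hε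
  have hε0 : 0 < ε := lt_min hη (lt_min (by positivity) (by positivity))
  obtain ⟨x, e', hx, hxe, hpe⟩ := h ε hε0
  have hVe : V e' ≤ ε := hV _ _ fun σ => (hpe σ).le
  have hge : g e' ≤ c / 8 := by
    refine (hC e').trans ?_
    have h1 : C * V e' ≤ (|C| + 1) * ε := by
      refine mul_le_mul (by linarith [le_abs_self C]) hVe (apply_nonneg _ _) (by positivity)
    have h2 : ε ≤ c / (8 * (|C| + 1)) := (min_le_right _ _).trans (min_le_right _ _)
    have h3 : (|C| + 1) * ε ≤ (|C| + 1) * (c / (8 * (|C| + 1))) :=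
      mul_le_mul_of_nonneg_left h2 (by positivity)
    have h4 : (|C| + 1) * (c / (8 * (|C| + 1))) = c / 8 := by
      field_simp
    linarith
  have hAe : 3 * c / 4 ≤ A e' := by
    have h1 := hT x
    rw [hx, mul_one] at h1
    have h2 : ε ≤ c / 4 := (min_le_right _ _).trans (min_le_left _ _)
    have h3 := norm_sub_norm_le (T x) (toCmp A e')
    rw [norm_toCmp] at h3
    linarith
  refine ⟨x, e', hx, hxe.le.trans (min_le_left _ _), fun a s => ?_⟩
  set y := ∑ j ∈ Finset.range n, a j • e j with hy
  have h1 := sn_sub_le g y (s • e')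
  have h2 := sn_sub_le t (s • e') y
  rw [add_comm] at h2
  have h3 := hA (y + s • e')
  have h4 := hA y
  have h5 := hA e'
  rw [map_smul_eq_mul, Real.norm_eq_abs] at h1 h2
  have h6 : 2 * t y ≤ (1 - θ) * A y := by
    have := mul_le_mul_of_nonneg_left (hU a) (by positivity : 0 ≤ (1 / 2 : ℝ) ^ k * 4)
    have h7 := mul_le_mul_of_nonneg_right hk' (apply_nonneg A y)
    have h8 := ht y
    linarith
  have h7 : |s| * (c / 2) ≤ |s| * (t e' - g e') :=
    mul_le_mul_of_nonneg_left (by linarith) (abs_nonneg _)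
  linarith

end

open Filter Topology MeasureTheory

noncomputable section

def GG (n : ℕ) : Set (List ℕ) := {t | ∃ s : List ℕ, Encodable.encode s ≤ n ∧ t <:+ s}

theorem dc_GG (n : ℕ) : DC (GG n) := fun _ _ h ⟨u, hu, htu⟩ => ⟨u, hu, h.trans htu⟩

theorem GG_mono {n m : ℕ} (h : n ≤ m) : GG n ⊆ GG m := fun _ ⟨s, hs, hts⟩ => ⟨s, hs.trans h, hts⟩

theorem mem_GG (t : List ℕ) : t ∈ GG (Encodable.encode t) := ⟨t, le_rfl, List.suffix_refl _⟩

theorem finite_GG (n : ℕ) : (GG n).Finite := by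
  have h1 : {s : List ℕ | Encodable.encode s ≤ n}.Finite :=
    Set.Finite.preimage (Encodable.encode_injective.injOn) (Set.finite_Iic n)
  have : GG n ⊆ ⋃ s ∈ {s : List ℕ | Encodable.encode s ≤ n}, {t | t ∈ s.tails} := by
    rintro t ⟨s, hs, hts⟩
    simp only [Set.mem_iUnion]
    exact ⟨s, hs, (List.mem_tails _ _).2 hts⟩
  exact (h1.biUnion fun s _ => s.tails.finite_toSet).subset this

theorem exists_GG_of_finite {F : Set (List ℕ)} (hF : F.Finite) : ∃ n, ∀ m, n ≤ m → F ⊆ GG m := by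
  induction F, hF using Set.Finite.induction_on with
  | empty => exact ⟨0, fun m _ => Set.empty_subset _⟩
  | @insert a s _ _ ih =>
    obtain ⟨n, hn⟩ := ih
    refine ⟨max n (Encodable.encode a), fun m hm => Set.insert_subset ?_ (hn m ((le_max_left _ _).trans hm))⟩
    exact GG_mono ((le_max_right _ _).trans hm) (mem_GG a)

variable {I : Type} {nd : I → List ℕ} {p : (ℕ → ℕ) → Seminorm ℝ (I →₀ ℝ)} {lam : ℝ}

theorem TreeSN.finite_pre (H : TreeSN I nd p lam) {F : Set (List ℕ)} (hF : F.Finite) :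
    {c | nd c ∈ F}.Finite := by
  have : {c | nd c ∈ F} = ⋃ t ∈ F, {c | nd c = t} := by ext c; simp
  rw [this]
  exact hF.biUnion fun t _ => H.fin t

variable {A : Seminorm ℝ (I →₀ ℝ)} {X : Type*}
    [NormedAddCommGroup X] [NormedSpace ℝ X] [CompleteSpace X]

theorem AMN.block1 (H : TreeSN I nd p lam) (M : AMN nd p lam A) (T : X →L[ℝ] Cmp A)
    (hX : ¬ FiniteDimensional ℝ X) (n : ℕ) {η : ℝ} (hη : 0 < η) :
    ∃ (x : X) (e : I →₀ ℝ) (m : ℕ), n < m ∧ ‖x‖ = 1 ∧ ‖T x - toCmp A e‖ ≤ η ∧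
      ∀ c, e c ≠ 0 → nd c ∈ GG m ∧ nd c ∉ GG n := by
  classical
  have hl := H.lam_pos
  set S : Set I := {c | nd c ∈ GG n} with hS
  have hSf : S.Finite := H.finite_pre (finite_GG n)
  haveI := hSf.to_subtype
  let E : Submodule ℝ (I →₀ ℝ) := Finsupp.supported ℝ ℝ S
  haveI : FiniteDimensional ℝ E :=
    LinearEquiv.finiteDimensional (Finsupp.supportedEquivFinsupp (M := ℝ) (R := ℝ) S).symm
  obtain ⟨Φ, hΦf, _, hΦ1, hΦ2⟩ := finite_norming A E (by norm_num : (1 / 2 : ℝ) < 1)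
  have hlift : ∀ g : (I →₀ ℝ) →ₗ[ℝ] ℝ, g ∈ Φ → ∃ F : Cmp A →L[ℝ] ℝ,
      (∀ v, F (toCmp A v) = g (rr nd (GG n) v)) ∧ ∀ y, ‖F y‖ ≤ lam * ‖y‖ := fun g hg => by
    obtain ⟨F, h1, h2, _⟩ := exists_liftCmp A (g ∘ₗ rr nd (GG n)) lam fun v => by
      rw [LinearMap.comp_apply, Real.norm_eq_abs]
      exact (hΦ1 g hg _).trans (M.dc _ v (dc_GG n))
    exact ⟨F, h1, h2⟩
  choose! F hF1 hF2 using hlift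
  obtain ⟨x, hx, hx0⟩ := exists_unit_ker hX ((fun g => (F g).comp T) '' Φ) (hΦf.image _)
  set δ := η / (1 + 2 * lam) with hδ
  have hδ0 : 0 < δ := by positivity
  obtain ⟨v, hv⟩ := approx_toCmp A (T x) hδ0
  have hrr : A (rr nd (GG n) v) ≤ 2 * lam * δ := by
    obtain ⟨g, hg, hgv⟩ := hΦ2 (rr nd (GG n) v) (by
      rw [Finsupp.mem_supported]
      intro c hc
      by_contra h
      exact (Finsupp.mem_support_iff.1 hc) (rr_neg h v))
    have h0 : F g (T x) = 0 := hx0 _ ⟨g, hg, rfl⟩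
    have h1 := hF2 g hg (T x - toCmp A v)
    rw [map_sub, h0, hF1 g hg, zero_sub, norm_neg, Real.norm_eq_abs] at h1
    have h2 := le_abs_self (g (rr nd (GG n) v))
    have h3 : lam * ‖T x - toCmp A v‖ ≤ lam * δ := mul_le_mul_of_nonneg_left hv.le hl.le
    linarith
  obtain ⟨m, hm⟩ := exists_GG_of_finite (v.support.finite_toSet.image nd)
  refine ⟨x, v - rr nd (GG n) v, max m (n + 1), by omega, hx, ?_, fun c hc => ?_⟩
  · have h1 : T x - toCmp A (v - rr nd (GG n) v) = (T x - toCmp A v) + toCmp A (rr nd (GG n) v) := by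
      rw [map_sub]; abel
    rw [h1]
    refine (norm_add_le _ _).trans ?_
    rw [norm_toCmp]
    have h2 : δ * (1 + 2 * lam) = η := by rw [hδ]; field_simp
    linarith
  · have e1 : (v - rr nd (GG n) v) c = v c - rr nd (GG n) v c := rfl
    rw [e1] at hc
    have h1 : nd c ∉ GG n := fun h => hc (by rw [rr_pos h, sub_self])
    rw [rr_neg h1, sub_zero] at hc
    exact ⟨hm _ (le_max_left _ _) ⟨c, by simpa using hc, rfl⟩, h1⟩

theorem AMN.block2 (H : TreeSN I nd p lam) (M : AMN nd p lam A) (T : X →L[ℝ] Cmp A)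
    (hX : ¬ FiniteDimensional ℝ X) {c θ : ℝ} (hc : 0 < c) (hT : ∀ x, c * ‖x‖ ≤ ‖T x‖)
    (hθ : 0 < θ) :
    ∃ (x : ℕ → X) (e : ℕ → I →₀ ℝ), (∀ k c, e k c ≠ 0 → nd c ∉ GG k) ∧
      ∃ K : ℝ, ∀ a : ℕ →₀ ℝ, ‖T (lc x a) - toCmp A (lc e a)‖ ≤ θ * A (lc e a) ∧
        ∀ k, |a k| ≤ K * A (lc e a) := by
  classical
  have hl := H.lam_pos
  -- summable tolerances
  set η : ℕ → ℝ := fun k => min (c / 2) (θ * c / (4 * lam) * (1 / 2) ^ (k + 1)) with hη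
  have hη0 : ∀ k, 0 < η k := fun k => lt_min (by positivity) (by positivity)
  choose x0 e0 m0 h1 h2 h3 h4 using fun (n k : ℕ) => M.block1 H T hX n (hη0 k)
  -- positions
  let g : ℕ → ℕ := fun k => Nat.rec 0 (fun j n => m0 n j) k
  have hg : ∀ k, g (k + 1) = m0 (g k) k := fun k => rfl
  have hgm : StrictMono g := strictMono_nat_of_lt_succ fun k => by rw [hg]; exact h1 _ _
  set x : ℕ → X := fun k => x0 (g k) k with hx
  set e : ℕ → I →₀ ℝ := fun k => e0 (g k) k with he
  have hx1 : ∀ k, ‖x k‖ = 1 := fun k => h2 _ _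
  have hxe : ∀ k, ‖T (x k) - toCmp A (e k)‖ ≤ η k := fun k => h3 _ _
  have hsup : ∀ k c, e k c ≠ 0 → nd c ∈ GG (g (k + 1)) ∧ nd c ∉ GG (g k) := fun k c h => h4 _ _ c h
  have hAe : ∀ k, c / 2 ≤ A (e k) := fun k => by
    have q1 := hT (x k)
    rw [hx1, mul_one] at q1
    have q2 := norm_sub_norm_le (T (x k)) (toCmp A (e k))
    rw [norm_toCmp] at q2
    have q3 := (hxe k).trans (min_le_left _ _)
    linarith
  -- coefficient bounds
  have hrest : ∀ (a : ℕ →₀ ℝ) k, rr nd (GG (g (k + 1)) \ GG (g k)) (lc e a) = a k • e k := fun a k => by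
    have q1 : ∀ j, rr nd (GG (g (k + 1)) \ GG (g k)) (e j) = if j = k then e k else 0 := fun j => by
      ext i
      by_cases hi : nd i ∈ GG (g (k + 1)) \ GG (g k)
      · rw [rr_pos hi]
        split_ifs with hj
        · rw [hj]
        · by_contra h
          obtain ⟨s1, s2⟩ := hsup j i h
          rcases lt_or_gt_of_ne hj with hj | hj
          · exact hi.2 (GG_mono (hgm.monotone hj) s1)
          · exact s2 (GG_mono (hgm.monotone hj) hi.1)
      · rw [rr_neg hi]
        split_ifs with hj
        · by_contra h
          exact hi (hsup k i (Ne.symm h))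
        · rfl
    rw [Finsupp.linearCombination_apply, Finsupp.sum, map_sum]
    simp only [map_smul, q1, smul_ite, smul_zero]
    rw [Finset.sum_ite_eq']
    split_ifs with h
    · rfl
    · rw [Finsupp.notMem_support_iff.1 h, zero_smul]
  have hcoef : ∀ (a : ℕ →₀ ℝ) k, |a k| ≤ 4 * lam / c * A (lc e a) := fun a k => by
    have q1 : rr nd (GG (g (k + 1)) \ GG (g k)) (lc e a) =
        rr nd (GG (g (k + 1))) (lc e a) - rr nd (GG (g k)) (lc e a) := by
      ext i
      have : (rr nd (GG (g (k + 1))) (lc e a) - rr nd (GG (g k)) (lc e a)) i =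
        rr nd (GG (g (k + 1))) (lc e a) i - rr nd (GG (g k)) (lc e a) i := rfl
      rw [this]
      have hs : nd i ∈ GG (g k) → nd i ∈ GG (g (k + 1)) :=
        fun h => GG_mono (hgm.monotone (Nat.le_succ k)) h
      by_cases h : nd i ∈ GG (g (k + 1)) <;> by_cases h' : nd i ∈ GG (g k)
      · simp [rr_apply, h, h']
      · simp [rr_apply, h, h']
      · exact absurd (hs h') h
      · simp [rr_apply, h, h']
    have q2 : A (a k • e k) ≤ 2 * lam * A (lc e a) := by
      rw [← hrest, q1]
      refine (map_sub_le_add A _ _).trans ?_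
      have := M.dc _ (lc e a) (dc_GG (g (k + 1)))
      have := M.dc _ (lc e a) (dc_GG (g k))
      linarith
    rw [map_smul_eq_mul, Real.norm_eq_abs] at q2
    have q3 := mul_le_mul_of_nonneg_left (hAe k) (abs_nonneg (a k))
    rw [div_mul_eq_mul_div, le_div_iff₀ hc]
    linarith
  refine ⟨x, e, fun k i h hk => (hsup k i h).2 (GG_mono hgm.le_apply hk), 4 * lam / c,
    fun a => ⟨?_, hcoef a⟩⟩
  obtain ⟨N, hN⟩ := exists_bound_support a
  rw [lc_eq_sum_range x a hN, show toCmp A (lc e a) =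
    ∑ k ∈ Finset.range N, a k • toCmp A (e k) by rw [lc_eq_sum_range e a hN]; simp, map_sum,
    ← Finset.sum_sub_distrib]
  refine (norm_sum_le _ _).trans ?_
  have q4 : ∀ k ∈ Finset.range N, ‖T (a k • x k) - a k • toCmp A (e k)‖ ≤
      θ * A (lc e a) * (1 / 2) ^ (k + 1) := fun k _ => by
    rw [map_smul, ← smul_sub, norm_smul, Real.norm_eq_abs]
    refine (mul_le_mul (hcoef a k) ((hxe k).trans (min_le_right _ _)) (norm_nonneg _)
      (mul_nonneg (by positivity) (apply_nonneg _ _))).trans (le_of_eq ?_)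
    field_simp
  refine (Finset.sum_le_sum q4).trans ?_
  rw [← Finset.mul_sum]
  have q5 : ∑ k ∈ Finset.range N, (1 / 2 : ℝ) ^ (k + 1) ≤ 1 := by
    have : ∀ N, ∑ k ∈ Finset.range N, (1 / 2 : ℝ) ^ (k + 1) = 1 - (1 / 2) ^ N := fun N => by
      induction N with
      | zero => simp
      | succ n ih => rw [Finset.sum_range_succ, ih, pow_succ]; ring
    rw [this]
    linarith [pow_pos (by norm_num : (0 : ℝ) < 1 / 2) N]
  calc _ ≤ θ * A (lc e a) * 1 :=
        mul_le_mul_of_nonneg_left q5 (mul_nonneg hθ.le (apply_nonneg _ _))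
    _ = _ := mul_one _

end

open Filter Topology MeasureTheory

noncomputable section

variable {I : Type} {nd : I → List ℕ} {p : (ℕ → ℕ) → Seminorm ℝ (I →₀ ℝ)} {lam : ℝ}
variable {A : Seminorm ℝ (I →₀ ℝ)} {X : Type*}
    [NormedAddCommGroup X] [NormedSpace ℝ X] [CompleteSpace X]

theorem AMN.block3 (H : TreeSN I nd p lam) (M : AMN nd p lam A) (T : X →L[ℝ] Cmp A)
    (hmin : IsMinimal X) {c ε0 : ℝ} (hc : 0 < c) (hT : ∀ x, c * ‖x‖ ≤ ‖T x‖)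
    (hε0 : 0 < ε0)
    (h1 : ∀ (x : X) (e : I →₀ ℝ), ‖x‖ = 1 → ‖T x - toCmp A e‖ < ε0 → ∃ σ, ε0 ≤ p σ e)
    (hp : ∀ σ, ¬ Embeds X (Cmp (p σ))) :
    ∃ (E : Submodule ℝ (I →₀ ℝ)) (c0 : ℝ), 0 < c0 ∧ (∀ y ∈ E, ∃ σ, c0 * A y ≤ p σ y) ∧
      ∀ (Bs : Finset (ℕ → ℕ)) (ε : ℝ), 0 < ε → ∀ F : Set (List ℕ), F.Finite →
        ∃ y ∈ E, A y = 1 ∧ (∀ c, y c ≠ 0 → nd c ∉ F) ∧ ∀ σ ∈ Bs, p σ y < ε := by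
  classical
  set B : ℝ := 2 * (‖T‖ + 1) with hB
  have hB0 : 0 < B := by positivity
  set θ : ℝ := min (1 / 2) (ε0 / (2 * B)) with hθ
  have hθ0 : 0 < θ := lt_min (by norm_num) (by positivity)
  obtain ⟨x, e, hsup, K, hK⟩ := M.block2 H T hmin.1 hc hT hθ0
  have hA1 : ∀ a, A (lc e a) ≤ B * ‖lc x a‖ := fun a => by
    have q1 := (hK a).1
    have q2 := norm_sub_norm_le (toCmp A (lc e a)) (T (lc x a))
    rw [norm_sub_rev, norm_toCmp] at q2
    have q3 := T.le_opNorm (lc x a)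
    have q4 : θ * A (lc e a) ≤ 1 / 2 * A (lc e a) :=
      mul_le_mul_of_nonneg_right (min_le_left _ _) (apply_nonneg _ _)
    have := norm_nonneg (lc x a)
    rw [hB]
    nlinarith
  have hA2 : ∀ a, c / 2 * ‖lc x a‖ ≤ A (lc e a) := fun a => by
    have q1 := (hK a).1
    have q2 := norm_sub_norm_le (T (lc x a)) (toCmp A (lc e a))
    rw [norm_toCmp] at q2
    have q3 := hT (lc x a)
    have q4 : θ * A (lc e a) ≤ 1 / 2 * A (lc e a) :=
      mul_le_mul_of_nonneg_right (min_le_left _ _) (apply_nonneg _ _)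
    have := apply_nonneg A (lc e a)
    linarith
  refine ⟨LinearMap.range (lc e), ε0 / B, by positivity, ?_, ?_⟩
  · rintro _ ⟨a, rfl⟩
    rcases eq_or_ne (lc x a) 0 with h0 | h0
    · refine ⟨0, ?_⟩
      have := hA1 a
      rw [h0, norm_zero, mul_zero] at this
      rw [le_antisymm this (apply_nonneg _ _), mul_zero]
      exact apply_nonneg _ _
    have hn : 0 < ‖lc x a‖ := norm_pos_iff.2 h0
    obtain ⟨σ, hσ⟩ := h1 (‖lc x a‖⁻¹ • lc x a) (‖lc x a‖⁻¹ • lc e a)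
      (by rw [norm_smul, norm_inv, norm_norm, inv_mul_cancel₀ hn.ne']) (by
        rw [map_smul, map_smul, ← smul_sub, norm_smul, norm_inv, norm_norm, inv_mul_lt_iff₀ hn]
        refine (hK a).1.trans_lt ?_
        have q1 := hA1 a
        have q2 : θ ≤ ε0 / (2 * B) := min_le_right _ _
        calc θ * A (lc e a) ≤ ε0 / (2 * B) * (B * ‖lc x a‖) :=
              mul_le_mul q2 q1 (apply_nonneg _ _) (by positivity)
          _ = ‖lc x a‖ * ε0 / 2 := by field_simp
          _ < _ := by have : 0 < ‖lc x a‖ * ε0 := by positivity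
                      linarith)
    refine ⟨σ, ?_⟩
    rw [map_smul_eq_mul, norm_inv, norm_norm, ← div_eq_inv_mul, le_div_iff₀ hn] at hσ
    calc ε0 / B * A (lc e a) ≤ ε0 / B * (B * ‖lc x a‖) :=
          mul_le_mul_of_nonneg_left (hA1 a) (by positivity)
      _ = ε0 * ‖lc x a‖ := by field_simp
      _ ≤ _ := hσ
  · intro Bs ε hε F hF
    by_contra hcon
    push Not at hcon
    obtain ⟨m, hm⟩ := exists_GG_of_finite hF
    let sh : ℕ → ℕ := fun k => k + m
    have hsh : Function.Injective sh := fun a b h => Nat.add_right_cancel h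
    have e1 : ∀ {V : Type _} [AddCommGroup V] [Module ℝ V] (u : ℕ → V) (a : ℕ →₀ ℝ),
      lc u (a.mapDomain sh) = lc (u ∘ sh) a := fun u a => Finsupp.linearCombination_mapDomain _ _ _
    have e1X : ∀ (a : ℕ →₀ ℝ),
      lc x (a.mapDomain sh) = lc (x ∘ sh) a := fun a => Finsupp.linearCombination_mapDomain _ _ _
    have key : ∀ a : ℕ →₀ ℝ, ε * A (lc (e ∘ sh) a) ≤ ∑ σ ∈ Bs, p σ (lc (e ∘ sh) a) := fun a => by
      rcases (apply_nonneg A (lc (e ∘ sh) a)).eq_or_lt with h0 | h0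
      · rw [← h0, mul_zero]
        exact Finset.sum_nonneg fun _ _ => apply_nonneg _ _
      set r := A (lc (e ∘ sh) a) with hr
      obtain ⟨σ, hσ, hσ2⟩ := hcon (r⁻¹ • lc (e ∘ sh) a)
        ⟨r⁻¹ • a.mapDomain sh, by rw [map_smul, e1]⟩
        (by rw [map_smul_eq_mul, norm_inv, Real.norm_eq_abs, abs_of_pos h0, inv_mul_cancel₀ h0.ne'])
        (by
          intro i hi hiF
          obtain ⟨N, hN⟩ := exists_bound_support a
          apply hi
          rw [lc_eq_sum_range _ a hN, Finsupp.smul_apply, Finsupp.finset_sum_apply,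
            Finset.sum_eq_zero, smul_zero]
          intro k _
          rw [Finsupp.smul_apply]
          by_cases h : e (sh k) i = 0
          · rw [Function.comp, h, smul_zero]
          · exact absurd (hm (sh k) (Nat.le_add_left _ _) hiF) (hsup _ _ h))
      rw [map_smul_eq_mul, norm_inv, Real.norm_eq_abs, abs_of_pos h0, ← div_eq_inv_mul,
        le_div_iff₀ h0] at hσ2
      exact hσ2.trans (Finset.single_le_sum (f := fun σ => p σ (lc (e ∘ sh) a))
        (fun _ _ => apply_nonneg _ _) hσ)
    let r : Seminorm ℝ (ℕ →₀ ℝ) := A.comp (lc (e ∘ sh))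
    have hr : ∀ a, r a = A (lc (e ∘ sh) a) := fun a => rfl
    have hB1 : ∀ a, r a ≤ B * ‖lc (x ∘ sh) a‖ := fun a => by
      rw [hr, ← e1, ← e1X]; exact hA1 _
    have hB2 : ∀ a, c / 2 * ‖lc (x ∘ sh) a‖ ≤ r a := fun a => by
      rw [hr, ← e1, ← e1X]; exact hA2 _
    have e2 : ∀ a, lc (fun k => toCmp r (Finsupp.single k 1)) a = toCmp r a := fun a => by
      rw [Finsupp.linearCombination_apply]
      conv_rhs => rw [← Finsupp.sum_single a]
      rw [Finsupp.sum, Finsupp.sum, map_sum]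
      refine Finset.sum_congr rfl fun k _ => ?_
      rw [← map_smul, Finsupp.smul_single, smul_eq_mul, mul_one]
    obtain ⟨S0, d, hd, hS0⟩ : Embeds X (Cmp r) := by
      refine embeds_of_seq hmin (x ∘ sh) (fun k => toCmp r (Finsupp.single k 1)) ?_ (c / 2) B
        (by positivity) (fun a => ?_) (fun a => ?_)
      · refine linearIndependent_of_bound _ (fun _ => |K| * B) fun a k => ?_
        have q1 := (hK (a.mapDomain sh)).2 (sh k)
        rw [Finsupp.mapDomain_apply hsh] at q1
        refine q1.trans ?_
        rw [mul_assoc]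
        refine mul_le_mul (le_abs_self K) ?_ (apply_nonneg _ _) (abs_nonneg _)
        rw [e1]
        exact hB1 a
      · rw [e2, norm_toCmp]; exact hB2 a
      · rw [e2, norm_toCmp]; exact hB1 a
    choose S hS1 hS2 hS3 using fun σ => exists_liftCmp r ((toCmp (p σ)) ∘ₗ (lc (e ∘ sh))) 1
      (fun v => by
        rw [LinearMap.comp_apply, norm_toCmp, one_mul]
        exact M.le σ _)
    have key2 : ∀ y : Cmp r, ε * ‖y‖ ≤ ∑ σ ∈ Bs, ‖S σ y‖ := fun y => by
      refine (denseRange_toCmp r).induction_on y ?_ fun a => ?_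
      · exact isClosed_le (by fun_prop) (by fun_prop)
      · rw [norm_toCmp]
        simp only [hS1, LinearMap.comp_apply, norm_toCmp]
        exact key a
    obtain ⟨σ, _, hσ⟩ := ss hmin (fun σ => Cmp (p σ)) Bs (fun σ => (S σ).comp S0) (ε * d)
      (by positivity) (fun x => by
        have := key2 (S0 x)
        refine le_trans ?_ this
        rw [mul_assoc]
        exact mul_le_mul_of_nonneg_left (hS0 x) hε.le)
    exact hp σ hσ

end

open Filter Topology MeasureTheory

noncomputable section

theorem finite_common (s : Finset (ℕ → ℕ)) :
    {t | ∃ σ ∈ s, ∃ τ ∈ s, σ ≠ τ ∧ On σ t ∧ On τ t}.Finite := by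
  have h : ∀ σ τ : ℕ → ℕ, {t | σ ≠ τ ∧ On σ t ∧ On τ t}.Finite := fun σ τ => by
    by_cases hst : σ = τ
    · convert Set.finite_empty
      ext t
      simp [hst]
    · obtain ⟨n, hn⟩ := Function.ne_iff.1 hst
      refine ((Set.finite_Iic n).image (PiNat.res σ)).subset ?_
      rintro t ⟨_, h1, h2⟩
      refine ⟨t.length, ?_, h1.symm⟩
      by_contra h3
      rw [Set.mem_Iic, not_le] at h3
      rw [On] at h1 h2
      exact hn (PiNat.res_eq_res.1 (h1.symm.trans h2) h3)
  have e : {t | ∃ σ ∈ s, ∃ τ ∈ s, σ ≠ τ ∧ On σ t ∧ On τ t} =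
      ⋃ σ ∈ s, ⋃ τ ∈ s, {t | σ ≠ τ ∧ On σ t ∧ On τ t} := by
    ext t
    simp only [Set.mem_setOf_eq, Set.mem_iUnion, exists_prop]
  rw [e]
  exact Set.Finite.biUnion s.finite_toSet fun σ _ => Set.Finite.biUnion s.finite_toSet fun τ _ => h σ τ

theorem suffix_eq_of_length {s s' t : List ℕ} (h : s <:+ t) (h' : s' <:+ t)
    (hl : s.length = s'.length) : s = s' :=
  (List.suffix_of_suffix_length_le h h' hl.le).eq_of_length hl

theorem exists_branch (C : Set (List ℕ)) (hC : ∀ s ∈ C, ∀ t ∈ C, s <:+ t ∨ t <:+ s) :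
    ∃ σ, ∀ t ∈ C, On σ t := by
  classical
  let Pn : ℕ → ℕ → Prop := fun n a => ∃ s t, t ∈ C ∧ (a :: s) <:+ t ∧ s.length = n
  let σ : ℕ → ℕ := fun n => if h : ∃ a, Pn n a then h.choose else 0
  have huniq : ∀ n a b, Pn n a → Pn n b → a = b := by
    rintro n a b ⟨s, t, ht, hs, hl⟩ ⟨s', t', ht', hs', hl'⟩
    have : a :: s = b :: s' := by
      rcases hC t ht t' ht' with h | h
      · exact suffix_eq_of_length (hs.trans h) hs' (by simp [hl, hl'])
      · exact suffix_eq_of_length hs (hs'.trans h) (by simp [hl, hl'])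
    exact (List.cons.inj this).1
  have hσ : ∀ n a, Pn n a → σ n = a := fun n a h => by
    have h' : ∃ a, Pn n a := ⟨a, h⟩
    simp only [σ, dif_pos h']
    exact huniq n _ _ h'.choose_spec h
  have key : ∀ s : List ℕ, (∃ t ∈ C, s <:+ t) → On σ s := by
    intro s
    induction s with
    | nil => intro _; simp [On]
    | cons a s ih =>
      rintro ⟨t, ht, hst⟩
      have h1 := ih ⟨t, ht, (List.suffix_cons a s).trans hst⟩
      rw [On] at h1 ⊢
      rw [List.length_cons, PiNat.res_succ, ← h1, hσ _ a ⟨s, t, ht, hst, rfl⟩]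
  exact ⟨σ, fun t ht => key t ⟨t, ht, List.suffix_refl _⟩⟩

/-- finite pigeonhole for ultrafilters -/
theorem ultra_fin {α : Type*} (f : Ultrafilter α) {ι : Type*} (s : Finset ι) (P : ι → α → Prop)
    (h : ∀ᶠ x in f, ∃ i ∈ s, P i x) : ∃ i ∈ s, ∀ᶠ x in f, P i x := by
  by_contra hcon
  push Not at hcon
  have h2 : ∀ᶠ x in f, ∀ i ∈ s, ¬ P i x := by
    rw [Filter.eventually_all_finset]
    intro i hi
    exact hcon i hi
  obtain ⟨x, ⟨i, hi, h3⟩, h4⟩ := (h.and h2).exists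
  exact h4 i hi h3

def LL (n : ℕ) : Set (List ℕ) := {t | t.length ≤ n}

theorem dc_LL (n : ℕ) : DC (LL n) := fun _ _ h ht => h.length_le.trans ht

variable {I : Type} {nd : I → List ℕ} {p : (ℕ → ℕ) → Seminorm ℝ (I →₀ ℝ)} {lam : ℝ}
variable {A : Seminorm ℝ (I →₀ ℝ)}

theorem TreeSN.coh2 (H : TreeSN I nd p lam) {σ τ : ℕ → ℕ} {t : List ℕ} (hσ : On σ t) (hτ : On τ t)
    (x : I →₀ ℝ) {n : ℕ} (hn : n ≤ t.length) : p σ (rr nd (LL n) x) = p τ (rr nd (LL n) x) := by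
  have h1 : ∀ ρ, On ρ t → p ρ (rr nd (LL n) x) = p ρ (rr nd {s | s <:+ t ∧ s.length ≤ n} x) :=
    fun ρ hρ => H.congr ρ fun c hc => by
      by_cases h : nd c ∈ LL n
      · rw [rr_pos h, rr_pos]
        exact ⟨hc.suffix hρ (le_trans h hn), h⟩
      · rw [rr_neg h, rr_neg]
        exact fun h' => h h'.2
  rw [h1 σ hσ, h1 τ hτ]
  refine H.coh σ τ t.length _ (hσ.symm.trans hτ) fun c hc => ?_
  have : nd c ∈ {s | s <:+ t ∧ s.length ≤ n} := by
    by_contra h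
    exact hc (rr_neg h x)
  rw [On] at hσ
  rw [← hσ]
  exact this.1

/-- the heavy nodes of a vector -/
def hvy (nd : I → List ℕ) (p : (ℕ → ℕ) → Seminorm ℝ (I →₀ ℝ)) (ε : ℝ) (w : I →₀ ℝ) : Set (List ℕ) :=
  {t | ∃ σ, On σ t ∧ ε ≤ p σ w ∧ ε / 2 ≤ p σ (rr nd (LL t.length) w) ∧
    ∀ n < t.length, p σ (rr nd (LL n) w) < ε / 2}

theorem TreeSN.exists_hvy (H : TreeSN I nd p lam) {ε : ℝ} (hε : 0 < ε) {w : I →₀ ℝ} {σ : ℕ → ℕ}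
    (h : ε ≤ p σ w) : ∃ t ∈ hvy nd p ε w, On σ t := by
  classical
  have hex : ∃ n, ε / 2 ≤ p σ (rr nd (LL n) w) := by
    refine ⟨w.support.sup fun c => (nd c).length, ?_⟩
    have : rr nd (LL (w.support.sup fun c => (nd c).length)) w = w := by
      ext c
      by_cases hc : w c = 0
      · by_cases h : nd c ∈ LL (w.support.sup fun c => (nd c).length)
        · rw [rr_pos h]
        · rw [rr_neg h, hc]
      · rw [rr_pos]
        exact Finset.le_sup (f := fun c => (nd c).length) (Finsupp.mem_support_iff.2 hc)
    rw [this]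
    linarith
  refine ⟨PiNat.res σ (Nat.find hex), ⟨σ, on_res _ _, h, ?_, ?_⟩, on_res _ _⟩
  · rw [res_len]
    exact Nat.find_spec hex
  · rw [res_len]
    intro n hn
    exact not_le.1 (Nat.find_min hex hn)

theorem TreeSN.hvy_anti (H : TreeSN I nd p lam) {ε : ℝ} {w : I →₀ ℝ} {s t : List ℕ}
    (hs : s ∈ hvy nd p ε w) (ht : t ∈ hvy nd p ε w) (hst : s <:+ t) : s = t := by
  by_contra hne
  have hl : s.length < t.length := by
    refine lt_of_le_of_ne hst.length_le fun h => hne (hst.eq_of_length h)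
  obtain ⟨σ, h1, _, h3, _⟩ := hs
  obtain ⟨τ, g1, _, _, g4⟩ := ht
  have := g4 _ hl
  rw [H.coh2 (g1.of_suffix hst) h1 w le_rfl] at this
  linarith

theorem AMN.conc' (M : AMN nd p lam A) {ε L : ℝ} (hε : 0 < ε) (hL : 0 < L) :
    ∃ N : ℕ, ∀ x, A x ≤ L → ∀ (α : Type) (s : Finset α) (J : α → Itv), Valid s J →
    (∀ a ∈ s, ε ≤ (J a).q nd p x) → s.card ≤ N := by
  obtain ⟨N, hN⟩ := M.conc (ε / L) (by positivity)
  refine ⟨N, fun x hx α s J hJ h => hN (L⁻¹ • x) ?_ α s J hJ fun a ha => ?_⟩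
  · rw [map_smul_eq_mul, norm_inv, Real.norm_eq_abs, abs_of_pos hL, inv_mul_le_iff₀ hL, mul_one]
    exact hx
  · rw [map_smul_eq_mul, norm_inv, Real.norm_eq_abs, abs_of_pos hL, div_eq_inv_mul]
    exact mul_le_mul_of_nonneg_left (h a ha) (by positivity)

theorem AMN.hvy_card (H : TreeSN I nd p lam) (M : AMN nd p lam A) {ε L : ℝ} (hε : 0 < ε)
    (hL : 0 < L) : ∃ N : ℕ, ∀ w, A w ≤ L → ∃ f : ℕ → List ℕ, ∀ t ∈ hvy nd p ε w, ∃ a < N, f a = t := by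
  classical
  obtain ⟨N, hN⟩ := M.conc' (half_pos hε) hL
  refine ⟨N, fun w hw => ?_⟩
  have hcard : ∀ s : Finset (List ℕ), (s : Set (List ℕ)) ⊆ hvy nd p ε w → s.card ≤ N := by
    intro s hs
    choose! σ h1 h2 h3 h4 using fun t (ht : t ∈ hvy nd p ε w) => ht
    refine hN w hw _ s (fun t => ⟨σ t, {u | u.length < t.length}, Set.univ,
      fun _ _ h h' => lt_of_le_of_lt h.length_le h', fun _ _ h _ => trivial⟩) ?_ ?_
    · intro a ha b hb hab t ht t' ht' htt
      apply hab
      have ha' := hs ha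
      have hb' := hs hb
      have q1 : a <:+ t := (h1 a ha').suffix ht.1 (not_lt.1 ht.2.2)
      have q2 : b <:+ t' := (h1 b hb').suffix ht'.1 (not_lt.1 ht'.2.2)
      rcases List.suffix_or_suffix_of_suffix (q1.trans htt) q2 with h | h
      · exact H.hvy_anti ha' hb' h
      · exact (H.hvy_anti hb' ha' h).symm
    · intro t ht
      have ht' := hs ht
      rw [Itv.q_apply]
      by_cases h0 : t.length = 0
      · have e : rr nd (Set.univ \ {u : List ℕ | u.length < t.length}) w = w := by
          ext c
          rw [rr_pos]
          simp [h0]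
        show _ ≤ p (σ t) (rr nd (Set.univ \ {u : List ℕ | u.length < t.length}) w)
        rw [e]
        linarith [h2 t ht']
      · have e : rr nd (Set.univ \ {u : List ℕ | u.length < t.length}) w =
            w - rr nd (LL (t.length - 1)) w := by
          ext c
          have : (w - rr nd (LL (t.length - 1)) w) c = w c - rr nd (LL (t.length - 1)) w c := rfl
          rw [this]
          by_cases hc : (nd c).length < t.length
          · rw [rr_neg, rr_pos, sub_self]
            · show (nd c).length ≤ t.length - 1
              omega
            · exact fun h => h.2 hc
          · rw [rr_pos, rr_neg, sub_zero]
            · intro h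
              have : (nd c).length ≤ t.length - 1 := h
              omega
            · exact ⟨trivial, hc⟩
        show _ ≤ p (σ t) (rr nd (Set.univ \ {u : List ℕ | u.length < t.length}) w)
        rw [e]
        have q1 := h4 t ht' (t.length - 1) (by omega)
        have q2 := h2 t ht'
        have q3 := map_add_le_add (p (σ t)) (w - rr nd (LL (t.length - 1)) w) (rr nd (LL (t.length - 1)) w)
        rw [sub_add_cancel] at q3
        linarith
  have hfin : (hvy nd p ε w).Finite := by
    by_contra hinf
    obtain ⟨s, hs, hsc⟩ := Set.Infinite.exists_subset_card_eq hinf (N + 1)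
    have := hcard s hs
    omega
  have hc := hcard hfin.toFinset (by simp)
  refine ⟨fun a => if h : a < hfin.toFinset.card then (hfin.toFinset.equivFin.symm ⟨a, h⟩ : List ℕ)
    else [], fun t ht => ?_⟩
  have ht' : t ∈ hfin.toFinset := by simpa using ht
  refine ⟨hfin.toFinset.equivFin ⟨t, ht'⟩, (Fin.is_lt _).trans_le hc, ?_⟩
  simp

theorem TreeSN.hvy_le (H : TreeSN I nd p lam) {ε : ℝ} {w : I →₀ ℝ} {t : List ℕ}
    (ht : t ∈ hvy nd p ε w) {σ : ℕ → ℕ} (hσ : On σ t) : ε / (2 * lam) ≤ p σ w := by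
  obtain ⟨τ, h1, _, h3, _⟩ := ht
  rw [H.coh2 h1 hσ w le_rfl] at h3
  have := H.dc σ (dc_LL t.length) w
  have hl := H.lam_pos
  rw [div_le_iff₀ (by positivity)]
  linarith

theorem AMN.nonred (H : TreeSN I nd p lam) (M : AMN nd p lam A) (f : Ultrafilter ℕ) {ε L : ℝ}
    (hε : 0 < ε) (hL : 0 < L) (w w' : ℕ → I →₀ ℝ) (hw : ∀ i, A (w i) ≤ L) (hw' : ∀ i, A (w' i) ≤ L)
    (h : ∀ σ, ∀ᶠ i in f, p σ (w i) < ε / (2 * lam)) (h' : ∀ σ, ∀ᶠ i in f, p σ (w' i) < ε / (2 * lam)) :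
    ∀ᶠ i in f, ∀ᶠ k in f, ∀ σ, ¬ (ε ≤ p σ (w i) ∧ ε ≤ p σ (w' k)) := by
  classical
  by_contra hcon
  rw [← Ultrafilter.eventually_not] at hcon
  simp only [← Ultrafilter.eventually_not] at hcon
  obtain ⟨N, hN⟩ := M.hvy_card H hε hL
  choose g hg using fun i => hN (w i) (hw i)
  choose g' hg' using fun i => hN (w' i) (hw' i)
  let P : ℕ × ℕ × Bool → ℕ → ℕ → Prop := fun a i k => g i a.1 ∈ hvy nd p ε (w i) ∧
    g' k a.2.1 ∈ hvy nd p ε (w' k) ∧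
      (if a.2.2 then g i a.1 <:+ g' k a.2.1 else g' k a.2.1 <:+ g i a.1)
  let s : Finset (ℕ × ℕ × Bool) := Finset.range N ×ˢ Finset.range N ×ˢ Finset.univ
  have hP : ∀ᶠ i in f, ∀ᶠ k in f, ∃ a ∈ s, P a i k := by
    filter_upwards [hcon] with i hi
    filter_upwards [hi] with k hk
    push Not at hk
    obtain ⟨σ, h1, h2⟩ := hk
    obtain ⟨t, ht, hσt⟩ := H.exists_hvy hε h1
    obtain ⟨t', ht', hσt'⟩ := H.exists_hvy hε h2
    obtain ⟨a, ha, rfl⟩ := hg i t ht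
    obtain ⟨b, hb, rfl⟩ := hg' k t' ht'
    rcases le_total (g i a).length (g' k b).length with hl | hl
    · exact ⟨(a, b, true), by simp [s, ha, hb], ht, ht', by simpa using hσt.suffix hσt' hl⟩
    · exact ⟨(a, b, false), by simp [s, ha, hb], ht, ht', by simpa using hσt'.suffix hσt hl⟩
  obtain ⟨⟨a, b, dir⟩, _, hab⟩ := ultra_fin f s (fun a i => ∀ᶠ k in f, P a i k)
    (hP.mono fun i hi => ultra_fin f s _ hi)
  cases dir with
  | true =>
    obtain ⟨σ, hσ⟩ := exists_branch {t | ∃ i, (∀ᶠ k in f, P (a, b, true) i k) ∧ g i a = t} (by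
      rintro _ ⟨i, hi, rfl⟩ _ ⟨j, hj, rfl⟩
      obtain ⟨k, hk1, hk2⟩ := (hi.and hj).exists
      have q1 := hk1.2.2
      have q2 := hk2.2.2
      simp only [if_true] at q1 q2
      exact List.suffix_or_suffix_of_suffix q1 q2)
    obtain ⟨i, hi1, hi2⟩ := (hab.and (h σ)).exists
    obtain ⟨k, hk⟩ := hi1.exists
    exact absurd (H.hvy_le hk.1 (hσ _ ⟨i, hi1, rfl⟩)) (not_le.2 hi2)
  | false =>
    obtain ⟨i, hi⟩ := hab.exists
    obtain ⟨k0, hk0⟩ := hi.exists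
    obtain ⟨σ, hσ, _⟩ := hk0.1
    obtain ⟨k, hk1, hk2⟩ := (hi.and (h' σ)).exists
    have q1 := hk1.2.2
    simp only [Bool.false_eq_true, if_false] at q1
    exact absurd (H.hvy_le hk1.2.1 (hσ.of_suffix q1)) (not_le.2 hk2)

end

open Filter Topology MeasureTheory

noncomputable section

theorem sel_fin (f : Ultrafilter ℕ) (M : ℕ) (Q : ℕ → ℕ → Prop) (R : ℕ → ℕ → ℕ → ℕ → Prop)
    (hQ : ∀ m < M, ∀ᶠ i in f, Q m i) (hR : ∀ m m', m < m' → m' < M → ∀ᶠ i in f, ∀ᶠ k in f, R m m' i k) :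
    ∃ i : ℕ → ℕ, (∀ m < M, Q m (i m)) ∧ ∀ m m', m < m' → m' < M → R m m' (i m) (i m') := by
  obtain ⟨i, hi⟩ := exists_seq_strong (α := ℕ) (fun n g a =>
    (n < M ∧ ∀ m < n, ∀ᶠ k in f, R m n (g m) k) →
      (Q n a ∧ (∀ m' ∈ Finset.range M, n < m' → ∀ᶠ k in f, R n m' a k) ∧
        ∀ m ∈ Finset.range n, R m n (g m) a)) (by
    intro n g
    by_cases h : n < M ∧ ∀ m < n, ∀ᶠ k in f, R m n (g m) k
    · have h1 : ∀ᶠ a in f, ∀ m' ∈ Finset.range M, n < m' → ∀ᶠ k in f, R n m' a k := by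
        rw [Filter.eventually_all_finset]
        intro m' hm'
        by_cases hn : n < m'
        · filter_upwards [hR n m' hn (Finset.mem_range.1 hm')] with a ha _ using ha
        · exact Filter.Eventually.of_forall fun a h => absurd h hn
      have h2 : ∀ᶠ a in f, ∀ m ∈ Finset.range n, R m n (g m) a := by
        rw [Filter.eventually_all_finset]
        intro m hm
        exact h.2 m (Finset.mem_range.1 hm)
      obtain ⟨a, ha⟩ := ((hQ n h.1).and (h1.and h2)).exists
      exact ⟨a, fun _ => ha⟩
    · exact ⟨0, fun h' => absurd h' h⟩)
  have key : ∀ n, n < M → Q n (i n) ∧ (∀ m' ∈ Finset.range M, n < m' → ∀ᶠ k in f, R n m' (i n) k) ∧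
        ∀ m ∈ Finset.range n, R m n (i m) (i n) := by
    intro n
    induction n using Nat.strong_induction_on with
    | _ n ih =>
      intro hn
      obtain ⟨g, hg, h⟩ := hi n
      obtain ⟨h1, h2, h3⟩ := h ⟨hn, fun m hm => by
        rw [hg m hm]
        exact (ih m hm (hm.trans hn)).2.1 n (Finset.mem_range.2 hn) hm⟩
      refine ⟨h1, h2, fun m hm => ?_⟩
      rw [← hg m (Finset.mem_range.1 hm)]
      exact h3 m hm
  exact ⟨i, fun m hm => (key m hm).1, fun m m' h h' => (key m' h').2.2 m (Finset.mem_range.2 h)⟩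

variable {I : Type} {nd : I → List ℕ} {p : (ℕ → ℕ) → Seminorm ℝ (I →₀ ℝ)} {lam : ℝ}
variable {A : Seminorm ℝ (I →₀ ℝ)}

def Sg (p : (ℕ → ℕ) → Seminorm ℝ (I →₀ ℝ)) (f : Ultrafilter ℕ) (ε : ℝ) (y : ℕ → I →₀ ℝ) :
    Set (ℕ → ℕ) := {σ | ∀ᶠ i in f, ε ≤ p σ (y i)}

theorem AMN.finite_Sg (M : AMN nd p lam A) {f : Ultrafilter ℕ} (hf : (f : Filter ℕ) ≤ atTop)
    {ε : ℝ} (hε : 0 < ε)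
    {y : ℕ → I →₀ ℝ} (hy : ∀ i, A (y i) ≤ 1) (hs : ∀ i c, y i c ≠ 0 → nd c ∉ GG i) :
    (Sg p f ε y).Finite := by
  by_contra hinf
  obtain ⟨N, hN⟩ := M.conc ε hε
  obtain ⟨s, hsS, hsc⟩ := Set.Infinite.exists_subset_card_eq hinf (N + 1)
  obtain ⟨m, hm⟩ := exists_GG_of_finite (finite_common s)
  have h1 : ∀ᶠ i in f, ∀ σ ∈ s, ε ≤ p σ (y i) := by
    rw [Filter.eventually_all_finset]
    intro σ hσ
    exact hsS hσ
  obtain ⟨i, hi, him⟩ := (h1.and (hf (eventually_ge_atTop m))).exists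
  have := hN (y i) (hy i) _ s (fun σ => ⟨σ, GG m, Set.univ, dc_GG m, fun _ _ _ h => h⟩) ?_ ?_
  · omega
  · intro σ hσ τ hτ hst t ht t' ht' htt
    exact ht.2.2 (hm m le_rfl ⟨σ, hσ, τ, hτ, hst, ht.1, ht'.1.of_suffix htt⟩)
  · intro σ hσ
    rw [Itv.q_apply]
    have e : rr nd (Set.univ \ GG m) (y i) = y i := by
      ext c
      by_cases hc : y i c = 0
      · rw [hc]
        by_cases h : nd c ∈ Set.univ \ GG m
        · rw [rr_pos h, hc]
        · exact rr_neg h _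
      · rw [rr_pos]
        exact ⟨trivial, fun h => hs i c hc (GG_mono him h)⟩
    show ε ≤ p σ (rr nd (Set.univ \ GG m) (y i))
    rw [e]
    exact hi σ hσ

def KK (S : Set (ℕ → ℕ)) : Set (List ℕ) := {t | ∃ σ ∈ S, On σ t}

theorem dc_KK (S : Set (ℕ → ℕ)) : DC (KK S) := fun _ _ h ⟨σ, hσ, ht⟩ => ⟨σ, hσ, ht.of_suffix h⟩

theorem rr_add_compl (K : Set (List ℕ)) (x : I →₀ ℝ) : rr nd K x + rr nd Kᶜ x = x := by
  ext c
  rw [Finsupp.add_apply]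
  by_cases h : nd c ∈ K
  · rw [rr_pos h, rr_neg (show nd c ∉ Kᶜ from fun h' => h' h), add_zero]
  · rw [rr_neg h, rr_pos (show nd c ∈ Kᶜ from h), zero_add]

theorem sn_compl_le (q : Seminorm ℝ (I →₀ ℝ)) (K : Set (List ℕ)) (x : I →₀ ℝ) :
    q (rr nd Kᶜ x) ≤ q x + q (rr nd K x) := by
  have : rr nd Kᶜ x = x - rr nd K x := by
    rw [eq_sub_iff_add_eq, add_comm, rr_add_compl]
  rw [this]
  exact map_sub_le_add q _ _

theorem TreeSN.small_compl (H : TreeSN I nd p lam) (f : Ultrafilter ℕ) {ε : ℝ} (hε : 0 < ε)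
    (y : ℕ → I →₀ ℝ) (τ : ℕ → ℕ) :
    ∀ᶠ i in f, p τ (rr nd (KK (Sg p f ε y))ᶜ (y i)) < (1 + lam) * ε := by
  have hl := H.lam_pos
  by_cases hτ : τ ∈ Sg p f ε y
  · refine Filter.Eventually.of_forall fun i => ?_
    rw [H.zero τ]
    · positivity
    · intro c hc
      exact rr_neg (show nd c ∉ (KK (Sg p f ε y))ᶜ from fun h => h ⟨τ, hτ, hc⟩) _
  · have : ∀ᶠ i in f, ¬ ε ≤ p τ (y i) := Ultrafilter.eventually_not.2 hτ
    filter_upwards [this] with i hi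
    have h1 := sn_compl_le (nd := nd) (p τ) (KK (Sg p f ε y)) (y i)
    have h2 := H.dc τ (dc_KK (Sg p f ε y)) (y i)
    have h3 : lam * p τ (y i) < lam * ε := mul_lt_mul_of_pos_left (not_le.1 hi) hl
    linarith

/-- at most one big term -/
theorem sum_le_of_one (M : ℕ) (b : ℕ → ℝ) {L ε : ℝ} (hε : 0 ≤ ε) (hL : 0 ≤ L) (hb : ∀ m < M, b m ≤ L)
    (h : ∀ m < M, ∀ m' < M, m ≠ m' → ¬ (ε ≤ b m ∧ ε ≤ b m')) :
    ∑ m ∈ Finset.range M, b m ≤ L + M * ε := by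
  classical
  by_cases hex : ∃ m < M, ε ≤ b m
  · obtain ⟨m, hm, hbm⟩ := hex
    have h1 : ∀ m' ∈ Finset.range M, b m' ≤ (if m' = m then L else 0) + ε := fun m' hm' => by
      rw [Finset.mem_range] at hm'
      split_ifs with he
      · linarith [hb m' hm']
      · by_contra hc
        exact h m hm m' hm' (Ne.symm he) ⟨hbm, by linarith⟩
    refine (Finset.sum_le_sum h1).trans ?_
    rw [Finset.sum_add_distrib, Finset.sum_ite_eq', Finset.sum_const, Finset.card_range, nsmul_eq_mul]
    split_ifs <;> linarith
  · push Not at hex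
    refine (Finset.sum_le_sum fun m hm => (hex m (Finset.mem_range.1 hm)).le).trans ?_
    rw [Finset.sum_const, Finset.card_range, nsmul_eq_mul]
    linarith

end

open Filter Topology MeasureTheory

noncomputable section

variable {I : Type} {nd : I → List ℕ} {p : (ℕ → ℕ) → Seminorm ℝ (I →₀ ℝ)} {lam : ℝ}
variable {A : Seminorm ℝ (I →₀ ℝ)}

theorem AMN.contra (H : TreeSN I nd p lam) (M : AMN nd p lam A) (E : Submodule ℝ (I →₀ ℝ)) {c0 : ℝ}
    (hc0 : 0 < c0) (hE1 : ∀ y ∈ E, ∃ σ, c0 * A y ≤ p σ y)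
    (hE2 : ∀ (Bs : Finset (ℕ → ℕ)) (ε : ℝ), 0 < ε → ∀ F : Set (List ℕ), F.Finite →
        ∃ y ∈ E, A y = 1 ∧ (∀ c, y c ≠ 0 → nd c ∉ F) ∧ ∀ σ ∈ Bs, p σ y < ε) : False := by
  classical
  have hl := H.lam_pos
  have hl1 := H.one_le
  obtain ⟨N, hN⟩ := M.conc' (show 0 < c0 / (4 * lam) by positivity)
    (show 0 < (3 + 2 * lam) / c0 by positivity)
  set M0 : ℕ := 2 * N + 1 with hM0
  have hM0' : (0 : ℝ) < M0 := by rw [hM0]; positivity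
  set ε : ℝ := min (1 / M0) (c0 / (4 * lam)) with hε
  have hε0 : 0 < ε := lt_min (by positivity) (by positivity)
  have hεM : M0 * ε ≤ 1 := by
    have : ε ≤ 1 / M0 := min_le_left _ _
    rw [le_div_iff₀ hM0'] at this
    linarith
  have hεc : lam * ε ≤ c0 / 4 := by
    have : ε ≤ c0 / (4 * lam) := min_le_right _ _
    rw [le_div_iff₀ (by positivity)] at this
    linarith
  have hεc2 : ε ≤ c0 / 4 := le_trans (le_mul_of_one_le_left hε0.le hl1) hεc
  set ε1 : ℝ := ε / (4 * lam * (1 + lam)) with hε1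
  have hε10 : 0 < ε1 := by positivity
  have hε11 : (1 + lam) * ε1 ≤ ε / (2 * lam) := by
    rw [hε1, le_div_iff₀ (by positivity)]
    have : (1 + lam) * (ε / (4 * lam * (1 + lam))) * (2 * lam) = ε / 2 := by field_simp; norm_num
    rw [this]
    linarith
  set f : Ultrafilter ℕ := hyperfilter ℕ with hf
  have hfT : (f : Filter ℕ) ≤ atTop := Nat.hyperfilter_le_atTop
  -- the sequences
  let α := {y : ℕ → I →₀ ℝ // ∀ i, y i ∈ E ∧ A (y i) = 1 ∧ ∀ c, y i c ≠ 0 → nd c ∉ GG i}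
  have hSf : ∀ y : α, (Sg p f ε1 y.1).Finite := fun y =>
    M.finite_Sg hfT hε10 (fun i => (y.2 i).2.1.le) fun i => (y.2 i).2.2
  have hex : ∀ Bs : Finset (ℕ → ℕ), ∃ y : α, ∀ σ ∈ Bs, ∀ i : ℕ, p σ (y.1 i) < 1 / ((i : ℝ) + 1) := by
    intro Bs
    choose y h1 h2 h3 h4 using fun i : ℕ => hE2 Bs (1 / ((i : ℝ) + 1)) (by positivity) (GG i) (finite_GG i)
    exact ⟨⟨y, fun i => ⟨h1 i, h2 i, h3 i⟩⟩, fun σ hσ i => h4 i σ hσ⟩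
  haveI : Nonempty α := ⟨(hex ∅).choose⟩
  obtain ⟨y, hy⟩ := exists_seq_strong (α := α)
    (fun n g y => ∀ m < n, ∀ σ ∈ Sg p f ε1 (g m).1, ∀ i : ℕ, p σ (y.1 i) < 1 / ((i : ℝ) + 1)) (by
    intro n g
    obtain ⟨y, hy⟩ := hex ((Finset.range n).biUnion fun m => (hSf (g m)).toFinset)
    refine ⟨y, fun m hm σ hσ => hy σ ?_⟩
    rw [Finset.mem_biUnion]
    exact ⟨m, Finset.mem_range.2 hm, (hSf (g m)).mem_toFinset.2 hσ⟩)
  have hnull : ∀ n, ∀ m < n, ∀ σ ∈ Sg p f ε1 (y m).1, ∀ i : ℕ, p σ ((y n).1 i) < 1 / ((i : ℝ) + 1) := by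
    intro n m hm σ hσ
    obtain ⟨g, hg, h⟩ := hy n
    exact h m hm σ (by rw [hg m hm]; exact hσ)
  have hdis : ∀ m n, m < n → ∀ σ, σ ∈ Sg p f ε1 (y m).1 → σ ∈ Sg p f ε1 (y n).1 → False := by
    intro m n hmn σ h1 h2
    have h3 : ∀ᶠ i : ℕ in f, 1 / ((i : ℝ) + 1) < ε1 :=
      hfT (tendsto_one_div_add_atTop_nhds_zero_nat.eventually (gt_mem_nhds hε10))
    obtain ⟨i, hi, hi'⟩ := (h2.and h3).exists
    have := hnull n m hmn σ h1 i
    linarith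
  have hdis' : ∀ m n, m ≠ n → ∀ σ, σ ∈ Sg p f ε1 (y m).1 → σ ∈ Sg p f ε1 (y n).1 → False := by
    intro m n hmn σ h1 h2
    rcases lt_or_gt_of_ne hmn with h | h
    · exact hdis m n h σ h1 h2
    · exact hdis n m h σ h2 h1
  set K : ℕ → Set (List ℕ) := fun m => KK (Sg p f ε1 (y m).1) with hK
  have hKd : ∀ m, DC (K m) := fun m => dc_KK _
  set w : ℕ → ℕ → I →₀ ℝ := fun m i => rr nd (K m)ᶜ ((y m).1 i) with hw
  have hwA : ∀ m i, A (w m i) ≤ 1 + lam := fun m i => by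
    have h1 := sn_compl_le (nd := nd) A (K m) ((y m).1 i)
    have h2 := M.dc (K m) ((y m).1 i) (hKd m)
    rw [((y m).2 i).2.1] at h1 h2
    linarith
  have hws : ∀ m σ, ∀ᶠ i in f, p σ (w m i) < ε / (2 * lam) := fun m σ => by
    filter_upwards [H.small_compl f hε10 (y m).1 σ] with i hi
    exact hi.trans_le hε11
  -- common prefixes
  obtain ⟨nD, hnD⟩ := exists_GG_of_finite (finite_common
    ((Finset.range M0).biUnion fun m => (hSf (y m)).toFinset))
  obtain ⟨i, hi1, hi2⟩ := sel_fin f M0 (fun m i => nD ≤ i)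
    (fun m m' i k => (∀ σ, ¬ (ε ≤ p σ (w m i) ∧ ε ≤ p σ (w m' k))) ∧
      ∀ c, (y m).1 i c ≠ 0 → nd c ∈ GG k) (fun m _ => hfT (eventually_ge_atTop nD)) (by
    intro m m' hm hm'
    filter_upwards [M.nonred H f hε0 (by positivity) (w m) (w m') (hwA m) (hwA m') (hws m) (hws m')]
      with i hi
    obtain ⟨n, hn⟩ := exists_GG_of_finite (((y m).1 i).support.finite_toSet.image nd)
    filter_upwards [hi, hfT (eventually_ge_atTop n)] with k hk hnk
    exact ⟨hk, fun c hc => hn k hnk ⟨c, by simpa using hc, rfl⟩⟩)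
  set d : ℕ → I →₀ ℝ := fun m => (y m).1 (i m) with hd
  set W : ℕ → I →₀ ℝ := fun m => rr nd (K m)ᶜ (d m) with hW
  have hWw : ∀ m, W m = w m (i m) := fun m => rfl
  have hdE : ∀ m, d m ∈ E := fun m => ((y m).2 (i m)).1
  have hdA : ∀ m, A (d m) = 1 := fun m => ((y m).2 (i m)).2.1
  have hdG : ∀ m c, d m c ≠ 0 → nd c ∉ GG (i m) := fun m => ((y m).2 (i m)).2.2
  have hred : ∀ m < M0, ∀ m' < M0, m ≠ m' → ∀ σ, ¬ (ε ≤ p σ (W m) ∧ ε ≤ p σ (W m')) := by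
    intro m hm m' hm' hne σ
    rcases lt_or_gt_of_ne hne with h | h
    · exact (hi2 m m' h hm').1 σ
    · exact fun h' => (hi2 m' m h hm).1 σ h'.symm
  have hcommon : ∀ m < M0, ∀ m' < M0, m ≠ m' → ∀ σ ∈ Sg p f ε1 (y m).1, ∀ σ' ∈ Sg p f ε1 (y m').1,
      ∀ t, On σ t → On σ' t → ∀ n < M0, t ∈ GG (i n) := by
    intro m hm m' hm' hne σ hσ σ' hσ' t ht ht' n hn
    refine hnD (i n) (hi1 n hn) ⟨σ, ?_, σ', ?_, fun he => ?_, ht, ht'⟩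
    · rw [Finset.mem_biUnion]
      exact ⟨m, Finset.mem_range.2 hm, (hSf (y m)).mem_toFinset.2 hσ⟩
    · rw [Finset.mem_biUnion]
      exact ⟨m', Finset.mem_range.2 hm', (hSf (y m')).mem_toFinset.2 hσ'⟩
    · rw [← he] at hσ'
      exact hdis' m m' hne σ hσ hσ'
  -- the K part
  have hKle : ∀ m σ, p σ (rr nd (K m) (d m)) = 0 ∨ ∃ τ ∈ Sg p f ε1 (y m).1,
      p σ (rr nd (K m) (d m)) ≤ lam * p τ (d m) := fun m σ => by
    rcases H.dc' σ (hKd m) (d m) with h | ⟨n, ⟨τ, hτ, hn⟩, h⟩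
    · exact Or.inl h
    · refine Or.inr ⟨τ, hτ, h τ ?_⟩
      rw [On, res_len] at hn
      exact hn.symm
  have hpd : ∀ m σ, p σ (d m) ≤ 1 := fun m σ => (M.le σ _).trans (hdA m).le
  have hKnode : ∀ m σ, p σ (rr nd (K m) (d m)) ≠ 0 → ∃ t, On σ t ∧ t ∉ GG (i m) ∧
      ∃ τ ∈ Sg p f ε1 (y m).1, On τ t := fun m σ h => by
    by_contra hcon
    push Not at hcon
    refine h (H.zero σ fun c hc => ?_)
    by_cases hcK : nd c ∈ K m
    · rw [rr_pos hcK]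
      by_contra hdc
      obtain ⟨τ, hτ, hct⟩ := hcK
      exact hcon (nd c) hc (hdG m c hdc) τ hτ hct
    · exact rr_neg hcK _
  set x : I →₀ ℝ := ∑ m ∈ Finset.range M0, d m with hx
  have hxE : x ∈ E := Submodule.sum_mem _ fun m _ => hdE m
  have hsplit : ∀ m σ, p σ (d m) ≤ p σ (rr nd (K m) (d m)) + p σ (W m) := fun m σ => by
    have := map_add_le_add (p σ) (rr nd (K m) (d m)) (W m)
    rwa [hW, rr_add_compl] at this
  have hxA : A x ≤ (3 + 2 * lam) / c0 := by
    obtain ⟨σ, hσ⟩ := hE1 x hxE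
    have h1 : p σ x ≤ ∑ m ∈ Finset.range M0, p σ (rr nd (K m) (d m)) +
        ∑ m ∈ Finset.range M0, p σ (W m) := by
      refine (sn_sum_le (p σ) _ _).trans ?_
      rw [← Finset.sum_add_distrib]
      exact Finset.sum_le_sum fun m _ => hsplit m σ
    have h2 := sum_le_of_one M0 (fun m => p σ (W m)) hε0.le (show 0 ≤ 1 + lam by positivity)
      (fun m _ => (M.le σ _).trans (hwA m (i m))) fun m hm m' hm' hne => hred m hm m' hm' hne σ
    have h3 := sum_le_of_one M0 (fun m => p σ (rr nd (K m) (d m))) hε0.le hl.le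
      (fun m _ => by
        rcases hKle m σ with h | ⟨τ, _, h⟩
        · show p σ (rr nd (K m) (d m)) ≤ lam
          rw [h]; exact hl.le
        · have := mul_le_mul_of_nonneg_left (hpd m τ) hl.le
          show p σ (rr nd (K m) (d m)) ≤ lam
          linarith) (by
      rintro m hm m' hm' hne ⟨h, h'⟩
      obtain ⟨t, ht, htG, τ, hτ, hτt⟩ := hKnode m σ (hε0.trans_le h).ne'
      obtain ⟨t', ht', htG', τ', hτ', hτt'⟩ := hKnode m' σ (hε0.trans_le h').ne'
      rcases le_total t.length t'.length with hle | hle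
      · exact htG (hcommon m hm m' hm' hne τ hτ τ' hτ' t hτt (hτt'.of_suffix (ht.suffix ht' hle)) m hm)
      · exact htG' (hcommon m hm m' hm' hne τ hτ τ' hτ' t' (hτt.of_suffix (ht'.suffix ht hle)) hτt' m' hm'))
    rw [le_div_iff₀ hc0]
    linarith
  -- the range sets
  set Q : ℕ → Set (List ℕ) := fun m => {t | ∃ c, d m c ≠ 0 ∧ t <:+ nd c} with hQ
  have hQd : ∀ m, DC (Q m) := fun m s t hst ⟨c, hc, ht⟩ => ⟨c, hc, hst.trans ht⟩
  have hxd : ∀ m < M0, ∀ c, nd c ∈ Q m → nd c ∉ GG (i m) → x c = d m c := by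
    intro m hm c hcQ hcG
    rw [hx, Finsupp.finset_sum_apply]
    refine Finset.sum_eq_single_of_mem m (Finset.mem_range.2 hm) fun n hn hnm => ?_
    rw [Finset.mem_range] at hn
    by_contra hne
    rcases lt_or_gt_of_ne hnm with h | h
    · exact hcG ((hi2 n m h hm).2 c hne)
    · obtain ⟨c', hc', hcc⟩ := hcQ
      exact hdG n c hne (dc_GG _ _ _ hcc ((hi2 m n h hn).2 c' hc'))
  have hrest : ∀ m < M0, ∀ L : Set (List ℕ), rr nd (Q m \ (GG (i m) ∪ L)) x = rr nd Lᶜ (d m) := by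
    intro m hm L
    ext c
    by_cases h : nd c ∈ Q m \ (GG (i m) ∪ L)
    · have hL : nd c ∈ Lᶜ := fun h' => h.2 (Or.inr h')
      rw [rr_pos h, rr_pos hL]
      exact hxd m hm c h.1 fun h' => h.2 (Or.inl h')
    · rw [rr_neg h]
      by_cases hL : nd c ∈ Lᶜ
      · rw [rr_pos hL]
        by_contra hne
        refine h ⟨⟨c, Ne.symm hne, List.suffix_refl _⟩, fun h' => ?_⟩
        rcases h' with h' | h'
        · exact hdG m c (Ne.symm hne) h'
        · exact hL h'
      · rw [rr_neg hL]
  -- types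
  have htype : ∀ m, (∃ τ, c0 / 2 ≤ p τ (W m)) ∨ ∃ σ ∈ Sg p f ε1 (y m).1, c0 / (2 * lam) ≤ p σ (d m) := by
    intro m
    obtain ⟨τ, hτ⟩ := hE1 (d m) (hdE m)
    rw [hdA, mul_one] at hτ
    by_cases h : c0 / 2 ≤ p τ (W m)
    · exact Or.inl ⟨τ, h⟩
    · have h1 := hsplit m τ
      rcases hKle m τ with h2 | ⟨σ, hσ, h2⟩
      · rw [h2] at h1; linarith
      · refine Or.inr ⟨σ, hσ, ?_⟩
        rw [div_le_iff₀ (by positivity)]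
        linarith
  set sW := (Finset.range M0).filter fun m => ∃ τ, c0 / 2 ≤ p τ (W m) with hsW
  set sK := (Finset.range M0).filter fun m => ∃ σ ∈ Sg p f ε1 (y m).1, c0 / (2 * lam) ≤ p σ (d m)
    with hsK
  have hcard : M0 ≤ sW.card + sK.card := by
    calc M0 = (Finset.range M0).card := (Finset.card_range _).symm
      _ ≤ (sW ∪ sK).card := Finset.card_le_card fun m hm => by
        rw [Finset.mem_union, hsW, hsK, Finset.mem_filter, Finset.mem_filter]
        exact (htype m).imp (fun h => ⟨hm, h⟩) fun h => ⟨hm, h⟩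
      _ ≤ _ := Finset.card_union_le _ _
  have hKcard : sK.card ≤ N := by
    choose! σ hσ1 hσ2 using fun m (hm : ∃ σ ∈ Sg p f ε1 (y m).1, c0 / (2 * lam) ≤ p σ (d m)) => hm
    refine hN x hxA ℕ sK (fun m => ⟨σ m, GG (i m) ∪ ∅, Q m,
      (dc_GG _).union (fun _ _ _ h => h), hQd m⟩) ?_ ?_
    · intro a ha b hb hab t ht t' ht' htt
      rw [hsK, Finset.mem_filter, Finset.mem_range] at ha hb
      refine ht.2.2 (Or.inl ?_)
      exact hcommon a ha.1 b hb.1 hab (σ a) (hσ1 a ha.2) (σ b) (hσ1 b hb.2) t ht.1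
        (ht'.1.of_suffix htt) a ha.1
    · intro m hm
      rw [hsK, Finset.mem_filter, Finset.mem_range] at hm
      rw [Itv.q_apply]
      show _ ≤ p (σ m) (rr nd (Q m \ (GG (i m) ∪ ∅)) x)
      rw [hrest m hm.1 ∅]
      have e : rr nd (∅ : Set (List ℕ))ᶜ (d m) = d m := by
        ext c
        rw [rr_pos]
        simp
      rw [e]
      refine le_trans ?_ (hσ2 m hm.2)
      gcongr
      linarith
  have hWcard : sW.card ≤ N := by
    choose! τ hτ using fun m (hm : ∃ τ, c0 / 2 ≤ p τ (W m)) => hm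
    set L : ℕ → Set (List ℕ) := fun m => {t | ∃ m' ∈ sW, m' ≠ m ∧ On (τ m') t} with hL
    have hLd : ∀ m, DC (L m) := fun m s t hst ⟨m', h1, h2, h3⟩ => ⟨m', h1, h2, h3.of_suffix hst⟩
    refine hN x hxA ℕ sW (fun m => ⟨τ m, GG (i m) ∪ (K m ∪ L m), Q m,
      (dc_GG _).union ((hKd m).union (hLd m)), hQd m⟩) ?_ ?_
    · intro a ha b hb hab t ht t' ht' htt
      refine ht.2.2 (Or.inr (Or.inr ⟨b, hb, hab.symm, ht'.1.of_suffix htt⟩))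
    · intro m hm
      have hm' := hm
      rw [hsW, Finset.mem_filter, Finset.mem_range] at hm'
      rw [Itv.q_apply]
      show _ ≤ p (τ m) (rr nd (Q m \ (GG (i m) ∪ (K m ∪ L m))) x)
      rw [hrest m hm'.1, Set.compl_union, Set.inter_comm, ← rr_rr]
      show _ ≤ p (τ m) (rr nd (L m)ᶜ (W m))
      have h1 := map_add_le_add (p (τ m)) (rr nd (L m) (W m)) (rr nd (L m)ᶜ (W m))
      rw [rr_add_compl] at h1
      have h2 := hτ m hm'.2
      have h3 : p (τ m) (rr nd (L m) (W m)) ≤ c0 / 4 := by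
        rcases H.dc' (τ m) (hLd m) (W m) with h | ⟨n, ⟨m', hm1, hm2, hm3⟩, h⟩
        · rw [h]; positivity
        · rw [On, res_len] at hm3
          refine (h (τ m') hm3.symm).trans (le_trans ?_ hεc)
          refine mul_le_mul_of_nonneg_left ?_ hl.le
          rw [hsW, Finset.mem_filter, Finset.mem_range] at hm1
          by_contra hlt
          push Not at hlt
          exact hred m hm'.1 m' hm1.1 (Ne.symm hm2) (τ m') ⟨hlt.le, by linarith [hτ m' hm1.2]⟩
      have h4 : c0 / (4 * lam) ≤ c0 / 4 := by
        gcongr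
        linarith
      linarith
  omega

/-- The amalgamation theorem. -/
theorem AMN.not_embeds (H : TreeSN I nd p lam) (M : AMN nd p lam A) {X : Type*}
    [NormedAddCommGroup X] [NormedSpace ℝ X] [CompleteSpace X] (hmin : IsMinimal X)
    (hXl1 : ¬ Embeds EllOne X) (hp : ∀ σ, ¬ Embeds X (Cmp (p σ))) : ¬ Embeds X (Cmp A) := by
  rintro ⟨T, c, hc, hT⟩
  by_cases h : ∀ ε > 0, ∃ (x : X) (e : I →₀ ℝ), ‖x‖ = 1 ∧ ‖T x - toCmp A e‖ < ε ∧ ∀ σ, p σ e < ε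
  · exact hXl1 (M.case2 T hc hT h)
  · push Not at h
    obtain ⟨ε0, hε0, h1⟩ := h
    obtain ⟨E, c0, hc0, hE1, hE2⟩ := M.block3 H T hmin hc hT hε0 h1 hp
    exact M.contra H E hc0 hE1 hE2

theorem AMN.embeds (H : TreeSN I nd p lam) (M : AMN nd p lam A) (τ : ℕ → ℕ) :
    Embeds (Cmp (p τ)) (Cmp A) := by
  have hl := H.lam_pos
  have h1 : ∀ v, p τ (rr nd {t | On τ t} v) = p τ v := fun v => H.congr τ fun c hc =>
    rr_pos (show nd c ∈ {t | On τ t} from hc) v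
  obtain ⟨F, hF1, hF2, hF3⟩ := exists_liftCmp (p τ) (toCmp A ∘ₗ rr nd {t | On τ t}) (4 * lam ^ 2)
    (fun v => by
      rw [LinearMap.comp_apply, norm_toCmp, ← h1 v]
      exact M.on τ _ fun c hc => by
        by_contra h
        exact hc (rr_neg (show nd c ∉ {t | On τ t} from h) v))
  refine ⟨F, 1, one_pos, hF3 1 fun v => ?_⟩
  rw [LinearMap.comp_apply, norm_toCmp, one_mul, ← h1 v]
  exact M.le τ _

end

open Filter Topology MeasureTheory

noncomputable section

theorem separable_Cmp {I : Type*} [Countable I] (p : Seminorm ℝ (I →₀ ℝ)) :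
    TopologicalSpace.SeparableSpace (Cmp p) := by
  have h1 : TopologicalSpace.IsSeparable (Set.range (toCmp p)) := by
    have h2 : TopologicalSpace.IsSeparable
        (Submodule.span ℝ (Set.range fun i : I => toCmp p (Finsupp.single i 1)) : Set (Cmp p)) :=
      (Set.countable_range _).isSeparable.span
    refine h2.mono ?_
    rintro _ ⟨v, rfl⟩
    have : v = v.sum fun i a => a • Finsupp.single i 1 := by
      conv_lhs => rw [← Finsupp.sum_single v]
      simp
    rw [SetLike.mem_coe, this, Finsupp.sum, map_sum]
    exact Submodule.sum_mem _ fun i _ => by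
      rw [map_smul]
      exact Submodule.smul_mem _ _ (Submodule.subset_span ⟨i, rfl⟩)
  have h3 := h1.closure
  rw [(denseRange_toCmp p).closure_range] at h3
  exact TopologicalSpace.isSeparable_univ_iff.1 h3

/-- A dense sequence spans densely. -/
theorem closure_span_denseRange {W : Type*} [NormedAddCommGroup W] [NormedSpace ℝ W] {z : ℕ → W}
    (hz : DenseRange z) : (Submodule.span ℝ (Set.range z)).topologicalClosure = ⊤ := by
  rw [eq_top_iff]
  intro y _
  have : y ∈ closure (Set.range z) := hz y
  exact closure_mono Submodule.subset_span this

theorem embeds_top {W : Type*} [NormedAddCommGroup W] [NormedSpace ℝ W] {V : Submodule ℝ W}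
    (hV : V = ⊤) : Embeds W V := by
  subst hV
  refine ⟨(Submodule.topEquiv (R := ℝ) (M := W)).symm.toLinearMap.mkContinuous 1 fun x => ?_, 1, one_pos, fun x => ?_⟩
  · rw [one_mul]; exact le_rfl
  · rw [one_mul]; exact le_rfl

/-- Bourgain and Pisier: every separable `X`-free space is contained in an `X`-free `𝓛_∞` space. -/
theorem exists_linfty (W : Type*) [NormedAddCommGroup W] [NormedSpace ℝ W] [CompleteSpace W]
    [TopologicalSpace.SeparableSpace W] {lam : ℝ} (hl : 1 < lam) {X : Type*} [NormedAddCommGroup X]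
    [NormedSpace ℝ X] [CompleteSpace X] (hmin : IsMinimal X) (hXl1 : ¬ Embeds EllOne X)
    (hX : ¬ Embeds X W) : ∃ Y : SB, IsLinftyPlus lam Y.1 ∧ ¬ Embeds X Y.1 ∧ Embeds W Y.1 := by
  obtain ⟨κ, hκ1, hκ2⟩ := exists_between hl
  let d := TopologicalSpace.denseSeq W
  have hd : DenseRange d := TopologicalSpace.denseRange_denseSeq W
  let z : List ℕ → W := fun s => d (s.length - 1)
  obtain ⟨st, r, hgood, hrel, hF⟩ := exists_tree hκ1.le hκ2 z
  let σ : ℕ → ℕ := fun _ => 0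
  have hz : (fun n => z (PiNat.res σ (n + 1))) = d := by
    funext n
    simp [z]
  have hseq : BPSeq lam κ d (fun n => st (PiNat.res σ n)) := by
    rw [← hz]
    exact ⟨fun n => by simpa using hgood (PiNat.res σ n), fun n => by
      simpa [PiNat.res_succ] using hrel (σ n) (PiNat.res σ n)⟩
  obtain ⟨Q, hQ⟩ := hseq.exists_lim
  have H : BPLim lam κ d (fun n => st (PiNat.res σ n)) Q := ⟨hseq, hQ⟩
  haveI := separable_Cmp (bpq Q)
  obtain ⟨Y, ⟨T⟩⟩ := exists_SB (Cmp (bpq Q))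
  refine ⟨Y, isLinftyPlus_of_isometryEquiv T (H.linfty hl.le), fun h => hX ?_, ?_⟩
  · exact (H.embeds_of_embeds hκ1 hmin hXl1 (h.trans' (embeds_of_isometryEquiv T.symm))).trans'
      (embeds_subtype _)
  · exact ((embeds_top (closure_span_denseRange hd)).trans' H.embeds_span).trans'
      (embeds_of_isometryEquiv T)

/-- The full amalgamation theorem. -/
theorem exists_amalgam {B : Type*} [NormedAddCommGroup B] [NormedSpace ℝ B] [CompleteSpace B]
    {lam : ℝ} (hl : 1 < lam) (z : List ℕ → B) {X : Type*} [NormedAddCommGroup X]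
    [NormedSpace ℝ X] [CompleteSpace X] (hmin : IsMinimal X) (hXl1 : ¬ Embeds EllOne X)
    (hX : ∀ σ : ℕ → ℕ, ¬ Embeds X
      (Submodule.span ℝ (Set.range fun n => z (PiNat.res σ (n + 1)))).topologicalClosure) :
    ∃ Y : SB, IsLinftyPlus lam Y.1 ∧ ¬ Embeds X Y.1 ∧
      ∀ σ, Embeds (Submodule.span ℝ (Set.range fun n => z (PiNat.res σ (n + 1)))).topologicalClosure
        Y.1 := by
  obtain ⟨I, hI, nd, p, H, h1, h2⟩ := exists_treeSN hl z hmin hXl1 hX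
  obtain ⟨A, M⟩ := H.exists_A
  haveI := separable_Cmp A
  obtain ⟨Y, hY1, hY2, hY3⟩ := exists_linfty (Cmp A) hl hmin hXl1 (M.not_embeds H hmin hXl1 h1)
  exact ⟨Y, hY1, hY2, fun σ => ((h2 σ).trans' (M.embeds H σ)).trans' hY3⟩

end

open Filter Topology MeasureTheory

noncomputable section

/-- The coefficient functionals of a normalized Schauder basis are uniformly bounded. -/
theorem coeff_bound {X : Type*} [NormedAddCommGroup X] [NormedSpace ℝ X] [CompleteSpace X]
    {x : ℕ → X} (hb : IsSchauderBasis x) (hn : ∀ n, ‖x n‖ = 1) :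
    ∃ C > 0, ∀ (a : ℕ →₀ ℝ) k, |a k| ≤ C * ‖lc x a‖ := by
  let ev : OnePoint ℕ → (C(OnePoint ℕ, X) →L[ℝ] X) := fun t => ContinuousMap.evalCLM ℝ t
  have hev : ∀ t f, ev t f = f t := fun t f => rfl
  let V : Submodule ℝ C(OnePoint ℕ, X) :=
    LinearMap.ker (ev ((0 : ℕ) : OnePoint ℕ)).toLinearMap ⊓
      ⨅ n : ℕ, (Submodule.span ℝ {x n}).comap
        (ev ((n + 1 : ℕ) : OnePoint ℕ) - ev (n : OnePoint ℕ)).toLinearMap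
  have hV : ∀ f, f ∈ V ↔ f ((0 : ℕ) : OnePoint ℕ) = 0 ∧ ∀ n : ℕ,
      f ((n + 1 : ℕ) : OnePoint ℕ) - f (n : OnePoint ℕ) ∈ Submodule.span ℝ {x n} := by
    intro f
    simp only [V, Submodule.mem_inf, Submodule.mem_iInf, Submodule.mem_comap, LinearMap.mem_ker]
    rfl
  have hVc : IsClosed (V : Set C(OnePoint ℕ, X)) := by
    have : (V : Set C(OnePoint ℕ, X)) = (ev ((0 : ℕ) : OnePoint ℕ)) ⁻¹' {0} ∩
      ⋂ n : ℕ, (ev ((n + 1 : ℕ) : OnePoint ℕ) - ev (n : OnePoint ℕ)) ⁻¹'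
        (Submodule.span ℝ {x n} : Set X) := by
      ext f
      rw [SetLike.mem_coe, hV]
      simp [hev]
    rw [this]
    refine (isClosed_singleton.preimage (ev _).continuous).inter (isClosed_iInter fun n =>
      IsClosed.preimage (ContinuousLinearMap.continuous _) (Submodule.closed_of_finiteDimensional _))
  haveI : CompleteSpace V := hVc.completeSpace_coe
  let Φ : V →L[ℝ] X := (ev OnePoint.infty).comp V.subtypeL
  have hsum : ∀ f ∈ V, ∃ b : ℕ → ℝ, ∀ n : ℕ, f (n : OnePoint ℕ) = ∑ i ∈ Finset.range n, b i • x i := by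
    intro f hf
    rw [hV] at hf
    choose b hb using fun n => Submodule.mem_span_singleton.1 (hf.2 n)
    refine ⟨b, fun n => ?_⟩
    induction n with
    | zero => simpa using hf.1
    | succ n ih => rw [Finset.sum_range_succ, ← ih, hb]; abel
  have hlim : ∀ f : C(OnePoint ℕ, X), Tendsto (fun n : ℕ => f (n : OnePoint ℕ)) atTop (𝓝 (f OnePoint.infty)) :=
    fun f => (OnePoint.continuous_iff_from_nat f).1 f.continuous
  have hsurj : Function.Surjective Φ := by
    intro y
    obtain ⟨a, ha, -⟩ := hb y
    let f := OnePoint.continuousMapMkNat _ y ha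
    have hf : ∀ n : ℕ, f (n : OnePoint ℕ) = ∑ i ∈ Finset.range n, a i • x i := fun n => rfl
    refine ⟨⟨f, (hV f).2 ⟨by rw [hf]; simp, fun n => ?_⟩⟩, rfl⟩
    rw [hf, hf, Finset.sum_range_succ, add_sub_cancel_left]
    exact Submodule.smul_mem _ _ (Submodule.mem_span_singleton_self _)
  obtain ⟨C, hC, h⟩ := Φ.exists_preimage_norm_le hsurj
  refine ⟨2 * C, by positivity, fun a k => ?_⟩
  obtain ⟨⟨f, hf⟩, h1, h2⟩ := h (lc x a)
  obtain ⟨b, hbf⟩ := hsum f hf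
  have h1' : f OnePoint.infty = lc x a := h1
  have hab : b = a := by
    refine (hb (lc x a)).unique ?_ ?_
    · simp_rw [← hbf, ← h1']
      exact hlim f
    · obtain ⟨N, hN⟩ := exists_bound_support a
      refine tendsto_const_nhds.congr' ?_
      filter_upwards [eventually_ge_atTop N] with n hn
      exact lc_eq_sum_range x a fun k hk => (hN k hk).trans_le hn
  have h3 : a k • x k = f ((k + 1 : ℕ) : OnePoint ℕ) - f (k : OnePoint ℕ) := by
    rw [hbf, hbf, Finset.sum_range_succ, add_sub_cancel_left, hab]
  have h2' : ‖f‖ ≤ C * ‖lc x a‖ := h2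
  calc |a k| = ‖a k • x k‖ := by rw [norm_smul, hn, mul_one, Real.norm_eq_abs]
    _ ≤ ‖f ((k + 1 : ℕ) : OnePoint ℕ)‖ + ‖f (k : OnePoint ℕ)‖ := by rw [h3]; exact norm_sub_le _ _
    _ ≤ ‖f‖ + ‖f‖ := add_le_add (f.norm_coe_le_norm _) (f.norm_coe_le_norm _)
    _ ≤ _ := by linarith

end

open Filter Topology MeasureTheory

noncomputable section

section TreeRank
variable {Λ : Type} {T : Set (List Λ)}

theorem tdi_zero : treeDerivIter T 0 = T := by
  simp [treeDerivIter]

theorem tdi_succ (o : Ordinal.{0}) : treeDerivIter T (o + 1) = treeDeriv (treeDerivIter T o) := by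
  simp only [treeDerivIter, Ordinal.limitRecOn_add_one]

theorem tdi_limit {o : Ordinal.{0}} (ho : Order.IsSuccLimit o) :
    treeDerivIter T o = ⋂ (o' : Ordinal.{0}) (_ : o' < o), treeDerivIter T o' := by
  simp only [treeDerivIter, Ordinal.limitRecOn_limit _ _ _ _ ho]

theorem tdi_anti (η : Ordinal.{0}) : ∀ η' ≤ η, treeDerivIter T η ⊆ treeDerivIter T η' := by
  induction η using Ordinal.limitRecOn with
  | zero =>
    intro η' h
    have : η' = 0 := by simpa using h
    rw [this]
  | add_one o ih =>
    intro η' h l hl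
    rcases h.lt_or_eq with h | h
    · rw [tdi_succ] at hl
      exact ih η' (Order.lt_add_one_iff.1 h) hl.1
    · rw [h]; exact hl
  | limit o ho ih =>
    intro η' h l hl
    rcases h.lt_or_eq with h | h
    · rw [tdi_limit ho] at hl
      exact Set.mem_iInter₂.1 hl η' h
    · rw [h]; exact hl

theorem tdi_mem (hT : IsTree T) {l : List Λ} {a : Λ} (h0 : l ++ [a] ∈ T) (η : Ordinal.{0})
    (h : ∀ η' < η, l ++ [a] ∈ treeDerivIter T η') : l ∈ treeDerivIter T η := by
  have hT' : l ∈ T := hT l _ (List.prefix_append _ _) h0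
  induction η using Ordinal.limitRecOn with
  | zero => rwa [tdi_zero]
  | add_one o ih =>
    rw [tdi_succ]
    refine ⟨ih fun η' h' => h η' (h'.trans (Order.lt_add_one_iff.2 le_rfl)), a,
      h o (Order.lt_add_one_iff.2 le_rfl)⟩
  | limit o ho ih =>
    rw [tdi_limit ho]
    refine Set.mem_iInter₂.2 fun o' ho' => ih o' ho' fun η' h' => h η' (h'.trans ho')

theorem illFounded_of_pruned (hT : IsTree T) {P : Set (List Λ)} (hP : P ⊆ T) (hne : P.Nonempty)
    (hp : IsPruned P) : TreeIllFounded T := by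
  obtain ⟨t0, ht0⟩ := hne
  choose nx hnx using fun l : P => hp l.1 l.2
  let L : ℕ → P := fun n => Nat.rec ⟨t0, ht0⟩ (fun _ l => ⟨l.1 ++ [nx l], hnx l⟩) n
  have hL : ∀ n, (L (n + 1)).1 = (L n).1 ++ [nx (L n)] := fun n => rfl
  have hlen : ∀ n, n ≤ (L n).1.length := by
    intro n
    induction n with
    | zero => simp
    | succ n ih => rw [hL]; simp; exact ih
  have hpre : ∀ m n, m ≤ n → (L m).1 <+: (L n).1 := by
    intro m n h
    induction n, h using Nat.le_induction with
    | base => exact List.prefix_rfl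
    | succ n h ih => rw [hL]; exact ih.trans (List.prefix_append _ _)
  refine ⟨fun i => (L (i + 1)).1[i]'(hlen (i + 1)), fun n => ?_⟩
  have : (List.ofFn fun i : Fin n => (L (i + 1)).1[(i : ℕ)]'(hlen (i + 1))) = (L n).1.take n := by
    refine List.ext_getElem (by simp [hlen n]) fun i h1 h2 => ?_
    simp only [List.length_ofFn] at h1
    simp only [List.getElem_ofFn, List.getElem_take]
    exact (hpre (i + 1) n h1).getElem _
  rw [this]
  exact hT _ _ (List.take_prefix _ _) (hP (L n).2)

theorem exists_tdi_empty (hT : IsTree T) (h : ¬ TreeIllFounded T) :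
    {ξ : Ordinal.{0} | treeDerivIter T ξ = ∅}.Nonempty := by
  have h1 := not_injective_of_ordinal (fun ξ : Ordinal.{0} => treeDerivIter T ξ)
  rw [Function.Injective] at h1
  push Not at h1
  obtain ⟨a, b, hab, hne⟩ := h1
  wlog hlt : a < b generalizing a b
  · exact this b a hab.symm hne.symm (lt_of_le_of_ne (not_lt.1 hlt) hne.symm)
  refine ⟨a, ?_⟩
  by_contra hE
  refine h (illFounded_of_pruned hT (P := treeDerivIter T a) ?_ (Set.nonempty_iff_ne_empty.2 hE) ?_)
  · have := tdi_anti (T := T) a 0 (by simp)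
    rwa [tdi_zero] at this
  · intro t ht
    have hab' : treeDerivIter T a = treeDerivIter T b := hab
    rw [hab'] at ht
    have := tdi_anti (T := T) b (a + 1) (Order.add_one_le_iff.2 hlt) ht
    rw [tdi_succ] at this
    exact this.2

/-- A rank function. -/
theorem exists_rank (hT : IsTree T) (h : ¬ TreeIllFounded T) {ξ : Ordinal.{0}}
    (hξ : treeRank T ≤ ξ) : ∃ ρ : List Λ → Set.Iic ξ, ∀ l a, l ++ [a] ∈ T → ρ (l ++ [a]) < ρ l := by
  have h1 : treeDerivIter T (treeRank T) = ∅ := csInf_mem (exists_tdi_empty hT h)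
  have h2 : ∀ l, l ∉ treeDerivIter T ξ := fun l hl => by
    have := tdi_anti ξ _ hξ hl
    rw [h1] at this
    exact this
  let R : List Λ → Ordinal.{0} := fun l => sInf {η | l ∉ treeDerivIter T η}
  have hR : ∀ l, R l ∈ {η | l ∉ treeDerivIter T η} := fun l => csInf_mem ⟨ξ, h2 l⟩
  refine ⟨fun l => ⟨R l, (csInf_le' (show ξ ∈ {η | l ∉ treeDerivIter T η} from h2 l) : R l ≤ ξ)⟩, fun l a hl => ?_⟩
  show R (l ++ [a]) < R l
  have h3 : l ∈ treeDerivIter T (R (l ++ [a])) := tdi_mem hT hl _ fun η' h' => by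
    by_contra h4
    exact absurd (csInf_le' (s := {η | l ++ [a] ∉ treeDerivIter T η}) h4) (not_le.2 h')
  by_contra h4
  exact hR l (tdi_anti _ _ (not_lt.1 h4) h3)

end TreeRank

theorem isTree_bourgain {W : Type*} [SeminormedAddCommGroup W] [NormedSpace ℝ W] (e : ℕ → W)
    (δ : ℝ) (Y : Type*) [SeminormedAddCommGroup Y] [NormedSpace ℝ Y] : IsTree (bourgainTree e δ Y) := by
  intro s t hst ht a
  have h := ht fun i => if i < s.length then a i else 0
  have hl := hst.length_le
  have key : ∀ {U : Type _} [AddCommGroup U] [Module ℝ U] (f g : ℕ → U), (∀ i < s.length, f i = g i) →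
      ∑ i ∈ Finset.range t.length, (if i < s.length then a i else 0) • f i =
        ∑ i ∈ Finset.range s.length, a i • g i := by
    intro U _ _ f g hfg
    rw [← Finset.sum_subset (Finset.range_subset_range.2 hl)]
    · exact Finset.sum_congr rfl fun i hi => by
        rw [if_pos (Finset.mem_range.1 hi), hfg i (Finset.mem_range.1 hi)]
    · intro i _ hi
      rw [if_neg (by simpa using hi), zero_smul]
  have key2 : ∀ {U : Type _} [AddCommGroup U] [Module ℝ U] (f g : ℕ → U), (∀ i < s.length, f i = g i) →
      ∑ i ∈ Finset.range t.length, (if i < s.length then a i else 0) • f i =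
        ∑ i ∈ Finset.range s.length, a i • g i := by
    intro U _ _ f g hfg
    rw [← Finset.sum_subset (Finset.range_subset_range.2 hl)]
    · exact Finset.sum_congr rfl fun i hi => by
        rw [if_pos (Finset.mem_range.1 hi), hfg i (Finset.mem_range.1 hi)]
    · intro i _ hi
      rw [if_neg (by simpa using hi), zero_smul]
  rw [key e e (fun _ _ => rfl), key2 (fun i => t.getD i 0) (fun i => s.getD i 0) (fun i hi => ?_)] at h
  · exact h
  · obtain ⟨u, rfl⟩ := hst
    exact List.getD_append _ _ _ _ hi

theorem exists_rank_of_index {X : Type*} [NormedAddCommGroup X] [NormedSpace ℝ X] {x : ℕ → X}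
    {Z : Type} [NormedAddCommGroup Z] [NormedSpace ℝ Z] {ξ : Ordinal.{0}} (hξ : ξ < omega1)
    (h : bourgainIndex x Z ≤ ξ) {δ : ℝ} (hδ : δ ∈ Set.Ioc (0 : ℝ) 1) :
    ∃ ρ : List Z → Set.Iic ξ, ∀ l a, l ++ [a] ∈ bourgainTree x δ Z → ρ (l ++ [a]) < ρ l := by
  unfold bourgainIndex at h
  split_ifs at h with h1
  · exact absurd h (not_le.2 hξ)
  · refine exists_rank (isTree_bourgain x δ Z) (fun h2 => h1 ⟨δ, hδ, h2⟩) (le_trans ?_ h)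
    exact Ordinal.le_iSup (fun δ : Set.Ioc (0:ℝ) 1 => treeRank (bourgainTree x δ.1 Z)) ⟨δ, hδ⟩

end

open Filter Topology MeasureTheory

noncomputable section

theorem exists_functional {Z : Type*} [NormedAddCommGroup Z] [NormedSpace ℝ Z] (p : Submodule ℝ Z)
    [FiniteDimensional ℝ p] {u : Z} (hu : u ∉ p) : ∃ f : Z →L[ℝ] ℝ, f u = 1 ∧ ∀ y ∈ p, f y = 0 := by
  haveI : IsClosed (p : Set Z) := Submodule.closed_of_finiteDimensional p
  have h1 : p.mkQL u ≠ 0 := fun h => hu ((Submodule.Quotient.mk_eq_zero p).1 h)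
  obtain ⟨g, hg⟩ := SeparatingDual.exists_eq_one (R := ℝ) h1
  refine ⟨g.comp p.mkQL, hg, fun y hy => ?_⟩
  have : p.mkQL y = 0 := (Submodule.Quotient.mk_eq_zero p).2 hy
  rw [ContinuousLinearMap.comp_apply, this, map_zero]

theorem exists_biorth (Z : Type*) [NormedAddCommGroup Z] [NormedSpace ℝ Z] (d : ℕ → Z) :
    ∃ (e : ℕ → Z) (f : ℕ → Z →L[ℝ] ℝ), (∀ n, d n ∈ Submodule.span ℝ (Set.range e)) ∧
      (∀ m n, m ≠ n → f m (e n) = 0) ∧ ∀ n, (e n = 0 ∧ f n = 0) ∨ f n (e n) = 1 := by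
  let bio : ℕ → (ℕ → Z × (Z →L[ℝ] ℝ)) → Prop := fun n F =>
    (∀ i < n, ∀ j < n, i ≠ j → (F i).2 (F j).1 = 0) ∧ ∀ i < n, F i = 0 ∨ (F i).2 (F i).1 = 1
  obtain ⟨F, hF⟩ := exists_seq_strong (α := Z × (Z →L[ℝ] ℝ)) (fun n F p => bio n F →
    d n ∈ Submodule.span ℝ (insert p.1 ((fun i => (F i).1) '' Set.Iio n)) ∧ (∀ k < n, (F k).2 p.1 = 0) ∧
      (∀ k < n, p.2 (F k).1 = 0) ∧ (p = 0 ∨ p.2 p.1 = 1)) (by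
    intro n F
    by_cases hb : bio n F
    swap
    · exact ⟨0, fun h => absurd h hb⟩
    set u := d n - ∑ i ∈ Finset.range n, (F i).2 (d n) • (F i).1 with hu
    set p := Submodule.span ℝ ((fun i => (F i).1) '' Set.Iio n) with hp
    have hmem : ∀ k < n, (F k).1 ∈ p := fun k hk => Submodule.subset_span ⟨k, hk, rfl⟩
    have hsum : ∑ i ∈ Finset.range n, (F i).2 (d n) • (F i).1 ∈ p :=
      Submodule.sum_mem _ fun i hi => p.smul_mem _ (hmem i (Finset.mem_range.1 hi))
    have hfu : ∀ y : Z, ∀ k < n, (F k).2 (y - ∑ i ∈ Finset.range n, (F i).2 y • (F i).1) = 0 := by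
      intro y k hk
      rw [map_sub, map_sum, Finset.sum_eq_single k]
      · rcases hb.2 k hk with h | h
        · rw [h]; simp
        · rw [map_smul, h]; simp
      · intro j hj hjk
        rw [map_smul, hb.1 k hk j (Finset.mem_range.1 hj) hjk.symm, smul_zero]
      · intro h; exact absurd (Finset.mem_range.2 hk) h
    by_cases hup : u ∈ p
    · refine ⟨0, fun _ => ⟨?_, by simp, by simp, Or.inl rfl⟩⟩
      have : d n ∈ p := by
        have := p.add_mem hup hsum
        rwa [hu, sub_add_cancel] at this
      exact Submodule.span_mono (Set.subset_insert _ _) this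
    · haveI : FiniteDimensional ℝ p := FiniteDimensional.span_of_finite ℝ ((Set.finite_Iio n).image _)
      obtain ⟨f, hf1, hf2⟩ := exists_functional p hup
      refine ⟨(u, f), fun _ => ⟨?_, fun k hk => hfu _ k hk, fun k hk => hf2 _ (hmem k hk), Or.inr hf1⟩⟩
      have : d n = u + ∑ i ∈ Finset.range n, (F i).2 (d n) • (F i).1 := by rw [hu, sub_add_cancel]
      rw [this]
      exact Submodule.add_mem _ (Submodule.subset_span (Set.mem_insert _ _))
        (Submodule.span_mono (Set.subset_insert _ _) hsum))
  have hbio : ∀ n, bio n F := by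
    intro n
    induction n with
    | zero => exact ⟨by simp, by simp⟩
    | succ n ih =>
      obtain ⟨F', hF', h⟩ := hF n
      have hb' : bio n F' := ⟨fun i hi j hj => by rw [hF' i hi, hF' j hj]; exact ih.1 i hi j hj,
        fun i hi => by rw [hF' i hi]; exact ih.2 i hi⟩
      obtain ⟨_, h2, h3, h4⟩ := h hb'
      refine ⟨fun i hi j hj hij => ?_, fun i hi => ?_⟩
      · rcases Nat.lt_succ_iff_lt_or_eq.1 hi with hi | hi <;> rcases Nat.lt_succ_iff_lt_or_eq.1 hj with hj | hj
        · exact ih.1 i hi j hj hij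
        · rw [hj, ← hF' i hi]; exact h2 i hi
        · rw [hi, ← hF' j hj]; exact h3 j hj
        · omega
      · rcases Nat.lt_succ_iff_lt_or_eq.1 hi with hi | hi
        · exact ih.2 i hi
        · rw [hi]; exact h4
  refine ⟨fun n => (F n).1, fun n => (F n).2, fun n => ?_, fun m n hmn => ?_, fun n => ?_⟩
  · obtain ⟨F', hF', h⟩ := hF n
    have ih := hbio n
    have hb' : bio n F' := ⟨fun i hi j hj => by rw [hF' i hi, hF' j hj]; exact ih.1 i hi j hj,
        fun i hi => by rw [hF' i hi]; exact ih.2 i hi⟩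
    refine Submodule.span_mono ?_ (h hb').1
    rintro y (rfl | ⟨i, hi, rfl⟩)
    · exact ⟨n, rfl⟩
    · exact ⟨i, by show (F i).1 = (F' i).1; rw [hF' i hi]⟩
  · exact (hbio (max m n + 1)).1 m (by omega) n (by omega) hmn
  · rcases (hbio (n + 1)).2 n (by omega) with h | h
    · left
      show (F n).1 = 0 ∧ (F n).2 = 0
      rw [h]; exact ⟨rfl, rfl⟩
    · exact Or.inr h

/-- Perturbation into a dense sequence. -/
theorem exists_pert {Z B : Type*} [NormedAddCommGroup Z] [NormedSpace ℝ Z]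
    [TopologicalSpace.SeparableSpace Z] [NormedAddCommGroup B] [NormedSpace ℝ B] [CompleteSpace B]
    (J : Z →ₗᵢ[ℝ] B) (d : ℕ → B) (hd : DenseRange d) (hd0 : d 0 = 0) :
    ∃ (e : ℕ → Z) (k : ℕ → ℕ) (S : Z →L[ℝ] B), (∀ n, S (e n) = d (k n)) ∧
      (∀ y, 1 / 2 * ‖y‖ ≤ ‖S y‖) ∧ (∀ y, ‖S y‖ ≤ 2 * ‖y‖) ∧
      (Submodule.span ℝ (Set.range e)).topologicalClosure = ⊤ := by
  obtain ⟨e, f, h1, h2, h3⟩ := exists_biorth Z (TopologicalSpace.denseSeq Z)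
  have hk : ∀ n, ∃ k, ‖f n‖ * ‖d k - J (e n)‖ ≤ 1 / 4 * (1 / 2) ^ n ∧ (e n = 0 → d k = 0) := by
    intro n
    by_cases he : e n = 0
    · exact ⟨0, by rw [hd0, he]; simp, fun _ => hd0⟩
    · obtain ⟨k, hk⟩ := hd.exists_dist_lt (J (e n))
        (show 0 < 1 / 4 * (1 / 2 : ℝ) ^ n / (‖f n‖ + 1) by positivity)
      refine ⟨k, ?_, fun h => absurd h he⟩
      rw [dist_comm, dist_eq_norm, lt_div_iff₀ (by positivity)] at hk
      nlinarith [norm_nonneg (d k - J (e n))]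
  choose k hk hk0 using hk
  let g : ℕ → Z →L[ℝ] B := fun n => (f n).smulRight (d (k n) - J (e n))
  have hg : ∀ n, ‖g n‖ ≤ 1 / 4 * (1 / 2) ^ n := fun n => by
    rw [ContinuousLinearMap.norm_smulRight_apply]; exact hk n
  have hs : HasSum (fun n : ℕ => 1 / 4 * (1 / 2 : ℝ) ^ n) (1 / 2) := by
    convert! hasSum_geometric_two.mul_left (1 / 4 : ℝ) using 1
    norm_num
  have hgs : Summable g := Summable.of_norm_bounded hs.summable hg
  obtain ⟨G, hGs⟩ : ∃ G, HasSum g G := hgs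
  have hG : ‖G‖ ≤ 1 / 2 := by
    rw [← hGs.tsum_eq]
    exact tsum_of_norm_bounded hs hg
  have hGe : ∀ n, G (e n) = f n (e n) • (d (k n) - J (e n)) := by
    intro n
    have := (ContinuousLinearMap.apply ℝ B (e n)).hasSum hGs
    simp only [ContinuousLinearMap.apply_apply] at this
    have h5 : HasSum (fun m => g m (e n)) (g n (e n)) := hasSum_single n fun m hm => by
      show f m (e n) • (d (k m) - J (e m)) = 0
      rw [h2 m n hm, zero_smul]
    exact this.unique h5
  have hGn : ∀ y, ‖G y‖ ≤ 1 / 2 * ‖y‖ := fun y => G.le_of_opNorm_le hG y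
  refine ⟨e, k, J.toContinuousLinearMap + G, fun n => ?_, fun y => ?_, fun y => ?_, ?_⟩
  · show J (e n) + G (e n) = _
    rw [hGe]
    rcases h3 n with ⟨h, h'⟩ | h
    · rw [h, h', hk0 n h]; simp
    · rw [h]; simp
  · show _ ≤ ‖J y + G y‖
    have := norm_sub_le (J y + G y) (G y)
    rw [add_sub_cancel_right, J.norm_map] at this
    linarith [hGn y]
  · show ‖J y + G y‖ ≤ _
    have := norm_add_le (J y) (G y)
    rw [J.norm_map] at this
    linarith [hGn y, norm_nonneg y]
  · rw [eq_top_iff, ← closure_span_denseRange (TopologicalSpace.denseRange_denseSeq Z)]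
    refine Submodule.topologicalClosure_mono (Submodule.span_le.2 ?_)
    rintro _ ⟨n, rfl⟩
    exact h1 n

theorem embeds_span_of_pert {Z B : Type*} [NormedAddCommGroup Z] [NormedSpace ℝ Z]
    [NormedAddCommGroup B] [NormedSpace ℝ B] {e : ℕ → Z} {v : ℕ → B} {S : Z →L[ℝ] B}
    (hS : ∀ n, S (e n) = v n) (h1 : ∀ y, 1 / 2 * ‖y‖ ≤ ‖S y‖)
    (h2 : (Submodule.span ℝ (Set.range e)).topologicalClosure = ⊤) :
    Embeds Z (Submodule.span ℝ (Set.range v)).topologicalClosure := by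
  refine ⟨S.codRestrict _ fun y => ?_, 1 / 2, by norm_num, h1⟩
  have h3 : (Submodule.span ℝ (Set.range e)) ≤
      ((Submodule.span ℝ (Set.range v)).topologicalClosure).comap S.toLinearMap := by
    refine Submodule.span_le.2 ?_
    rintro _ ⟨n, rfl⟩
    show S (e n) ∈ (Submodule.span ℝ (Set.range v)).topologicalClosure
    rw [hS]
    exact Submodule.le_topologicalClosure _ (Submodule.subset_span ⟨n, rfl⟩)
  have h4 := Submodule.topologicalClosure_minimal _ h3
    ((Submodule.isClosed_topologicalClosure _).preimage S.continuous)
  rw [h2] at h4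
  exact h4 trivial

end

open Filter Topology MeasureTheory

noncomputable section

section Codes
variable {V : Type*} [NormedAddCommGroup V] [NormedSpace ℝ V]

/-- Rational combinations. -/
def qev (v : ℕ → V) (q : List ℚ) : V := ∑ i ∈ Finset.range q.length, (q.getD i 0 : ℝ) • v i

theorem qev_congr {v w : ℕ → V} {q : List ℚ} (h : ∀ i < q.length, v i = w i) : qev v q = qev w q :=
  Finset.sum_congr rfl fun i hi => by rw [h i (Finset.mem_range.1 hi)]

theorem qev_map {W : Type*} [NormedAddCommGroup W] [NormedSpace ℝ W] (S : V →L[ℝ] W) (v : ℕ → V)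
    (q : List ℚ) : S (qev v q) = qev (fun n => S (v n)) q := by
  simp [qev, map_sum]

theorem exists_qev (v : ℕ → V) {y : V} (hy : y ∈ (Submodule.span ℝ (Set.range v)).topologicalClosure)
    {ε : ℝ} (hε : 0 < ε) : ∃ q, ‖qev v q - y‖ ≤ ε := by
  have hy' : y ∈ closure (Submodule.span ℝ (Set.range v) : Set V) := hy
  obtain ⟨y', hy1, hy2⟩ := Metric.mem_closure_iff.1 hy' (ε / 2) (by positivity)
  obtain ⟨b, rfl⟩ := (Finsupp.mem_span_range_iff_exists_finsupp).1 hy1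
  obtain ⟨N, hN⟩ := exists_bound_support b
  have hr : ∀ i, ∃ r : ℚ, |(r : ℝ) - b i| * ‖v i‖ ≤ ε / 2 / (N + 1) := by
    intro i
    obtain ⟨r, hr1, hr2⟩ := exists_rat_btwn
      (show b i < b i + ε / 2 / (N + 1) / (‖v i‖ + 1) by
        have : 0 < ε / 2 / (N + 1) / (‖v i‖ + 1) := by positivity
        linarith)
    refine ⟨r, ?_⟩
    have h1 : |(r : ℝ) - b i| ≤ ε / 2 / (N + 1) / (‖v i‖ + 1) := by
      rw [abs_of_nonneg (by linarith)]; linarith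
    rw [le_div_iff₀ (by positivity)] at h1
    nlinarith [abs_nonneg ((r : ℝ) - b i)]
  choose r hr using hr
  refine ⟨(List.range N).map r, ?_⟩
  have h1 : qev v ((List.range N).map r) = ∑ i ∈ Finset.range N, (r i : ℝ) • v i := by
    unfold qev
    rw [List.length_map, List.length_range]
    refine Finset.sum_congr rfl fun i hi => ?_
    have := Finset.mem_range.1 hi
    rw [List.getD_eq_getElem _ _ (by simpa using this)]
    simp
  have h2 : (b.sum fun i a => a • v i) = ∑ i ∈ Finset.range N, b i • v i := lc_eq_sum_range v b hN
  have h3 : ‖qev v ((List.range N).map r) - b.sum fun i a => a • v i‖ ≤ ε / 2 := by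
    rw [h1, h2, ← Finset.sum_sub_distrib]
    refine (norm_sum_le _ _).trans ?_
    calc ∑ i ∈ Finset.range N, ‖(r i : ℝ) • v i - b i • v i‖
        ≤ ∑ i ∈ Finset.range N, ε / 2 / (N + 1) := Finset.sum_le_sum fun i _ => by
          rw [← sub_smul, norm_smul, Real.norm_eq_abs]; exact hr i
      _ = N * (ε / 2 / (N + 1)) := by simp
      _ ≤ ε / 2 := by
          rw [mul_div_assoc', div_le_iff₀ (by positivity)]
          nlinarith
  have h4 := norm_sub_le_norm_sub_add_norm_sub (qev v ((List.range N).map r))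
    (b.sum fun i a => a • v i) y
  rw [dist_eq_norm, norm_sub_rev] at hy2
  linarith

end Codes

theorem tree_pull {X Z B : Type*} [NormedAddCommGroup X] [NormedSpace ℝ X] [NormedAddCommGroup Z]
    [NormedSpace ℝ Z] [NormedAddCommGroup B] [NormedSpace ℝ B] (x : ℕ → X) {S : Z →L[ℝ] B}
    (h1 : ∀ y, 1 / 2 * ‖y‖ ≤ ‖S y‖) (h2 : ∀ y, ‖S y‖ ≤ 2 * ‖y‖) {δ : ℝ} {L : List Z}
    (hL : L.map S ∈ bourgainTree x δ B) : L ∈ bourgainTree x (δ / 2) Z := by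
  intro a
  have h := hL a
  rw [List.length_map] at h
  have e : ∑ i ∈ Finset.range L.length, a i • (L.map S).getD i 0 =
      S (∑ i ∈ Finset.range L.length, a i • L.getD i 0) := by
    rw [map_sum]
    refine Finset.sum_congr rfl fun i hi => ?_
    have := Finset.mem_range.1 hi
    rw [map_smul, List.getD_eq_getElem _ _ (by simpa using this), List.getD_eq_getElem _ _ this]
    simp
  rw [e] at h
  refine ⟨by linarith [h.1, h2 (∑ i ∈ Finset.range L.length, a i • L.getD i 0)], ?_⟩
  have h3 := h1 (∑ i ∈ Finset.range L.length, a i • L.getD i 0)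
  have h4 : (δ / 2)⁻¹ = 2 * δ⁻¹ := by rw [inv_div, div_eq_mul_inv]
  rw [h4, mul_assoc]
  linarith [h.2]

theorem mem_tree {X B : Type*} [NormedAddCommGroup X] [NormedSpace ℝ X]
    [NormedAddCommGroup B] [NormedSpace ℝ B] (x : ℕ → X) (w : ℕ → B) {δ : ℝ}
    (h1 : ∀ a, δ * ‖lc x a‖ ≤ ‖lc w a‖) (h2 : ∀ a, ‖lc w a‖ ≤ δ⁻¹ * ‖lc x a‖) (k : ℕ) :
    (List.range k).map w ∈ bourgainTree x δ B := by
  intro a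
  rw [List.length_map, List.length_range]
  let A : ℕ →₀ ℝ := ∑ i ∈ Finset.range k, Finsupp.single i (a i)
  have hA : ∀ {U : Type _} [AddCommGroup U] [Module ℝ U] (u : ℕ → U),
      lc u A = ∑ i ∈ Finset.range k, a i • u i := fun u => by simp [A, map_sum]
  have hA' : ∀ {U : Type _} [AddCommGroup U] [Module ℝ U] (u : ℕ → U),
      lc u A = ∑ i ∈ Finset.range k, a i • u i := fun u => by simp [A, map_sum]
  have e : ∑ i ∈ Finset.range k, a i • ((List.range k).map w).getD i 0 =
      ∑ i ∈ Finset.range k, a i • w i := by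
    refine Finset.sum_congr rfl fun i hi => ?_
    have := Finset.mem_range.1 hi
    rw [List.getD_eq_getElem _ _ (by simpa using this)]
    simp
  rw [e, ← hA x, ← hA' w]
  exact ⟨h1 A, h2 A⟩

/-- A sequence spanning a copy of `X` produces an infinite branch of codes. -/
theorem codes_of_embeds {X B : Type*} [NormedAddCommGroup X] [NormedSpace ℝ X] [CompleteSpace X]
    [NormedAddCommGroup B] [NormedSpace ℝ B] {x : ℕ → X} (hb : IsSchauderBasis x)
    (hn : ∀ n, ‖x n‖ = 1) (v : ℕ → B)
    (hX : Embeds X (Submodule.span ℝ (Set.range v)).topologicalClosure) :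
    ∃ (m : ℕ) (q : ℕ → List ℚ), ∀ k,
      ((List.range k).map q).map (qev v) ∈ bourgainTree x (1 / (m + 1)) B := by
  obtain ⟨C, hC, hCb⟩ := coeff_bound hb hn
  obtain ⟨T, c, hc, hT⟩ := hX
  choose q hq using fun n => exists_qev v (T (x n)).2
    (show 0 < c / (4 * C) * (1 / 4 : ℝ) ^ n by positivity)
  let w : ℕ → B := fun n => qev v (q n) - T (x n)
  have hw : ∀ a, ‖lc w a‖ ≤ c / 2 * ‖lc x a‖ := fun a => by
    have e : lc (fun n => C • x n) a = C • lc x a := by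
      rw [Finsupp.linearCombination_apply, Finsupp.linearCombination_apply, Finsupp.smul_sum]
      exact Finsupp.sum_congr fun i _ => smul_comm _ _ _
    have e' : ∀ a, ‖lc (fun n => C • x n) a‖ = C * ‖lc x a‖ := fun a => by
      have e : lc (fun n => C • x n) a = C • lc x a := by
        rw [Finsupp.linearCombination_apply, Finsupp.linearCombination_apply, Finsupp.smul_sum]
        exact Finsupp.sum_congr fun i _ => smul_comm _ _ _
      rw [e, norm_smul, Real.norm_of_nonneg hC.le]
    have := pert_bound (fun n => C • x n) w (c / (4 * C)) (by positivity) (fun a k => by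
      rw [e']
      refine (hCb a k).trans ?_
      have h2 : (1 : ℝ) ≤ 2 ^ k := one_le_pow₀ (by norm_num)
      nlinarith [mul_nonneg hC.le (norm_nonneg (lc x a))]) hq a
    rw [e'] at this
    refine this.trans (le_of_eq ?_)
    field_simp
    ring
  have hsub : ∀ a, lc (fun n => qev v (q n)) a = T (lc x a) + lc w a := fun a => by
    have : (T (lc x a) : B) = lc (fun n => (T (x n) : B)) a := by
      simp [Finsupp.linearCombination_apply, Finsupp.sum, map_sum]
    rw [this]
    simp only [Finsupp.linearCombination_apply, w, ← Finsupp.sum_add]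
    exact Finsupp.sum_congr fun i _ => by rw [← smul_add, add_sub_cancel]
  obtain ⟨m, hm⟩ := exists_nat_ge (2 / c + ‖T‖ + c / 2)
  refine ⟨m, q, fun k => ?_⟩
  rw [List.map_map]
  have hm1 : (0 : ℝ) < m + 1 := by positivity
  have h2c : 2 / c ≤ m + 1 := by linarith [norm_nonneg T]
  refine mem_tree x (qev v ∘ q) (fun a => ?_) (fun a => ?_) k
  · have h3 : 1 / ((m : ℝ) + 1) ≤ c / 2 := by
      rw [div_le_iff₀ hc] at h2c
      rw [div_le_iff₀ hm1]; linarith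
    have h4 : ‖T (lc x a)‖ - ‖lc w a‖ ≤ ‖lc (qev v ∘ q) a‖ := by
      have : lc (qev v ∘ q) a = (T (lc x a) : B) + lc w a := hsub a
      rw [this]
      have := norm_sub_le ((T (lc x a) : B) + lc w a) (lc w a)
      rw [add_sub_cancel_right] at this
      rw [← Submodule.coe_norm] at this
      linarith
    have := mul_le_mul_of_nonneg_right h3 (norm_nonneg (lc x a))
    linarith [hT (lc x a), hw a]
  · have : lc (qev v ∘ q) a = (T (lc x a) : B) + lc w a := hsub a
    rw [this, one_div, inv_inv]
    have h5 := norm_add_le (T (lc x a) : B) (lc w a)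
    rw [← Submodule.coe_norm] at h5
    have h6 := T.le_opNorm (lc x a)
    have h7 : (‖T‖ + c / 2) * ‖lc x a‖ ≤ (m + 1) * ‖lc x a‖ := by
      refine mul_le_mul_of_nonneg_right ?_ (norm_nonneg _)
      have : 0 < 2 / c := by positivity
      linarith
    linarith [hw a]

end

open Filter Topology MeasureTheory

noncomputable section

theorem countable_Iic_of_lt {ξ : Ordinal.{0}} (hξ : ξ < omega1) : Countable (Set.Iic ξ) := by
  have h1 : ξ + 1 < omega1 := by
    have : Order.IsSuccLimit omega1 := Cardinal.isSuccLimit_ord (Cardinal.aleph0_le_aleph 1)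
    exact this.succ_lt hξ
  have h2 : (ξ + 1).card < Cardinal.aleph 1 := Cardinal.lt_ord.1 h1
  have h3 : Cardinal.mk (Set.Iic ξ) ≤ Cardinal.aleph0 := by
    have : Set.Iic ξ = Set.Iio (ξ + 1) := by
      ext; simp [Order.lt_add_one_iff]
    rw [this, Ordinal.mk_Iio_ordinal]
    rw [← Cardinal.succ_aleph0, Order.lt_succ_iff] at h2
    exact Cardinal.lift_le_aleph0.2 h2
  exact Cardinal.mk_le_aleph0_iff.1 h3

theorem rank_tree {X : Type*} [NormedAddCommGroup X] [NormedSpace ℝ X] [CompleteSpace X]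
    {x : ℕ → X} (hb : IsSchauderBasis x) (hn : ∀ n, ‖x n‖ = 1) (hmin : IsMinimal X)
    {ξ : Ordinal.{0}} (hξ : ξ < omega1) : ∃ z : List ℕ → CantorC,
      (∀ σ : ℕ → ℕ, ¬ Embeds X
        (Submodule.span ℝ (Set.range fun n => z (PiNat.res σ (n + 1)))).topologicalClosure) ∧
      ∀ (Z : Type) [NormedAddCommGroup Z] [NormedSpace ℝ Z] [CompleteSpace Z]
          [TopologicalSpace.SeparableSpace Z], bourgainIndex x Z ≤ ξ → ∃ σ : ℕ → ℕ,
        Embeds Z (Submodule.span ℝ (Set.range fun n => z (PiNat.res σ (n + 1)))).topologicalClosure := by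
  classical
  haveI := countable_Iic_of_lt hξ
  haveI : Nonempty (Set.Iic ξ) := ⟨⟨ξ, Set.mem_Iic.2 le_rfl⟩⟩
  obtain ⟨on, hon⟩ := exists_surjective_nat (Set.Iic ξ)
  obtain ⟨cd, hcd⟩ := exists_surjective_nat (ℕ × List (List ℚ))
  let d : ℕ → CantorC := fun n => Nat.casesOn n 0 (TopologicalSpace.denseSeq CantorC)
  have hd : DenseRange d := (TopologicalSpace.denseRange_denseSeq CantorC).mono (by
    rintro _ ⟨n, rfl⟩
    exact ⟨n + 1, rfl⟩)
  let vv : (ℕ → ℕ) → ℕ → CantorC := fun σ n => d (σ n).unpair.1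
  let oo : (ℕ → ℕ) → ℕ → Set.Iic ξ := fun σ n => on (σ n).unpair.2
  let Good : (ℕ → ℕ) → Prop := fun σ => ∀ i j m l a, cd i = (m, l) → cd j = (m, l ++ [a]) →
    (l ++ [a]).map (qev (vv σ)) ∈ bourgainTree x (1 / ((m : ℝ) + 1)) CantorC → oo σ j < oo σ i
  let z : List ℕ → CantorC := fun s =>
    if ∃ σ, Good σ ∧ s = PiNat.res σ s.length then d (s.headD 0).unpair.1 else 0
  have hzg : ∀ σ, Good σ → (fun n => z (PiNat.res σ (n + 1))) = vv σ := by
    intro σ hσ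
    funext n
    show (if _ then _ else _) = _
    rw [if_pos ⟨σ, hσ, by rw [res_len]⟩, PiNat.res_succ]
    rfl
  refine ⟨z, fun τ hE => ?_, fun Z _ _ _ _ hZ => ?_⟩
  · by_cases hA : ∀ n, ∃ σ, Good σ ∧ PiNat.res τ n = PiNat.res σ n
    · have hG : Good τ := by
        intro i j m l a hi hj ht
        set N := (i + 1) + (j + 1) + ((l ++ [a]).map List.length).sum with hN
        obtain ⟨σ, hσ, hres⟩ := hA N
        have heq : ∀ k < N, τ k = σ k := fun k hk => PiNat.res_eq_res.1 hres hk
        have h1 : (l ++ [a]).map (qev (vv σ)) = (l ++ [a]).map (qev (vv τ)) := by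
          refine List.map_congr_left fun q hq => qev_congr fun k hk => ?_
          have := List.single_le_sum (l := (l ++ [a]).map List.length) (by simp) q.length
            (List.mem_map_of_mem hq)
          show d (σ k).unpair.1 = d (τ k).unpair.1
          rw [heq k (by omega)]
        rw [← h1] at ht
        have := hσ i j m l a hi hj ht
        show on (τ j).unpair.2 < on (τ i).unpair.2
        rw [heq j (by omega), heq i (by omega)]
        exact this
      rw [hzg τ hG] at hE
      obtain ⟨m, q, hq⟩ := codes_of_embeds hb hn _ hE
      choose j hj using fun k => hcd (m, (List.range k).map q)
      have hlt : ∀ k, oo τ (j (k + 1)) < oo τ (j k) := by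
        intro k
        have e : (List.range (k + 1)).map q = (List.range k).map q ++ [q k] := by
          rw [List.range_succ, List.map_append]; rfl
        refine hG (j k) (j (k + 1)) m ((List.range k).map q) (q k) (hj k) ?_ ?_
        · rw [hj, e]
        · rw [← e]; exact hq (k + 1)
      exact not_strictAnti_of_wellFoundedLT (fun k => oo τ (j k))
        (strictAnti_nat_of_succ_lt (f := fun k => oo τ (j k)) hlt)
    · push Not at hA
      obtain ⟨n0, hn0⟩ := hA
      have hz0 : ∀ n, n0 ≤ n → z (PiNat.res τ n) = 0 := by
        intro n hn'
        show (if _ then _ else _) = _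
        rw [if_neg]
        rintro ⟨σ, hσ, h⟩
        rw [res_len] at h
        refine hn0 σ hσ (PiNat.res_eq_res.2 fun i hi => PiNat.res_eq_res.1 h (hi.trans_le hn'))
      set s := Set.range fun n => z (PiNat.res τ (n + 1)) with hs
      have hfin : s.Finite := by
        refine Set.Finite.subset (((Set.finite_Iio n0).image
          fun n => z (PiNat.res τ (n + 1))).insert 0) ?_
        rintro _ ⟨n, rfl⟩
        rcases lt_or_ge n n0 with h | h
        · exact Or.inr ⟨n, h, rfl⟩
        · exact Or.inl (hz0 _ (by omega))
      haveI : FiniteDimensional ℝ (Submodule.span ℝ s) := FiniteDimensional.span_of_finite ℝ hfin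
      have hcl : (Submodule.span ℝ s).topologicalClosure = Submodule.span ℝ s :=
        (Submodule.closed_of_finiteDimensional _).submodule_topologicalClosure_eq
      rw [hcl] at hE
      obtain ⟨T, c, hc, hT⟩ := hE
      refine hmin.1 (FiniteDimensional.of_injective T.toLinearMap ?_)
      rw [← LinearMap.ker_eq_bot, LinearMap.ker_eq_bot']
      intro y hy
      have := hT y
      have hy' : T y = 0 := hy
      have h0 : ‖T y‖ = 0 := by rw [hy']; exact norm_zero (E := Submodule.span ℝ s)
      rw [h0] at this
      exact norm_eq_zero.1 (le_antisymm (nonpos_of_mul_nonpos_right this hc) (norm_nonneg y))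
  · obtain ⟨J⟩ := embedsIso_cantorC Z
    obtain ⟨e, k, S, hS, h1, h2, h3⟩ := exists_pert J d hd rfl
    have hδ : ∀ m : ℕ, (1 / ((m : ℝ) + 1)) / 2 ∈ Set.Ioc (0 : ℝ) 1 := fun m => by
      refine ⟨by positivity, ?_⟩
      rw [div_div, div_le_one (by positivity)]
      have : (0 : ℝ) ≤ m := by positivity
      linarith
    choose ρ hρ using fun m => exists_rank_of_index hξ hZ (hδ m)
    choose r hr using fun n => hon (ρ (cd n).1 ((cd n).2.map (qev e)))
    let σ : ℕ → ℕ := fun n => Nat.pair (k n) (r n)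
    have hv : vv σ = fun n => S (e n) := by
      funext n
      show d (Nat.pair (k n) (r n)).unpair.1 = _
      rw [Nat.unpair_pair, hS]
    have ho : ∀ n, oo σ n = ρ (cd n).1 ((cd n).2.map (qev e)) := fun n => by
      show on (Nat.pair (k n) (r n)).unpair.2 = _
      rw [Nat.unpair_pair]; exact hr n
    have hG : Good σ := by
      intro i j m l a hi hj ht
      rw [ho, ho, hi, hj]
      have e1 : (l ++ [a]).map (qev (vv σ)) = ((l ++ [a]).map (qev e)).map S := by
        rw [List.map_map]
        refine List.map_congr_left fun q _ => ?_
        rw [hv, Function.comp_apply, qev_map]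
      rw [e1] at ht
      have h4 := tree_pull x h1 h2 ht
      rw [List.map_append] at h4 ⊢
      exact hρ m _ _ h4
    refine ⟨σ, ?_⟩
    rw [hzg σ hG]
    exact embeds_span_of_pert (fun n => (congrFun hv n).symm) h1 h3

end

open Filter Topology MeasureTheory

noncomputable section

theorem res_succ_eq_append (σ : ℕ → ℕ) (n : ℕ) :
    PiNat.res σ (n + 1) = PiNat.res (fun i => σ (i + 1)) n ++ [σ 0] := by
  induction n with
  | zero => rfl
  | succ n ih => rw [PiNat.res_succ, ih, PiNat.res_succ, List.cons_append]

theorem closedSpan_congr {B : Type*} [NormedAddCommGroup B] [NormedSpace ℝ B] {u v : ℕ → B}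
    (h0 : u 0 = 0) (h : ∀ n, u (n + 1) = v n) :
    Submodule.span ℝ (Set.range u) = Submodule.span ℝ (Set.range v) := by
  refine le_antisymm (Submodule.span_le.2 ?_) (Submodule.span_le.2 ?_)
  · rintro _ ⟨n, rfl⟩
    cases n with
    | zero => rw [h0]; exact Submodule.zero_mem _
    | succ n => rw [h]; exact Submodule.subset_span ⟨n, rfl⟩
  · rintro _ ⟨n, rfl⟩
    rw [← h]; exact Submodule.subset_span ⟨n + 1, rfl⟩

/-- Countably many trees are amalgamated at once. -/
theorem exists_amalgam_countable {B : Type*} [NormedAddCommGroup B] [NormedSpace ℝ B]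
    [CompleteSpace B] {lam : ℝ} (hl : 1 < lam) (zz : ℕ → List ℕ → B) {X : Type*}
    [NormedAddCommGroup X] [NormedSpace ℝ X] [CompleteSpace X] (hmin : IsMinimal X)
    (hXl1 : ¬ Embeds EllOne X)
    (hX : ∀ k, ∀ σ : ℕ → ℕ, ¬ Embeds X
      (Submodule.span ℝ (Set.range fun n => zz k (PiNat.res σ (n + 1)))).topologicalClosure) :
    ∃ Y : SB, IsLinftyPlus lam Y.1 ∧ ¬ Embeds X Y.1 ∧ ∀ k, ∀ σ : ℕ → ℕ,
      Embeds (Submodule.span ℝ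
        (Set.range fun n => zz k (PiNat.res σ (n + 1)))).topologicalClosure Y.1 := by
  let z : List ℕ → B := fun s => if s.length ≤ 1 then 0 else zz (s.getLastD 0) s.dropLast
  have hz : ∀ σ : ℕ → ℕ, Submodule.span ℝ (Set.range fun n => z (PiNat.res σ (n + 1))) =
      Submodule.span ℝ (Set.range fun n => zz (σ 0) (PiNat.res (fun i => σ (i + 1)) (n + 1))) := by
    intro σ
    refine closedSpan_congr ?_ fun n => ?_
    · simp [z]
    · show (if _ then _ else _) = _
      rw [if_neg (by simp), res_succ_eq_append σ (n + 1)]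
      generalize PiNat.res _ (n + 1) = t
      simp
  obtain ⟨Y, h1, h2, h3⟩ := exists_amalgam hl z hmin hXl1 (fun σ => by
    rw [hz]; exact hX _ _)
  refine ⟨Y, h1, h2, fun k σ => ?_⟩
  let τ : ℕ → ℕ := fun n => Nat.casesOn n k σ
  have := h3 τ
  rw [hz] at this
  exact this

theorem closedSpan_SB (Y : SB) : (Submodule.span ℝ (Set.range fun n =>
    ((TopologicalSpace.denseSeq Y.1 n : Y.1) : CantorC))).topologicalClosure = Y.1 := by
  refine le_antisymm (Submodule.topologicalClosure_minimal _ (Submodule.span_le.2 ?_) Y.2) ?_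
  · rintro _ ⟨n, rfl⟩
    exact (TopologicalSpace.denseSeq Y.1 n).2
  · intro y hy
    have h1 : (⟨y, hy⟩ : Y.1) ∈ closure (Set.range (TopologicalSpace.denseSeq Y.1)) :=
      TopologicalSpace.denseRange_denseSeq Y.1 _
    have h2 := image_closure_subset_closure_image (continuous_subtype_val)
      (Set.mem_image_of_mem (Subtype.val : Y.1 → CantorC) h1)
    refine closure_mono ?_ h2
    rintro _ ⟨_, ⟨n, rfl⟩, rfl⟩
    exact Submodule.subset_span ⟨n, rfl⟩

/-- The requirements for stage `ξ`, given the earlier stages. -/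
def StageOK {X : Type*} [NormedAddCommGroup X] [NormedSpace ℝ X] (x : ℕ → X) (lam : ℝ)
    (ξ : Ordinal.{0}) (prev : ∀ ζ : Ordinal.{0}, ζ < ξ → SB) (Y : SB) : Prop :=
  IsLinftyPlus lam ↥Y.1 ∧ ¬ Embeds X ↥Y.1 ∧ (∀ ζ (h : ζ < ξ), Embeds ↥(prev ζ h).1 ↥Y.1) ∧
  ∀ (Z : Type) [NormedAddCommGroup Z] [NormedSpace ℝ Z] [CompleteSpace Z]
    [TopologicalSpace.SeparableSpace Z], bourgainIndex x Z ≤ ξ → Embeds Z ↥Y.1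

theorem exists_stage {X : Type*} [NormedAddCommGroup X] [NormedSpace ℝ X] [CompleteSpace X]
    {x : ℕ → X} (hb : IsSchauderBasis x) (hn : ∀ n, ‖x n‖ = 1) (hmin : IsMinimal X)
    (hXl1 : ¬ Embeds EllOne X) {lam : ℝ} (hl : 1 < lam) {ξ : Ordinal.{0}} (hξ : ξ < omega1)
    (prev : ∀ ζ : Ordinal.{0}, ζ < ξ → SB) (hprev : ∀ ζ h, ¬ Embeds X ↥(prev ζ h).1) :
    ∃ Y, StageOK x lam ξ prev Y := by
  classical
  obtain ⟨z, hz1, hz2⟩ := rank_tree hb hn hmin hξ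
  haveI := countable_Iic_of_lt hξ
  haveI : Countable (Set.Iio ξ) :=
    (Set.inclusion_injective (Set.Iio_subset_Iic_self (a := ξ))).countable
  obtain ⟨on, hon⟩ := exists_surjective_nat (Option (Set.Iio ξ))
  let tr : Option (Set.Iio ξ) → List ℕ → CantorC := fun o => match o with
    | none => z
    | some ζ => fun s => ((TopologicalSpace.denseSeq (prev ζ.1 ζ.2).1 (s.length - 1) :
        (prev ζ.1 ζ.2).1) : CantorC)
  have htr : ∀ (ζ : Set.Iio ξ) (σ : ℕ → ℕ), (Submodule.span ℝ (Set.range fun n =>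
      tr (some ζ) (PiNat.res σ (n + 1)))).topologicalClosure = (prev ζ.1 ζ.2).1 := by
    intro ζ σ
    rw [← closedSpan_SB (prev ζ.1 ζ.2)]
    congr 4
    funext n
    simp [tr]
  obtain ⟨Y, h1, h2, h3⟩ := exists_amalgam_countable hl (fun k => tr (on k)) hmin hXl1 (by
    intro k σ
    show ¬ Embeds X (Submodule.span ℝ (Set.range fun n =>
      tr (on k) (PiNat.res σ (n + 1)))).topologicalClosure
    cases on k with
    | none => exact hz1 σ
    | some ζ => rw [htr]; exact hprev _ _)
  have h4 : ∀ (o : Option (Set.Iio ξ)) (σ : ℕ → ℕ), Embeds (Submodule.span ℝ (Set.range fun n =>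
      tr o (PiNat.res σ (n + 1)))).topologicalClosure Y.1 := by
    intro o σ
    obtain ⟨k, rfl⟩ := hon o
    exact h3 k σ
  refine ⟨Y, h1, h2, fun ζ h => ?_, fun Z _ _ _ _ hZ => ?_⟩
  · have := h4 (some ⟨ζ, h⟩) (fun _ => 0)
    rw [htr] at this
    exact this
  · obtain ⟨σ, hσ⟩ := hz2 Z hZ
    exact hσ.trans' (h4 none σ)

open Classical in
/-- The transfinite family. -/
def famY {X : Type*} [NormedAddCommGroup X] [NormedSpace ℝ X] (x : ℕ → X) (lam : ℝ) :
    Ordinal.{0} → SB :=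
  WellFounded.fix (C := fun _ => SB) (Ordinal.lt_wf.{0}) fun ξ prev =>
    if h : ∃ Y, StageOK x lam ξ prev Y then h.choose else ⟨⊥, isClosed_singleton⟩

theorem famY_ok {X : Type*} [NormedAddCommGroup X] [NormedSpace ℝ X] [CompleteSpace X]
    {x : ℕ → X} (hb : IsSchauderBasis x) (hn : ∀ n, ‖x n‖ = 1) (hmin : IsMinimal X)
    (hXl1 : ¬ Embeds EllOne X) {lam : ℝ} (hl : 1 < lam) (ξ : Ordinal.{0}) (hξ : ξ < omega1) :
    StageOK x lam ξ (fun ζ _ => famY x lam ζ) (famY x lam ξ) := by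
  induction ξ using Ordinal.lt_wf.induction with
  | _ ξ ih =>
    have h : ∃ Y, StageOK x lam ξ (fun ζ _ => famY x lam ζ) Y :=
      exists_stage hb hn hmin hXl1 hl hξ _ fun ζ hζ => (ih ζ hζ (hζ.trans hξ)).2.1
    have e : famY x lam ξ = h.choose := by
      conv_lhs => rw [famY, WellFounded.fix_eq]
      exact dif_pos h
    rw [e]
    exact h.choose_spec

end

/-- **Corollary.** Let `X` be a minimal Banach space with a (normalized) Schauder
basis, not containing `ℓ₁`. For every `λ > 1` there is a family `{Y_ξ : ξ < ω₁}` of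
separable Banach spaces such that: (i) every `Y_ξ` is `𝓛_{∞,λ+}` and contains no
isomorphic copy of `X`; (ii) `Y_ξ` embeds into `Y_ζ` for `ξ < ζ < ω₁`; (iii) every
separable Banach space `Z` with `φ_{NC_X}(Z) ≤ ξ` embeds into `Y_ξ`. -/
theorem linfty_family_exhausting_NCX (X : Type*) [NormedAddCommGroup X]
    [NormedSpace ℝ X] [CompleteSpace X]
    (x : ℕ → X) (hbasis : IsSchauderBasis x) (hnorm : ∀ n, ‖x n‖ = 1)
    (hmin : IsMinimal X) (hXl1 : ¬ Embeds EllOne X)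
    (lam : ℝ) (hlam : 1 < lam) :
    ∃ Y : Ordinal.{0} → SB,
      (∀ ξ : Ordinal.{0}, ξ < omega1 →
        IsLinftyPlus lam ↥(Y ξ).1 ∧ ¬ Embeds X ↥(Y ξ).1) ∧
      (∀ ξ ζ : Ordinal.{0}, ξ < ζ → ζ < omega1 → Embeds ↥(Y ξ).1 ↥(Y ζ).1) ∧
      (∀ ξ : Ordinal.{0}, ξ < omega1 →
        ∀ (Z : Type) [NormedAddCommGroup Z] [NormedSpace ℝ Z] [CompleteSpace Z]
          [TopologicalSpace.SeparableSpace Z],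
          bourgainIndex x Z ≤ ξ → Embeds Z ↥(Y ξ).1) := by
  exact ⟨famY x lam,
    fun ξ h => ⟨(famY_ok hbasis hnorm hmin hXl1 hlam ξ h).1,
      (famY_ok hbasis hnorm hmin hXl1 hlam ξ h).2.1⟩,
    fun ξ ζ h hζ => (famY_ok hbasis hnorm hmin hXl1 hlam ζ hζ).2.2.1 ξ h,
    fun ξ h => (famY_ok hbasis hnorm hmin hXl1 hlam ξ h).2.2.2⟩
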